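/- arXiv:2209.03265 — 13 statements merged into one kernel-verified Lean document; each statement's English description precedes it below -/
import Mathlib

section
/- Let p ≥ 2 be a prime number and let s(0), s(1), … be a sequence of distinct integers satisfying: (1) for every integer k ≥ 0 and every integer m with 1 ≤ m < p^{k+1}, there exist integers i and j with 0 ≤ i < j ≤ p^k such that m divides s(j) − s(i); and (2) for every integer k ≥ 0 and all integers i, j with 0 ≤ i < j < p^{k+1}, p^{k+1} does not divide s(j) − s(i). Then for every n ≥ 1, the discriminator satisfies D_s(n) = p^{⌈log_p n⌉}. -/
/-- If a sequence of distinct integers satisfies the two divisibility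
conditions, then its discriminator is `p ^ ⌈log_p n⌉`, the smallest power of `p`
that is `≥ n` (expressed as `p ^ Nat.clog p n`). -/
theorem stmt_0 (p : ℕ) (hp2 : 2 ≤ p) (hp : p.Prime) (s : ℕ → ℤ)
    (hs : Function.Injective s)
    (h1 : ∀ k m : ℕ, 1 ≤ m → m < p ^ (k + 1) →
      ∃ i j : ℕ, i < j ∧ j ≤ p ^ k ∧ (m : ℤ) ∣ s j - s i)
    (h2 : ∀ k i j : ℕ, i < j → j < p ^ (k + 1) →
      ¬ ((p : ℤ) ^ (k + 1) ∣ s j - s i)) :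
    ∀ n : ℕ, 1 ≤ n →
      IsLeast {m : ℕ | 0 < m ∧ ∀ i j : ℕ, i < j → j < n → ¬ ((m : ℤ) ∣ s j - s i)}
        (p ^ Nat.clog p n) := by
  intro n hn
  have hle : n ≤ p ^ Nat.clog p n := Nat.le_pow_clog hp2 n
  have hlt : ∀ k, k < Nat.clog p n → p ^ k < n := by
    intro k hk
    by_contra hc
    exact absurd ((Nat.clog_le_iff_le_pow hp2).2 (not_lt.1 hc)) (by omega)
  generalize Nat.clog p n = c at hle hlt
  cases c with
  | zero =>
    rw [pow_zero] at hle ⊢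
    refine ⟨⟨one_pos, ?_⟩, fun m hm => hm.1⟩
    intro i j hij hj
    omega
  | succ k =>
    refine ⟨⟨pow_pos hp.pos _, ?_⟩, ?_⟩
    · intro i j hij hj
      have := h2 k i j hij (by omega)
      simpa using this
    · rintro m ⟨hm0, hm⟩
      by_contra hc
      obtain ⟨i, j, hij, hj, hd⟩ := h1 k m hm0 (not_le.1 hc)
      exact hm i j hij (lt_of_le_of_lt hj (hlt k (by omega))) hd
end

section
/- Let p ≥ 3 be a prime number, let α′ and β′ be odd integers and γ an integer, and let qr(n) = (α′/2)n² + (β′/2)n + γ (an integer-valued quadratic). Suppose at least one of the following holds: (1) p does not divide α′; (2) p divides β′; (3) α′ = p^k·c for some integers k ≥ 1 and c with p not dividing c and c not dividing β′. Then there exists an integer n ≥ 1 such that p^{⌈log_p n⌉} is not the least positive integer m for which qr(0), qr(1), …, qr(n−1) are pairwise incongruent modulo m. -/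
lemma dens_aux (a L u v : ℝ) (hL : 0 < L) (hirr : Irrational (a / L)) (huv : u < v) (N0 : ℕ) :
    ∃ N : ℕ, N0 ≤ N ∧ ∃ z : ℤ, u < N * a - z * L ∧ N * a - z * L < v := by
  have : Fact (0 < L) := ⟨hL⟩
  have h1 : DenseRange (· • (a : AddCircle L) : ℤ → AddCircle L) :=
    AddCircle.denseRange_zsmul_coe_iff.2 hirr
  have h2 : DenseRange (· • (a : AddCircle L) : ℕ → AddCircle L) :=
    denseRange_zsmul_iff_nsmul.1 h1
  have hopen : IsOpen ((fun x : ℝ => (x : AddCircle L)) '' Set.Ioo (u - N0 * a) (v - N0 * a)) :=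
    QuotientAddGroup.isOpenMap_coe _ isOpen_Ioo
  have hne : ((fun x : ℝ => (x : AddCircle L)) '' Set.Ioo (u - N0 * a) (v - N0 * a)).Nonempty :=
    (Set.nonempty_Ioo.2 (by linarith)).image _
  obtain ⟨n, y, hy, hyn⟩ := h2.exists_mem_open hopen hne
  have hyn' : (y : AddCircle L) = ((n * a : ℝ) : AddCircle L) := by
    rw [← nsmul_eq_mul, AddCircle.coe_nsmul]; exact hyn
  have hz : ((n * a - y : ℝ) : AddCircle L) = 0 := by
    rw [AddCircle.coe_sub, hyn', sub_self]
  obtain ⟨z, hz⟩ := (AddCircle.coe_eq_zero_iff L).1 hz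
  rw [zsmul_eq_mul] at hz
  refine ⟨N0 + n, by omega, z, ?_, ?_⟩ <;> push_cast <;> rw [hz] <;>
    nlinarith [hy.1, hy.2]

lemma irr_aux (p T : ℕ) (hp3 : 3 ≤ p) (hodd : Odd p) (hT : 1 ≤ T) :
    Irrational ((T * Real.log 2) / Real.log p) := by
  have hLp : 0 < Real.log p := Real.log_pos (by exact_mod_cast (by omega : 1 < p))
  have hL2 : 0 < Real.log 2 := Real.log_pos (by norm_num)
  rw [irrational_iff_ne_rational]
  intro m d hd heq
  have hd0 : (d : ℝ) ≠ 0 := by exact_mod_cast hd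
  have hTpos : (0 : ℝ) < T := by exact_mod_cast hT
  have h1 : (T * d : ℝ) * Real.log 2 = m * Real.log p := by
    field_simp at heq
    linarith
  have h2 : ((T * d.natAbs : ℕ) : ℝ) * Real.log 2 = (m.natAbs : ℕ) * Real.log p := by
    have := congrArg abs h1
    rw [abs_mul, abs_mul, abs_mul, abs_of_pos hLp, abs_of_pos hL2, abs_of_pos hTpos] at this
    rw [Nat.cast_mul, Nat.cast_natAbs, Nat.cast_natAbs]
    push_cast
    exact this
  rw [← Real.log_pow, ← Real.log_pow] at h2
  have h3 : (2 : ℝ) ^ (T * d.natAbs) = (p : ℝ) ^ m.natAbs :=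
    Real.log_injOn_pos (Set.mem_Ioi.2 (by positivity))
      (Set.mem_Ioi.2 (pow_pos (by exact_mod_cast (by omega : 0 < p)) _)) h2
  have h4 : 2 ^ (T * d.natAbs) = p ^ m.natAbs := by exact_mod_cast h3
  have h5 : Odd (p ^ m.natAbs) := hodd.pow
  rw [← h4] at h5
  have h6 : Even (2 ^ (T * d.natAbs)) := by
    refine (Nat.even_pow.2 ⟨even_two, ?_⟩)
    have : d.natAbs ≠ 0 := Int.natAbs_ne_zero.2 hd
    positivity
  exact (Nat.not_even_iff_odd.2 h5) h6

lemma key_aux (p T i K : ℕ) (hp3 : 3 ≤ p) (hodd : Odd p) (hT : 1 ≤ T) :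
    ∃ l e : ℕ, T ∣ l + 1 + i ∧ K ≤ l ∧ 5 * p ^ e < 2 * 2 ^ l ∧ 2 ^ l < p ^ (e + 1) := by
  have hp0 : (0 : ℝ) < p := by exact_mod_cast (by omega : 0 < p)
  have hLp : 0 < Real.log p := Real.log_pos (by exact_mod_cast (by omega : 1 < p))
  have hL2 : 0 < Real.log 2 := Real.log_pos (by norm_num)
  have huv : Real.log (5 / 2) + (i + 1) * Real.log 2 < Real.log p + (i + 1) * Real.log 2 := by
    have : Real.log (5 / 2) < Real.log p := by
      apply Real.log_lt_log (by norm_num)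
      have : (3 : ℝ) ≤ p := by exact_mod_cast hp3
      linarith
    linarith
  obtain ⟨N, hN, z, hz1, hz2⟩ := dens_aux _ _ _ _ hLp (irr_aux p T hp3 hodd hT) huv (K + i + 1)
  have hTN : N ≤ T * N := Nat.le_mul_of_pos_left N hT
  obtain ⟨l, hl⟩ : ∃ l, T * N = l + 1 + i := ⟨T * N - 1 - i, by omega⟩
  have hlr : (N * (T * Real.log 2) : ℝ) = (l + 1 + i) * Real.log 2 := by
    have : (T * N : ℝ) = l + 1 + i := by exact_mod_cast hl
    rw [← this]; ring
  rw [hlr] at hz1 hz2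
  have hz0 : 0 ≤ z := by
    have h1 : 0 ≤ (l : ℝ) * Real.log 2 := by positivity
    have h2 : 0 < ((z : ℝ) + 1) * Real.log p := by nlinarith
    have h3 : (0 : ℝ) < (z : ℝ) + 1 := pos_of_mul_pos_left h2 hLp.le
    have h4 : 0 < z + 1 := by exact_mod_cast h3
    omega
  obtain ⟨e, rfl⟩ := Int.eq_ofNat_of_zero_le hz0
  push_cast at hz1 hz2
  refine ⟨l, e, ⟨N, hl.symm⟩, by omega, ?_, ?_⟩
  · have : Real.log (5 / 2 * (p : ℝ) ^ e) < Real.log (2 ^ l) := by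
      rw [Real.log_mul (by norm_num) (by positivity), Real.log_pow, Real.log_pow]
      linarith
    have := (Real.log_lt_log_iff (by positivity) (by positivity)).1 this
    have h : (5 * (p : ℝ) ^ e) < 2 * 2 ^ l := by linarith
    exact_mod_cast h
  · have : Real.log (2 ^ l) < Real.log ((p : ℝ) ^ (e + 1)) := by
      rw [Real.log_pow, Real.log_pow]
      push_cast
      linarith
    have := (Real.log_lt_log_iff (by positivity) (by positivity)).1 this
    exact_mod_cast this

lemma orbit_aux (α β : ℤ) (hα : 0 < α) (hodd : Odd α) (hndvd : ¬ α ∣ β) :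
    ∃ i : ℕ, α ≤ 2 * ((2 ^ i * β) % α) := by
  by_contra! hcon
  have hpow : ∀ i : ℕ, (2 ^ i * β) % α = 2 ^ i * (β % α) := by
    intro i
    induction i with
    | zero => simp
    | succ k ih =>
      have h0 := Int.emod_nonneg (2 ^ k * β) hα.ne'
      rw [pow_succ', mul_assoc, Int.mul_emod, ← Int.emod_emod_of_dvd (2 ^ k * β) (dvd_refl α),
        ← Int.mul_emod,
        Int.emod_eq_of_lt (by omega) (hcon k), ih]
      ring
  have hpos : 0 < β % α := by
    rcases (Int.emod_nonneg β hα.ne').lt_or_eq with h | h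
    · exact h
    · exact absurd (Int.dvd_of_emod_eq_zero h.symm) hndvd
  have h1 := hcon α.toNat
  rw [hpow] at h1
  have h2 : (α.toNat : ℤ) < 2 ^ α.toNat := by exact_mod_cast Nat.lt_two_pow_self
  rw [Int.toNat_of_nonneg hα.le] at h2
  nlinarith

lemma core_pos (p : ℕ) (hp3 : 3 ≤ p) (hp : p.Prime) (α β : ℤ) (hα : 0 < α) (hodd : Odd α)
    (hpα : (p : ℤ) ∣ α) (hpβ : ¬ (p : ℤ) ∣ β) :
    ∃ l e : ℕ, p ^ e < 2 ^ l ∧ 2 ^ l < p ^ (e + 1) ∧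
      ∀ s : ℕ, s < 2 * p ^ e → ¬ ((2 : ℤ) ^ (l + 1) ∣ α * s + β) := by
  have hpodd : Odd p := hp.odd_of_ne_two (by omega)
  obtain ⟨i, hi⟩ := orbit_aux α β hα hodd (fun h => hpβ (hpα.trans h))
  have hcop : Nat.Coprime 2 α.natAbs := by
    rw [Nat.coprime_two_left]; exact Int.natAbs_odd.2 hodd
  have hT : 1 ≤ Nat.totient α.natAbs := Nat.totient_pos.2 (by omega)
  obtain ⟨l, e, hdvd, hK, h1, h2⟩ := key_aux p _ i (10 * p * β.natAbs + 10) hp3 hpodd hT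
  have hpe : 0 < p ^ e := by positivity
  have hbig : 10 * p * β.natAbs + 10 < p * p ^ e := by
    have : l < 2 ^ l := Nat.lt_two_pow_self
    rw [pow_succ'] at h2
    omega
  have hbig' : 10 * β.natAbs < p ^ e := by
    have : p * (10 * β.natAbs) < p * p ^ e := by nlinarith
    exact Nat.lt_of_mul_lt_mul_left this
  refine ⟨l, e, by omega, h2, ?_⟩
  rintro s hs ⟨t, ht⟩
  have hbz : 10 * |β| < (p : ℤ) ^ e := by
    rw [Int.abs_eq_natAbs]; exact_mod_cast hbig'
  have h1z : 5 * (p : ℤ) ^ e < 2 * 2 ^ l := by exact_mod_cast h1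
  have hsz : (s : ℤ) < 2 * (p : ℤ) ^ e := by exact_mod_cast hs
  have hb1 := neg_abs_le β
  have hb2 := le_abs_self β
  have h2l : (0 : ℤ) < 2 ^ l := by positivity
  rw [pow_succ] at ht
  have hs0 : 0 ≤ α * (s : ℤ) := by positivity
  have ht0 : 0 ≤ t := by
    by_contra hneg
    push Not at hneg
    have : (2 : ℤ) ^ l * 2 * t ≤ (2 : ℤ) ^ l * 2 * (-1) := by
      apply mul_le_mul_of_nonneg_left _ (by positivity)
      omega
    linarith
  have ht1 : 2 * t < α := by
    have hA : α * (s : ℤ) + β < α * 2 ^ l := by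
      have : (s : ℤ) + |β| < 2 ^ l := by linarith
      have h3 : β ≤ α * |β| := by nlinarith [abs_nonneg β]
      nlinarith
    rw [ht] at hA
    have : (2 : ℤ) ^ l * (2 * t) < 2 ^ l * α := by linarith
    exact lt_of_mul_lt_mul_left this h2l.le
  -- multiply by 2^i
  have hone : (2 : ℤ) ^ (l + 1 + i) ≡ 1 [ZMOD α] := by
    obtain ⟨c, hc⟩ := hdvd
    have h := Nat.ModEq.pow_totient hcop
    have h' : ((2 ^ Nat.totient α.natAbs : ℕ) : ℤ) ≡ ((1 : ℕ) : ℤ) [ZMOD (α.natAbs : ℤ)] :=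
      Int.natCast_modEq_iff.2 h
    rw [Int.natAbs_of_nonneg hα.le] at h'
    push_cast at h'
    rw [hc, pow_mul]
    simpa using h'.pow c
  have hmod : t ≡ 2 ^ i * β [ZMOD α] := by
    have e1 : (2 : ℤ) ^ (l + 1 + i) * t = 2 ^ i * β + α * (2 ^ i * s) := by
      have : (2 : ℤ) ^ (l + 1 + i) * t = 2 ^ i * (2 ^ l * 2 * t) := by ring
      rw [this, ← ht]; ring
    have e2 : (2 : ℤ) ^ (l + 1 + i) * t ≡ 1 * t [ZMOD α] := hone.mul_right t
    rw [e1, one_mul] at e2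
    refine e2.symm.trans ?_
    simp [Int.ModEq]
  have : t = (2 ^ i * β) % α := by
    rw [← hmod, Int.emod_eq_of_lt ht0 (by omega)]
  omega

lemma core (p : ℕ) (hp3 : 3 ≤ p) (hp : p.Prime) (α β : ℤ) (hodd : Odd α)
    (hpα : (p : ℤ) ∣ α) (hpβ : ¬ (p : ℤ) ∣ β) :
    ∃ l e : ℕ, p ^ e < 2 ^ l ∧ 2 ^ l < p ^ (e + 1) ∧
      ∀ s : ℕ, s < 2 * p ^ e → ¬ ((2 : ℤ) ^ (l + 1) ∣ α * s + β) := by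
  rcases lt_trichotomy α 0 with h | h | h
  · obtain ⟨l, e, h1, h2, h3⟩ := core_pos p hp3 hp (-α) (-β) (by omega) hodd.neg
      (by rwa [dvd_neg]) (by rwa [dvd_neg])
    refine ⟨l, e, h1, h2, fun s hs hd => h3 s hs ?_⟩
    have : -α * (s : ℤ) + -β = -(α * s + β) := by ring
    rw [this, dvd_neg]; exact hd
  · subst h; simp at hodd
  · exact core_pos p hp3 hp α β h hodd hpα hpβ

/-- If `p ∤ α`, two distinct indices below `p` have `p ∣ α (i+j) + β`. -/
lemma pair_aux (p : ℕ) (hp3 : 3 ≤ p) (hp : p.Prime) (α β : ℤ) (hpα : ¬ (p : ℤ) ∣ α) :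
    ∃ i j : ℕ, i < j ∧ j < p ∧ (p : ℤ) ∣ α * ((i : ℤ) + j) + β := by
  have hpZ : Prime (p : ℤ) := Nat.prime_iff_prime_int.1 hp
  have hc : IsCoprime α (p : ℤ) := ((Prime.coprime_iff_not_dvd hpZ).2 hpα).symm
  obtain ⟨u, v, huv⟩ := hc
  have hp0 : (0 : ℤ) < p := by omega
  have hr0 := Int.emod_nonneg (-β * u) hp0.ne'
  have hr1 := Int.emod_lt_of_pos (-β * u) hp0
  have hdm := Int.emod_add_mul_ediv (-β * u) p
  obtain ⟨r, hr⟩ := Int.eq_ofNat_of_zero_le hr0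
  rw [hr] at hdm hr1
  have hrp : r < p := by exact_mod_cast hr1
  have hres : ∀ s : ℤ, (s = r ∨ s = r + p) → (p : ℤ) ∣ α * s + β := by
    have base : (p : ℤ) ∣ α * r + β := by
      refine ⟨β * v - α * (-β * u / p), ?_⟩
      have : (r : ℤ) = -β * u - p * (-β * u / p) := by
        linarith
      rw [this]
      linear_combination -β * huv
    rintro s (rfl | rfl)
    · exact base
    · have : α * ((r : ℤ) + p) + β = (α * r + β) + p * α := by ring
      rw [this]; exact base.add (Dvd.intro _ rfl)
  by_cases h0 : r = 0
  · exact ⟨1, p - 1, by omega, by omega, hres _ (Or.inr (by push_cast [h0]; omega))⟩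
  · exact ⟨0, r, by omega, hrp, hres _ (Or.inl (by simp))⟩

theorem stmt_2 (p : ℕ) (hp3 : 3 ≤ p) (hp : p.Prime) (α' β' γ : ℤ)
    (hα' : Odd α') (hβ' : Odd β')
    (qr : ℕ → ℤ) (hqr : ∀ n : ℕ, 2 * qr n = α' * (n : ℤ) ^ 2 + β' * (n : ℤ) + 2 * γ)
    (h : (¬ (p : ℤ) ∣ α') ∨ ((p : ℤ) ∣ β') ∨
      (∃ (k : ℕ) (c : ℤ), 1 ≤ k ∧ α' = (p : ℤ) ^ k * c ∧ ¬ (p : ℤ) ∣ c ∧ ¬ c ∣ β')) :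
    ∃ n : ℕ, 1 ≤ n ∧
      ¬ IsLeast {m : ℕ | 0 < m ∧ ∀ i j : ℕ, i < j → j < n → ¬ ((m : ℤ) ∣ qr j - qr i)}
        (p ^ Nat.clog p n) := by
  have hp1 : 1 < p := by omega
  have hdiff : ∀ i j : ℕ, 2 * (qr j - qr i) = ((j : ℤ) - i) * (α' * ((i : ℤ) + j) + β') := by
    intro i j
    have := hqr i
    have := hqr j
    linarith
  have hpodd : Odd p := hp.odd_of_ne_two (by omega)
  have hc2 : IsCoprime (p : ℤ) 2 := by
    have : Nat.Coprime p 2 := Nat.coprime_two_right.2 hpodd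
    exact_mod_cast Nat.isCoprime_iff_coprime.2 this
  by_cases hpα : (p : ℤ) ∣ α'
  · by_cases hpβ : (p : ℤ) ∣ β'
    · refine ⟨2, by norm_num, fun hL => ?_⟩
      have hcl : Nat.clog p 2 = 1 := by
        rw [Nat.clog_eq_one (by norm_num) (by omega)]
      rw [hcl, pow_one] at hL
      refine hL.1.2 0 1 (by norm_num) (by norm_num) (hc2.dvd_of_dvd_mul_left ?_)
      rw [hdiff]
      exact Dvd.dvd.mul_left ((hpα.mul_right _).add hpβ) _
    · obtain ⟨l, e, h1, h2, h3⟩ := core p hp3 hp α' β' hα' hpα hpβ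
      refine ⟨p ^ e + 1, by omega, fun hL => ?_⟩
      have hcl : p ^ Nat.clog p (p ^ e + 1) = p ^ (e + 1) := by
        congr 1
        apply le_antisymm
        · exact (Nat.clog_le_iff_le_pow hp1).2 (by rw [pow_succ] at *; nlinarith)
        · exact (Nat.lt_clog_iff_pow_lt hp1).2 (by omega)
      rw [hcl] at hL
      have hmem : (2 ^ l : ℕ) ∈ {m : ℕ | 0 < m ∧ ∀ i j : ℕ, i < j → j < p ^ e + 1 →
          ¬ ((m : ℤ) ∣ qr j - qr i)} → False := fun hm => absurd (hL.2 hm) (by omega)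
      refine hmem ⟨by positivity, ?_⟩
      intro i j hij hj hd
      have hd2 : (2 : ℤ) ^ (l + 1) ∣ ((j : ℤ) - i) * (α' * ((i : ℤ) + j) + β') := by
        rw [← hdiff, pow_succ']
        exact mul_dvd_mul_left 2 (by exact_mod_cast hd)
      rcases Int.even_or_odd ((j : ℤ) - i) with he | ho
      · have hodd : Odd (α' * ((i : ℤ) + j) + β') := by
          have : Even ((i : ℤ) + j) := by
            have : (i : ℤ) + j = ((j : ℤ) - i) + 2 * i := by ring
            rw [this]; exact he.add (even_two_mul _)
          exact (this.mul_left _).add_odd hβ'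
        have hcop : IsCoprime ((2 : ℤ) ^ (l + 1)) (α' * ((i : ℤ) + j) + β') :=
          (Int.isCoprime_two_left.2 hodd).pow_left
        have := Int.le_of_dvd (by omega) (hcop.dvd_of_dvd_mul_right hd2)
        have h1z : (p : ℤ) ^ e < 2 ^ l := by exact_mod_cast h1
        have hjz : (j : ℤ) < (p : ℤ) ^ e + 1 := by exact_mod_cast hj
        rw [pow_succ] at this
        omega
      · have hcop : IsCoprime ((2 : ℤ) ^ (l + 1)) ((j : ℤ) - i) :=
          (Int.isCoprime_two_left.2 ho).pow_left
        refine h3 (i + j) (by omega) ?_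
        push_cast
        exact hcop.dvd_of_dvd_mul_left hd2
  · obtain ⟨i, j, hij, hj, hd⟩ := pair_aux p hp3 hp α' β' hpα
    refine ⟨p, by omega, fun hL => ?_⟩
    have hcl : Nat.clog p p = 1 := by
      rw [Nat.clog_eq_one (by omega) (by omega)]
    rw [hcl, pow_one] at hL
    refine hL.1.2 i j hij hj (hc2.dvd_of_dvd_mul_left ?_)
    rw [hdiff]
    exact hd.mul_left _
end

section
/- Let t ≥ 1 be an integer, b an odd integer, and qd(n) = 2^t·n² + b·n. Then for every integer k ≥ 0 and every positive integer m < 2^{k+1}, there exists at least one pair of integers i, j with 0 ≤ i < j ≤ 2^k such that m divides qd(j) − qd(i). -/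
lemma exists_res (d : ℕ) (hd : Odd d) (u : ℕ) (c : ℤ) :
    ∃ i : ℕ, i < d ∧ (d : ℤ) ∣ 2 ^ u * (i : ℤ) + c := by
  have hpos : 0 < (d : ℤ) := by exact_mod_cast hd.pos
  have hc : IsCoprime ((2 : ℤ) ^ u) (d : ℤ) := by
    apply IsCoprime.pow_left
    have h2 : Nat.Coprime 2 d := (Nat.coprime_two_left).2 hd
    exact_mod_cast Nat.isCoprime_iff_coprime.2 h2
  obtain ⟨x, y, hxy⟩ := hc
  have h0 := Int.emod_nonneg (-c * x) hpos.ne'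
  have h1 := Int.emod_lt_of_pos (-c * x) hpos
  refine ⟨((-c * x) % d).toNat, by omega, ?_⟩
  rw [Int.toNat_of_nonneg h0, Int.emod_def]
  refine ⟨c * y - 2 ^ u * (-c * x / d), ?_⟩
  linear_combination (-c) * hxy

/-- For `qd(n) = 2^t n² + b n` with `t ≥ 1` and `b` odd, for every
`k ≥ 0` and every positive `m < 2^(k+1)` there are `0 ≤ i < j ≤ 2^k` with
`m ∣ qd(j) − qd(i)`. -/
theorem stmt_3 (t : ℕ) (ht : 1 ≤ t) (b : ℤ) (hb : Odd b)
    (qd : ℕ → ℤ) (hqd : ∀ n : ℕ, qd n = 2 ^ t * (n : ℤ) ^ 2 + b * (n : ℤ)) :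
    ∀ k m : ℕ, 0 < m → m < 2 ^ (k + 1) →
      ∃ i j : ℕ, i < j ∧ j ≤ 2 ^ k ∧ (m : ℤ) ∣ qd j - qd i := by
  intro k m hm hmk
  have hq : ∀ i j : ℕ, qd j - qd i = ((j : ℤ) - i) * (2 ^ t * ((i : ℤ) + j) + b) := by
    intro i j
    rw [hqd, hqd]; ring
  obtain ⟨e, d, hd, rfl⟩ := Nat.exists_eq_two_pow_mul_odd hm.ne'
  have hdp := hd.pos
  rcases Nat.eq_zero_or_pos e with rfl | he
  · obtain ⟨s, hs, hdv⟩ := exists_res d hd t (2 ^ t + b)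
    simp only [pow_zero, one_mul] at hmk ⊢
    rw [pow_succ] at hmk
    have key : ∀ i j : ℕ, i + j = s + 1 → (d : ℤ) ∣ qd j - qd i := by
      intro i j hij
      rw [hq]
      apply Dvd.dvd.mul_left
      have : (i : ℤ) + j = s + 1 := by exact_mod_cast hij
      rw [this]
      exact hdv.imp fun w hw => by linear_combination hw
    have hodd : d % 2 = 1 := Nat.odd_iff.1 hd
    by_cases h : s + 1 ≤ 2 ^ k
    · exact ⟨0, s + 1, by omega, h, key _ _ (by omega)⟩
    · exact ⟨s + 1 - 2 ^ k, 2 ^ k, by omega, le_rfl, key _ _ (by omega)⟩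
  · obtain ⟨i, hi, hdv⟩ := exists_res d hd (t + 1) (2 ^ t * 2 ^ e + b)
    have hek : e < k + 1 := by
      apply (Nat.pow_lt_pow_iff_right (a := 2) (by norm_num)).1
      exact lt_of_le_of_lt (Nat.le_mul_of_pos_right _ hdp) hmk
    obtain ⟨f, rfl⟩ := Nat.exists_eq_add_of_le (Nat.lt_succ_iff.1 hek)
    have hP : 2 ≤ 2 ^ e := by
      calc 2 = 2 ^ 1 := rfl
        _ ≤ 2 ^ e := Nat.pow_le_pow_right (by norm_num) he
    have hM : 1 ≤ 2 ^ f := Nat.one_le_two_pow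
    have hdM : d < 2 ^ f * 2 := by
      rw [add_assoc, pow_add, pow_succ] at hmk
      exact Nat.lt_of_mul_lt_mul_left hmk
    refine ⟨i, i + 2 ^ e, by omega, ?_, ?_⟩
    · rw [pow_add]
      generalize 2 ^ e = P at *
      generalize 2 ^ f = M at *
      obtain ⟨p, rfl⟩ := Nat.exists_eq_add_of_le hP
      obtain ⟨q, rfl⟩ := Nat.exists_eq_add_of_le hM
      have : d % 2 = 1 := Nat.odd_iff.1 hd
      nlinarith [Nat.zero_le (p * q)]
    · rw [hq]
      push_cast
      apply mul_dvd_mul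
      · simp
      · exact hdv.imp fun w hw => by linear_combination hw
end

section
/- Let q(n) = αn² + βn + γ be a quadratic sequence with integer coefficients α, β, γ whose discriminator satisfies D_q(n) = 2^{⌈log_2 n⌉} for all n ≥ 1. Then for any integer c, the shifted sequence qs(n) = q(n + c) also satisfies D_{qs}(n) = 2^{⌈log_2 n⌉} for all n ≥ 1. -/
theorem solve_lin (A B : ℤ) (M : ℕ) (hM : 0 < M) (h : IsCoprime A (M : ℤ)) :
    ∃ s : ℕ, s < M ∧ (M : ℤ) ∣ A * s + B := by
  obtain ⟨u, v, huv⟩ := h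
  have hM' : (0 : ℤ) < M := by exact_mod_cast hM
  have h1 := Int.emod_nonneg (-(u * B)) hM'.ne'
  have h2 := Int.emod_lt_of_pos (-(u * B)) hM'
  have h3 := Int.emod_add_mul_ediv (-(u * B)) M
  refine ⟨((-(u * B)) % M).toNat, by omega, ?_⟩
  rw [Int.toNat_of_nonneg h1]
  have h4 : (-(u * B)) % M = -(u * B) - M * (-(u * B) / M) := by linarith
  rw [h4]
  refine ⟨v * B - A * (-(u * B) / M), ?_⟩
  linear_combination (-B) * huv

theorem collide (α β : ℤ)
    (hp : ∀ p : ℕ, p.Prime → p ≠ 2 → (p : ℤ) ∣ α → (p : ℤ) ∣ β)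
    (k m : ℕ) (hm : 0 < m) (hmk : m < 2 ^ (k + 1)) :
    ∃ i j : ℕ, i < j ∧ j ≤ 2 ^ k ∧ (m : ℤ) ∣ ((j : ℤ) - i) * (α * (i + j) + β) := by
  rw [pow_succ] at hmk
  by_cases hc : ∃ p : ℕ, p.Prime ∧ p ≠ 2 ∧ p ∣ m ∧ (p : ℤ) ∣ α
  · obtain ⟨p, pp, p2, ⟨M, rfl⟩, pα⟩ := hc
    have p3 : 3 ≤ p := by have := pp.two_le; omega
    have hM : 0 < M := Nat.pos_of_mul_pos_left hm
    refine ⟨0, M, hM, by nlinarith, ?_⟩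
    have : (p : ℤ) ∣ α * ((0 : ℕ) + M) + β :=
      dvd_add (Dvd.dvd.mul_right pα _) (hp p pp p2 pα)
    push_cast at *
    rw [mul_comm]
    exact mul_dvd_mul (by simp) this
  push Not at hc
  obtain ⟨a, M, hodd, rfl⟩ := Nat.exists_eq_two_pow_mul_odd hm.ne'
  have hMpos : 0 < M := hodd.pos
  have hcop : IsCoprime α (M : ℤ) := by
    rw [Int.isCoprime_iff_gcd_eq_one]
    by_contra hg
    obtain ⟨p, pp, hpg⟩ := Nat.exists_prime_and_dvd hg
    have h1 : (p : ℤ) ∣ α := (Int.natCast_dvd_natCast.2 hpg).trans (Int.gcd_dvd_left ..)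
    have h2 : p ∣ M := by
      exact_mod_cast (Int.natCast_dvd_natCast.2 hpg).trans (Int.gcd_dvd_right ..)
    refine hc p pp ?_ (h2.mul_left _) h1
    rintro rfl
    exact (Nat.not_even_iff_odd.2 hodd) (even_iff_two_dvd.2 h2)
  by_cases hM1 : M = 1
  · subst hM1
    refine ⟨0, 2 ^ a, by positivity, ?_, ?_⟩
    · have : a < k + 1 := by
        apply (Nat.pow_lt_pow_iff_right (a := 2) (by norm_num)).1
        rw [pow_succ]; omega
      exact Nat.pow_le_pow_right (by norm_num) (by omega)
    · push_cast; simp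
  obtain ⟨r, hr⟩ := hodd
  rcases Nat.eq_zero_or_pos a with rfl | ha
  · obtain ⟨s, hs, hd⟩ := solve_lin α β M hMpos hcop
    have key : ∃ i j : ℕ, i < j ∧ j ≤ 2 ^ k ∧ (M : ℤ) ∣ (α * (i + j : ℕ) + β) := by
      rcases Nat.eq_zero_or_pos s with rfl | hs0
      · refine ⟨r, r + 1, by omega, by omega, ?_⟩
        have : r + (r + 1) = M := by omega
        rw [this]
        refine dvd_add (dvd_mul_left _ _) (by simpa using hd)
      rcases Nat.even_or_odd' s with ⟨t, ht | ht⟩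
      · refine ⟨t - 1, t + 1, by omega, by omega, ?_⟩
        have : t - 1 + (t + 1) = s := by omega
        rwa [this]
      · refine ⟨t, t + 1, by omega, by omega, ?_⟩
        have : t + (t + 1) = s := by omega
        rwa [this]
    obtain ⟨i, j, h1, h2, h3⟩ := key
    refine ⟨i, j, h1, h2, ?_⟩
    push_cast at *
    simpa using h3.mul_left _
  · have h2c : IsCoprime (2 * α) (M : ℤ) := by
      refine IsCoprime.mul_left ⟨-r, 1, ?_⟩ hcop
      rw [hr]; push_cast; ring
    obtain ⟨s, hs, hd⟩ := solve_lin (2 * α) (α * 2 ^ a + β) M hMpos h2c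
    refine ⟨s, s + 2 ^ a, by have : 0 < 2 ^ a := by positivity
                             omega, ?_, ?_⟩
    · obtain ⟨b, rfl⟩ : ∃ b, a = b + 1 := ⟨a - 1, by omega⟩
      rcases Nat.eq_zero_or_pos b with rfl | hb
      · simp at *; omega
      · obtain ⟨d, rfl⟩ : ∃ d, b = d + 1 := ⟨b - 1, by omega⟩
        have : 0 < 2 ^ d := by positivity
        simp only [pow_succ] at *
        generalize 2 ^ d = x at *
        have : 3 ≤ M := by omega
        nlinarith
    · push_cast
      refine mul_dvd_mul (by simp) ?_
      have e : α * ((s : ℤ) + (s + 2 ^ a)) + β = 2 * α * s + (α * 2 ^ a + β) := by ring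
      rw [e]
      exact hd

theorem suff (α β : ℤ) (hα : 2 ∣ α) (hβ : ¬ 2 ∣ β)
    (hp : ∀ p : ℕ, p.Prime → p ≠ 2 → (p : ℤ) ∣ α → (p : ℤ) ∣ β)
    (s : ℕ → ℤ) (hs : ∀ i j : ℕ, s j - s i = ((j : ℤ) - i) * (α * (i + j) + β))
    (n : ℕ) :
      IsLeast {m : ℕ | 0 < m ∧ ∀ i j : ℕ, i < j → j < n → ¬ ((m : ℤ) ∣ s j - s i)}
        (2 ^ Nat.clog 2 n) := by
  constructor
  · refine ⟨by positivity, fun i j hij hj hd => ?_⟩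
    rw [hs] at hd
    have hc : IsCoprime (((2 ^ Nat.clog 2 n : ℕ)) : ℤ) (α * (i + j) + β) := by
      push_cast
      apply IsCoprime.pow_left
      rw [Prime.coprime_iff_not_dvd Int.prime_two]
      intro h
      exact hβ ((Int.dvd_add_right (hα.mul_right _)).1 h)
    have h1 := Int.le_of_dvd (by omega) (hc.dvd_of_dvd_mul_right hd)
    have h2 := Nat.le_pow_clog (b := 2) (by norm_num) n
    omega
  · rintro m ⟨hm, h⟩
    by_contra hlt
    push Not at hlt
    rcases hk : Nat.clog 2 n with _ | k
    · rw [hk] at hlt; simp at hlt; omega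
    · rw [hk] at hlt
      obtain ⟨i, j, hij, hj, hd⟩ := collide α β hp k m hm hlt
      have : 2 ^ k < n := by
        by_contra hh
        have := Nat.clog_le_of_le_pow (not_lt.1 hh)
        omega
      exact h i j hij (by omega) (by rw [hs]; exact hd)


/-- If a quadratic sequence `q(n) = αn² + βn + γ` with integer
coefficients has discriminator `2 ^ ⌈log₂ n⌉` (i.e. `2 ^ Nat.clog 2 n`) for all
`n ≥ 1`, then so does every shifted sequence `qs(n) = q(n + c)` for an integer `c`. -/
theorem stmt_6 (α β γ : ℤ)
    (q : ℕ → ℤ) (hq : ∀ n : ℕ, q n = α * (n : ℤ) ^ 2 + β * (n : ℤ) + γ)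
    (hdisc : ∀ n : ℕ, 1 ≤ n →
      IsLeast {m : ℕ | 0 < m ∧ ∀ i j : ℕ, i < j → j < n → ¬ ((m : ℤ) ∣ q j - q i)}
        (2 ^ Nat.clog 2 n))
    (c : ℤ) (qs : ℕ → ℤ)
    (hqs : ∀ n : ℕ, qs n = α * ((n : ℤ) + c) ^ 2 + β * ((n : ℤ) + c) + γ) :
    ∀ n : ℕ, 1 ≤ n →
      IsLeast {m : ℕ | 0 < m ∧ ∀ i j : ℕ, i < j → j < n → ¬ ((m : ℤ) ∣ qs j - qs i)}
        (2 ^ Nat.clog 2 n) := by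

  have hs : ∀ i j : ℕ, q j - q i = ((j : ℤ) - i) * (α * (i + j) + β) := by
    intro i j; rw [hq, hq]; ring
  have c3 : Nat.clog 2 3 = 2 := by norm_num [Nat.clog]
  have c2 : Nat.clog 2 2 = 1 := by norm_num [Nat.clog]
  have hβ : ¬ (2 : ℤ) ∣ β := by
    intro h
    have := (hdisc 3 (by norm_num)).1.2 0 2 (by norm_num) (by norm_num)
    rw [c3, hs] at this
    push_cast at this
    omega
  have hα : (2 : ℤ) ∣ α := by
    have := (hdisc 2 (by norm_num)).1.2 0 1 (by norm_num) (by norm_num)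
    rw [c2, hs] at this
    push_cast at this
    omega
  have hp : ∀ p : ℕ, p.Prime → p ≠ 2 → (p : ℤ) ∣ α → (p : ℤ) ∣ β := by
    intro p pp p2 hpα
    by_contra hpβ
    have hle : 2 ^ Nat.clog 2 p ≤ p := (hdisc p pp.one_le).2 ⟨pp.pos, fun i j hij hj hd => by
      rw [hs] at hd
      rcases (Nat.prime_iff_prime_int.1 pp).dvd_or_dvd hd with h | h
      · have := Int.le_of_dvd (by omega) h
        omega
      · exact hpβ ((Int.dvd_add_right (hpα.mul_right _)).1 h)⟩
    have hge := Nat.le_pow_clog (b := 2) (by norm_num) p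
    have heq : p = 2 ^ Nat.clog 2 p := le_antisymm hge hle
    have : p ∣ 2 ^ Nat.clog 2 p := dvd_of_eq heq
    exact p2 ((Nat.prime_dvd_prime_iff_eq pp Nat.prime_two).1 (pp.dvd_of_dvd_pow this))
  intro n _
  refine suff α (2 * α * c + β) hα ?_ ?_ qs ?_ n
  · intro h
    exact hβ ((Int.dvd_add_right ((dvd_mul_right 2 α).mul_right c)).1 h)
  · intro p pp p2 h
    exact dvd_add ((h.mul_left 2).mul_right c) (hp p pp p2 h)
  · intro i j; rw [hqs, hqs]; ring
end

section
/- Let tr(n) = n(n + 1)/2 be the sequence of triangular numbers (tr(n) = (1/2)n² + (1/2)n for n ≥ 0). Then the discriminator satisfies D_{tr}(n) = 2^{⌈log_2 n⌉} for all n ≥ 1. -/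
/-- The sequence of triangular numbers `tr(n) = n(n+1)/2` (encoded by
`2 * tr n = n(n+1)`) has discriminator `2 ^ ⌈log₂ n⌉` (i.e. `2 ^ Nat.clog 2 n`)
for all `n ≥ 1`. -/
theorem stmt_7 (tr : ℕ → ℤ) (htr : ∀ n : ℕ, 2 * tr n = (n : ℤ) * ((n : ℤ) + 1)) :
    ∀ n : ℕ, 1 ≤ n →
      IsLeast {m : ℕ | 0 < m ∧ ∀ i j : ℕ, i < j → j < n → ¬ ((m : ℤ) ∣ tr j - tr i)}
        (2 ^ Nat.clog 2 n) := by
  intro n hn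
  have key : ∀ i x : ℕ, 2 * (tr (i + x) - tr i) = ((x * (2 * i + x + 1) : ℕ) : ℤ) := by
    intro i x
    have h1 := htr (i + x)
    have h2 := htr i
    push_cast at *
    linear_combination h1 - h2
  constructor
  · refine ⟨by positivity, ?_⟩
    intro i j hij hj hd
    obtain ⟨x, rfl⟩ := Nat.exists_eq_add_of_lt hij
    have hk : n ≤ 2 ^ Nat.clog 2 n := Nat.le_pow_clog (by norm_num) n
    generalize Nat.clog 2 n = k at *
    have h := mul_dvd_mul_left (2 : ℤ) hd
    rw [add_assoc i x 1, key i (x + 1)] at h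
    have h' : 2 ^ (k + 1) ∣ (x + 1) * (2 * i + (x + 1) + 1) := by
      rw [pow_succ']; exact_mod_cast h
    rcases Nat.even_or_odd (x + 1) with he | ho
    · have hc : Nat.Coprime (2 ^ (k + 1)) (2 * i + (x + 1) + 1) := by
        apply Nat.Coprime.pow_left
        rw [Nat.coprime_two_left]
        obtain ⟨c, hc⟩ := he
        exact ⟨i + c, by omega⟩
      have := Nat.le_of_dvd (by omega) (hc.dvd_of_dvd_mul_right h')
      rw [pow_succ] at this
      omega
    · have hc : Nat.Coprime (2 ^ (k + 1)) (x + 1) := by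
        apply Nat.Coprime.pow_left
        rwa [Nat.coprime_two_left]
      have := Nat.le_of_dvd (by omega) (hc.dvd_of_dvd_mul_left h')
      rw [pow_succ] at this
      omega
  · rintro m ⟨hm, hd⟩
    by_contra! hlt
    have hk : ∀ k, Nat.clog 2 n = k + 1 → 2 ^ k < n := by
      intro k hk
      exact (Nat.lt_clog_iff_pow_lt (by norm_num)).1 (by omega)
    generalize Nat.clog 2 n = k at *
    rcases k with _ | k
    · simp at hlt; omega
    have hkn := hk k rfl
    obtain ⟨a, b, hb, hab⟩ := Nat.exists_eq_two_pow_mul_odd (n := m) (by omega)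
    obtain ⟨c, rfl⟩ := hb
    have hP : 1 ≤ 2 ^ a := Nat.one_le_two_pow
    -- the bound on the sum of the two factors
    have hsum : 2 ^ a + c ≤ 2 ^ k := by
      rw [pow_succ] at hlt
      rcases Nat.eq_zero_or_pos c with rfl | hc
      · have h1 : 2 ^ a < 2 ^ (k + 1) := by rw [pow_succ]; omega
        have h2 := (Nat.pow_lt_pow_iff_right (by norm_num : 1 < 2)).1 h1
        have := Nat.pow_le_pow_right (by norm_num : 0 < 2) (by omega : a ≤ k)
        omega
      · have : 2 ^ a + c ≤ 2 ^ a * c + 1 := by nlinarith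
        nlinarith
    generalize 2 ^ a = P at *
    have fin : ∀ i x : ℕ, 0 < x → i + x < n → x * (2 * i + x + 1) = 2 * m → False := by
      intro i x hx hn' he
      refine hd i (i + x) (by omega) hn' ?_
      have h := key i x
      rw [he] at h
      push_cast at h
      exact ⟨1, by linarith⟩
    rcases Nat.lt_or_ge c P with h | h
    · refine fin (P - c - 1) (2 * c + 1) (by omega) (by omega) ?_
      have : 2 * (P - c - 1) + (2 * c + 1) + 1 = 2 * P := by omega
      rw [this, hab]; ring
    · refine fin (c - P) (2 * P) (by omega) (by omega) ?_
      have : 2 * (c - P) + 2 * P + 1 = 2 * c + 1 := by omega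
      rw [this, hab]; ring
end

section
/- Let α′ and β′ be odd integers, γ an integer, and qr(n) = (α′/2)n² + (β′/2)n + γ (an integer-valued quadratic). Then the discriminator satisfies D_{qr}(n) = 2^{⌈log_2 n⌉} for all n ≥ 1 if and only if α′ = β′. Here 'D_{qr}(n) = 2^{⌈log_2 n⌉} for all n ≥ 1' means that for each n ≥ 1 some positive integer discriminates {qr(0), …, qr(n−1)} and the least such integer equals 2^{⌈log_2 n⌉}. -/
lemma fwd_aux (α' β' γ : ℤ) (hα' : Odd α') (hβ' : Odd β')
    (qr : ℕ → ℤ) (hqr : ∀ n : ℕ, 2 * qr n = α' * (n : ℤ) ^ 2 + β' * (n : ℤ) + 2 * γ)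
    (k : ℕ) (h : ∀ i j : ℕ, i < j → j < 2 ^ k → ¬ (((2 ^ k : ℕ) : ℤ) ∣ qr j - qr i)) :
    (2 ^ k : ℤ) ∣ α' - β' := by
  obtain ⟨c, hc⟩ := hα'.add_odd hβ'
  have hcop : IsCoprime α' ((2 : ℤ) ^ k) := by
    apply IsCoprime.pow_right
    obtain ⟨a, ha⟩ := hα'
    exact ⟨1, -a, by rw [ha]; ring⟩
  obtain ⟨u, v, huv⟩ := hcop
  have hP : (0 : ℤ) < 2 ^ k := by positivity
  have h0 := Int.emod_nonneg (-u * c) hP.ne'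
  have h1 := Int.emod_lt_of_pos (-u * c) hP
  have h2 := Int.emod_add_mul_ediv (-u * c) (2 ^ k)
  set r := (-u * c) % 2 ^ k with hr
  set q := (-u * c) / 2 ^ k with hq
  obtain ⟨i, hi⟩ := Int.eq_ofNat_of_zero_le h0
  have hd : (2 ^ k : ℤ) ∣ α' * r + c := by
    refine ⟨v * c - α' * q, ?_⟩
    linear_combination α' * h2 - c * huv
  have e : qr (i + 1) - qr i = α' * r + c := by
    have a1 := hqr (i + 1)
    have a2 := hqr i
    push_cast at a1
    rw [hi]
    have : 2 * (qr (i + 1) - qr i) = 2 * (α' * i + c) := by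
      linear_combination a1 - a2 + hc
    linarith
  by_cases hlt : i + 1 < 2 ^ k
  · exfalso
    apply h i (i + 1) (by omega) hlt
    rw [e]
    exact_mod_cast hd
  · have h3 : (2 : ℤ) ^ k ≤ i + 1 := by
      have := not_lt.1 hlt
      exact_mod_cast this
    have h4 : r = 2 ^ k - 1 := by
      have : r = (i : ℤ) := hi
      omega
    rw [h4] at hd
    obtain ⟨d, hd⟩ := hd
    refine ⟨2 * α' - 2 * d, ?_⟩
    linear_combination (-2) * hd - hc

lemma qr_diff (α' γ : ℤ)
    (qr : ℕ → ℤ) (hqr : ∀ n : ℕ, 2 * qr n = α' * (n : ℤ) ^ 2 + α' * (n : ℤ) + 2 * γ)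
    (i j : ℕ) : 2 * (qr j - qr i) = α' * (((j : ℤ) - i) * (i + j + 1)) := by
  linear_combination hqr j - hqr i

lemma pow_discr (α' γ : ℤ) (hα' : Odd α')
    (qr : ℕ → ℤ) (hqr : ∀ n : ℕ, 2 * qr n = α' * (n : ℤ) ^ 2 + α' * (n : ℤ) + 2 * γ)
    (k i j : ℕ) (hij : i < j) (hj : j < 2 ^ k) : ¬ (((2 ^ k : ℕ) : ℤ) ∣ qr j - qr i) := by
  rintro ⟨d, hd⟩
  have e := qr_diff α' γ qr hqr i j
  have hdv : (2 : ℤ) ^ (k + 1) ∣ α' * (((j : ℤ) - i) * (i + j + 1)) := by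
    refine ⟨d, ?_⟩
    rw [← e, hd]; push_cast; ring
  have hcop : ∀ x : ℤ, Odd x → IsCoprime ((2 : ℤ) ^ (k + 1)) x := by
    rintro x ⟨a, ha⟩
    apply IsCoprime.pow_left
    exact ⟨-a, 1, by rw [ha]; ring⟩
  have h1 := (hcop α' hα').dvd_of_dvd_mul_left hdv
  have hj' : (j : ℤ) < 2 ^ k := by exact_mod_cast hj
  have hp : (2 : ℤ) ^ (k + 1) = 2 * 2 ^ k := by ring
  rcases Int.even_or_odd ((j : ℤ) - i) with h | h
  · have h2 := (hcop (i + j + 1) (by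
      obtain ⟨a, ha⟩ := h
      exact ⟨a + i, by linarith⟩)).dvd_of_dvd_mul_right h1
    have := Int.le_of_dvd (by omega) h2
    omega
  · have h2 := (hcop _ h).dvd_of_dvd_mul_left h1
    have := Int.le_of_dvd (by omega) h2
    omega

lemma exists_coll (α' γ : ℤ)
    (qr : ℕ → ℤ) (hqr : ∀ n : ℕ, 2 * qr n = α' * (n : ℤ) ^ 2 + α' * (n : ℤ) + 2 * γ)
    (m n A B : ℕ) (hA : 2 ≤ A) (hAB : A < B) (hodd : Odd (A + B)) (hm : A * B = 2 * m)
    (hmn : m + 2 ≤ 2 * n) : ∃ i j : ℕ, i < j ∧ j < n ∧ (m : ℤ) ∣ qr j - qr i := by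
  obtain ⟨s, hs⟩ := hodd
  have h1 : A + B ≤ m + 2 := by nlinarith
  refine ⟨s - A, s, by omega, by omega, ?_⟩
  have e := qr_diff α' γ qr hqr (s - A) s
  rw [Nat.cast_sub (by omega)] at e
  refine ⟨α', ?_⟩
  have hs' : (A : ℤ) + B = 2 * s + 1 := by exact_mod_cast hs
  have hm' : (A : ℤ) * B = 2 * m := by exact_mod_cast hm
  have : (B : ℤ) = 2 * s + 1 - A := by linarith
  rw [this] at hm'
  have h5 : 2 * (qr s - qr (s - A)) = 2 * (m * α') := by
    linear_combination e + α' * hm'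
  linarith

lemma lower (α' γ : ℤ)
    (qr : ℕ → ℤ) (hqr : ∀ n : ℕ, 2 * qr n = α' * (n : ℤ) ^ 2 + α' * (n : ℤ) + 2 * γ)
    (n m : ℕ) (hn : 1 ≤ n) (hm : 0 < m)
    (h : ∀ i j : ℕ, i < j → j < n → ¬ ((m : ℤ) ∣ qr j - qr i)) : 2 ^ Nat.clog 2 n ≤ m := by
  have hnm : n ≤ m := by
    by_contra hlt
    push Not at hlt
    obtain ⟨x, hx, y, hy, hne, hxy⟩ := Finset.exists_ne_map_eq_of_card_lt_of_maps_to
      (s := Finset.range n) (t := Finset.Ico (0 : ℤ) m) (f := fun i => qr i % (m : ℤ))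
      (by simpa using hlt)
      (fun i _ => by
        simp only [Finset.coe_Ico, Set.mem_Ico]
        exact ⟨Int.emod_nonneg _ (by omega), Int.emod_lt_of_pos _ (by omega)⟩)
    simp only [Finset.mem_range] at hx hy
    rcases lt_or_gt_of_ne hne with hl | hl
    · exact h x y hl hy (Int.ModEq.dvd hxy)
    · exact h y x hl hx (Int.ModEq.dvd hxy.symm)
  obtain ⟨e, q, hq, rfl⟩ := Nat.exists_eq_two_pow_mul_odd hm.ne'
  by_cases hq1 : q = 1
  · subst hq1
    rw [mul_one] at hnm ⊢
    exact Nat.pow_le_pow_right (by norm_num) (Nat.clog_le_of_le_pow hnm)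
  by_contra hlt
  push Not at hlt
  have hk : 2 ^ e * q + 2 ≤ 2 * n := by
    rcases Nat.lt_or_ge 1 n with h1 | h1
    · have h2 := Nat.pow_pred_clog_lt_self (b := 2) (by norm_num) h1
      have h3 : 0 < Nat.clog 2 n := Nat.clog_pos (by norm_num) h1
      obtain ⟨k, hk⟩ := Nat.exists_eq_succ_of_ne_zero h3.ne'
      rw [hk] at h2 hlt
      simp only [Nat.pred_succ, Nat.succ_eq_add_one, pow_succ] at h2 hlt
      omega
    · have : n = 1 := by omega
      subst this
      rw [Nat.clog_one_right, pow_zero] at hlt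
      omega
  have hq2 : 3 ≤ q := by
    obtain ⟨a, ha⟩ := hq
    omega
  have he : 2 ≤ 2 ^ (e + 1) := by
    have := Nat.one_le_two_pow (n := e)
    rw [pow_succ]; omega
  have hev : Even (2 ^ (e + 1)) := ⟨2 ^ e, by ring⟩
  have hne : 2 ^ (e + 1) ≠ q := by
    intro hh
    rw [hh] at hev
    exact (Nat.not_even_iff_odd.2 hq) hev
  have : ∃ i j : ℕ, i < j ∧ j < n ∧ ((2 ^ e * q : ℕ) : ℤ) ∣ qr j - qr i := by
    rcases lt_or_gt_of_ne hne with hl | hl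
    · exact exists_coll α' γ qr hqr _ n _ _ he hl (hev.add_odd hq) (by ring) hk
    · exact exists_coll α' γ qr hqr _ n _ _ (by omega) hl (hq.add_even hev) (by ring) hk
  obtain ⟨i, j, a, b, c⟩ := this
  exact h i j a b c

/-- For the integer-valued quadratic `qr(n) = (α′/2)n² + (β′/2)n + γ`
with `α′, β′` odd (encoded by `2 * qr n = α′ n² + β′ n + 2γ`), the discriminator
equals `2 ^ ⌈log₂ n⌉` (i.e. `2 ^ Nat.clog 2 n`) for all `n ≥ 1` iff `α′ = β′`. -/
theorem stmt_8 (α' β' γ : ℤ) (hα' : Odd α') (hβ' : Odd β')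
    (qr : ℕ → ℤ) (hqr : ∀ n : ℕ, 2 * qr n = α' * (n : ℤ) ^ 2 + β' * (n : ℤ) + 2 * γ) :
    (∀ n : ℕ, 1 ≤ n →
      IsLeast {m : ℕ | 0 < m ∧ ∀ i j : ℕ, i < j → j < n → ¬ ((m : ℤ) ∣ qr j - qr i)}
        (2 ^ Nat.clog 2 n)) ↔ α' = β' := by
  constructor
  · intro H
    have hdv : (2 ^ (α' - β').natAbs : ℤ) ∣ α' - β' := by
      have h1 := (H (2 ^ (α' - β').natAbs) Nat.one_le_two_pow).1.2
      rw [Nat.clog_pow 2 _ (by norm_num)] at h1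
      exact fwd_aux α' β' γ hα' hβ' qr hqr _ h1
    have := Int.eq_zero_of_abs_lt_dvd hdv (by
      rw [Int.abs_eq_natAbs]
      exact_mod_cast Nat.lt_two_pow_self)
    linarith
  · rintro rfl n hn
    refine ⟨⟨by positivity, fun i j hij hj => ?_⟩, fun m hm => ?_⟩
    · exact pow_discr α' γ hα' qr hqr _ i j hij
        (lt_of_lt_of_le hj (Nat.le_pow_clog (by norm_num) n))
    · exact lower α' γ qr hqr n m hn hm.1 hm.2
end

section
/- Let b ≥ 2 be an integer and let x and y be finite strings over the digit alphabet {0, 1, …, b−1} such that the integer [x]_b represented by x in base b satisfies [x]_b ≥ 1 and gcd(b, [y]_b) = 1. Then there exist infinitely many strings w over {0, 1, …, b−1} such that [xwy]_b, the integer whose base-b representation is the concatenation xwy, is prime. Equivalently, there are infinitely many primes of the form [x]_b·b^{|w|+|y|} + [w]_b·b^{|y|} + [y]_b as w ranges over digit strings. -/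
/-- The integer represented by a (big-endian) digit string `l` in base `b`;
the empty string represents 0. -/
def valB (b : ℕ) (l : List ℕ) : ℕ := l.foldl (fun acc d => acc * b + d) 0

section helpers

open ArithmeticFunction.vonMangoldt Filter Topology

/-- The twisted L-series is bounded near the line `re s = 1`, away from the real axis. -/
lemma twisted_bdd {q : ℕ} [NeZero q] {a : ZMod q} (ha : IsUnit a) (τ : ℝ) (hτ : τ ≠ 0) :
    ∃ C : ℝ, ∀ x : ℝ, x ∈ Set.Ioc (1 : ℝ) 2 →
      ‖LSeries (fun n => (residueClass a n : ℂ)) ((x : ℂ) + τ * Complex.I)‖ ≤ C := by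
  have hc : ContinuousOn (fun x : ℝ => LFunctionResidueClassAux a ((x : ℂ) + τ * Complex.I)
      + (q.totient : ℂ)⁻¹ / (((x : ℂ) + τ * Complex.I) - 1)) (Set.Icc 1 2) := by
    apply ContinuousOn.add
    · refine (continuousOn_LFunctionResidueClassAux a).comp (by fun_prop) ?_
      intro x hx
      simpa using hx.1
    · refine ContinuousOn.div (by fun_prop) (by fun_prop) ?_
      intro x hx h
      apply hτ
      simpa using congrArg Complex.im h
  obtain ⟨C, hC⟩ := isCompact_Icc.exists_bound_of_continuousOn hc
  refine ⟨C, fun x hx => ?_⟩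
  have h1 := hC x (Set.Ioc_subset_Icc_self hx)
  have h2 := eqOn_LFunctionResidueClassAux ha
    (show ((x : ℂ) + τ * Complex.I) ∈ {s : ℂ | 1 < s.re} by simpa using hx.1)
  rw [h2] at h1
  simpa using h1

lemma rc_summable {q : ℕ} (a : ZMod q) {s : ℂ} (hs : 1 < s.re) :
    Summable (LSeries.term (fun n => (residueClass a n : ℂ)) s) :=
  LSeriesSummable_of_abscissaOfAbsConv_lt_re <|
      (abscissaOfAbsConv_residueClass_le_one a).trans_lt <| by exact_mod_cast hs

lemma cos_pow_expand (N : ℕ) (u : ℝ) :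
    ((Real.cos u ^ (2 * N) : ℝ) : ℂ) = ∑ k ∈ Finset.range (2 * N + 1),
      ((2 * N).choose k : ℂ) / 4 ^ N * Complex.exp ((2 * (k : ℂ) - 2 * N) * u * Complex.I) := by
  have h4 : (4 : ℂ) ^ N = 2 ^ (2 * N) := by rw [pow_mul]; norm_num
  push_cast
  rw [Complex.cos, div_pow, add_pow, Finset.sum_div, h4]
  refine Finset.sum_congr rfl fun k hk => ?_
  have hk' : k ≤ 2 * N := by simpa [Nat.lt_succ_iff] using hk
  rw [← Complex.exp_nat_mul, ← Complex.exp_nat_mul, ← Complex.exp_add, Nat.cast_sub hk']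
  rw [mul_comm, mul_div_right_comm]
  congr 2
  push_cast
  ring

lemma twisted_term {q : ℕ} (a : ZMod q) (N : ℕ) (α β x : ℝ) (n : ℕ) :
    ((residueClass a n * Real.cos (α * Real.log n - β) ^ (2 * N) / (n : ℝ) ^ x : ℝ) : ℂ) =
    ∑ k ∈ Finset.range (2 * N + 1), ((2 * N).choose k : ℂ) / 4 ^ N *
      Complex.exp (-((2 * (k : ℂ) - 2 * N) * β * Complex.I)) *
      LSeries.term (fun n => (residueClass a n : ℂ))
        ((x : ℂ) + ((-(2 * k - 2 * N) * α : ℝ) : ℂ) * Complex.I) n := by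
  rcases eq_or_ne n 0 with rfl | hn
  · simp
  rw [Complex.ofReal_div, Complex.ofReal_mul, cos_pow_expand, Finset.mul_sum, Finset.sum_div]
  refine Finset.sum_congr rfl fun k _ => ?_
  rw [LSeries.term_of_ne_zero hn, Complex.ofReal_cpow (Nat.cast_nonneg _)]
  have hn' : (n : ℂ) ≠ 0 := by exact_mod_cast hn
  have hlog : Complex.log n = (Real.log n : ℂ) := by simp
  rw [Complex.ofReal_natCast, Complex.cpow_def_of_ne_zero hn', Complex.cpow_def_of_ne_zero hn', hlog]
  rw [div_eq_mul_inv, div_eq_mul_inv _ (Complex.exp _), ← Complex.exp_neg, ← Complex.exp_neg]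
  have e1 : Complex.exp ((2 * (k : ℂ) - 2 * N) * ((α * Real.log n - β : ℝ) : ℂ) * Complex.I) *
      Complex.exp (-((Real.log n : ℂ) * x)) =
      Complex.exp (-((2 * (k : ℂ) - 2 * N) * β * Complex.I)) *
      Complex.exp (-((Real.log n : ℂ) * ((x : ℂ) + ((-(2 * k - 2 * N) * α : ℝ) : ℂ) * Complex.I))) := by
    rw [← Complex.exp_add, ← Complex.exp_add]
    congr 1
    push_cast
    ring
  linear_combination ((residueClass a n : ℂ) * (((2 * N).choose k : ℂ) / 4 ^ N)) * e1

lemma twisted_lower {q : ℕ} [NeZero q] {a : ZMod q} (ha : IsUnit a) (N : ℕ) (α β : ℝ)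
    (hα : α ≠ 0) :
    ∃ C : ℝ, ∀ x : ℝ, x ∈ Set.Ioc (1 : ℝ) 2 →
      (N.centralBinom : ℝ) / 4 ^ N * (∑' n, residueClass a n / (n : ℝ) ^ x) - C ≤
      ∑' n : ℕ, residueClass a n * Real.cos (α * Real.log n - β) ^ (2 * N) / (n : ℝ) ^ x := by
  have hb : ∀ k : ℕ, ∃ C : ℝ, k ≠ N → ∀ x : ℝ, x ∈ Set.Ioc (1 : ℝ) 2 →
      ‖((2 * N).choose k : ℂ) / 4 ^ N *
      Complex.exp (-((2 * (k : ℂ) - 2 * N) * β * Complex.I)) *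
      LSeries (fun n => (residueClass a n : ℂ))
        ((x : ℂ) + ((-(2 * k - 2 * N) * α : ℝ) : ℂ) * Complex.I)‖ ≤ C := by
    intro k
    by_cases hk : k = N
    · exact ⟨0, fun h => absurd hk h⟩
    · have hk' : (-(2 * k - 2 * N) * α : ℝ) ≠ 0 := by
        refine mul_ne_zero ?_ hα
        intro h
        apply hk
        have : (k : ℝ) = N := by linarith
        exact_mod_cast this
      obtain ⟨C, hC⟩ := twisted_bdd ha _ hk'
      refine ⟨‖((2 * N).choose k : ℂ) / 4 ^ N *
        Complex.exp (-((2 * (k : ℂ) - 2 * N) * β * Complex.I))‖ * C, fun _ x hx => ?_⟩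
      rw [norm_mul]
      exact mul_le_mul_of_nonneg_left (hC x hx) (norm_nonneg _)
  choose C hC using hb
  refine ⟨∑ k ∈ (Finset.range (2 * N + 1)).erase N, C k, fun x hx => ?_⟩
  have hS : ((∑' n : ℕ, residueClass a n * Real.cos (α * Real.log n - β) ^ (2 * N) / (n : ℝ) ^ x : ℝ) : ℂ)
      = ∑ k ∈ Finset.range (2 * N + 1), ((2 * N).choose k : ℂ) / 4 ^ N *
      Complex.exp (-((2 * (k : ℂ) - 2 * N) * β * Complex.I)) *
      LSeries (fun n => (residueClass a n : ℂ))
        ((x : ℂ) + ((-(2 * k - 2 * N) * α : ℝ) : ℂ) * Complex.I) := by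
    rw [Complex.ofReal_tsum]
    simp_rw [twisted_term]
    rw [Summable.tsum_finsetSum]
    · refine Finset.sum_congr rfl fun k _ => ?_
      rw [tsum_mul_left]; rfl
    · intro k _
      exact (rc_summable a (by simpa using hx.1)).mul_left _
  have hN : N ∈ Finset.range (2 * N + 1) := by simp; omega
  rw [← Finset.add_sum_erase _ _ hN] at hS
  have h0 : LSeries (fun n => (residueClass a n : ℂ)) (x : ℂ) =
      ((∑' n, residueClass a n / (n : ℝ) ^ x : ℝ) : ℂ) := by
    rw [Complex.ofReal_tsum, LSeries]
    refine tsum_congr fun n => ?_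
    rcases eq_or_ne n 0 with rfl | hn
    · simp
    · rw [LSeries.term_of_ne_zero hn, Complex.ofReal_div, Complex.ofReal_cpow (Nat.cast_nonneg _)]
      simp
  have h1 : ((2 * N).choose N : ℂ) / 4 ^ N *
      Complex.exp (-((2 * (N : ℂ) - 2 * N) * β * Complex.I)) *
      LSeries (fun n => (residueClass a n : ℂ))
        ((x : ℂ) + ((-(2 * N - 2 * N) * α : ℝ) : ℂ) * Complex.I) =
      (((N.centralBinom : ℝ) / 4 ^ N * (∑' n, residueClass a n / (n : ℝ) ^ x) : ℝ) : ℂ) := by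
    have : ((x : ℂ) + ((-(2 * N - 2 * N) * α : ℝ) : ℂ) * Complex.I) = x := by simp
    rw [this, h0]
    simp [Nat.centralBinom]
  rw [h1] at hS
  have h2 : ‖∑ k ∈ (Finset.range (2 * N + 1)).erase N, ((2 * N).choose k : ℂ) / 4 ^ N *
      Complex.exp (-((2 * (k : ℂ) - 2 * N) * β * Complex.I)) *
      LSeries (fun n => (residueClass a n : ℂ))
        ((x : ℂ) + ((-(2 * k - 2 * N) * α : ℝ) : ℂ) * Complex.I)‖ ≤
      ∑ k ∈ (Finset.range (2 * N + 1)).erase N, C k :=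
    norm_sum_le_of_le _ fun k hk => hC k (Finset.ne_of_mem_erase hk) x hx
  rw [← sub_eq_iff_eq_add'] at hS
  rw [← hS, ← Complex.ofReal_sub, Complex.norm_real, Real.norm_eq_abs] at h2
  linarith [(abs_le.1 h2).1]

lemma exists_N {c : ℝ} (hc0 : 0 ≤ c) (hc : c < 1) :
    ∃ N : ℕ, c ^ N < (N.centralBinom : ℝ) / 4 ^ N := by
  have h := tendsto_self_mul_const_pow_of_lt_one hc0 hc
  have h2 := (h.eventually (gt_mem_nhds (show (0 : ℝ) < 1 / 2 by norm_num))).and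
    (eventually_gt_atTop 0)
  obtain ⟨N, hN, hN0⟩ := h2.exists
  refine ⟨N, ?_⟩
  have h3 : (4 : ℝ) ^ N ≤ 2 * N * N.centralBinom := by
    exact_mod_cast Nat.four_pow_le_two_mul_self_mul_centralBinom N hN0
  have h4 : (0 : ℝ) < N.centralBinom := by exact_mod_cast Nat.centralBinom_pos N
  rw [lt_div_iff₀ (by positivity)]
  have h5 : 0 ≤ c ^ N := by positivity
  nlinarith [mul_le_mul_of_nonneg_left h3 h5]

/-- Infinitely many primes `p ≡ a` with `cos² (α log p - β) > c`. -/
lemma infinite_primes_cos {q : ℕ} [NeZero q] {a : ZMod q} (ha : IsUnit a) (α β : ℝ)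
    (hα : α ≠ 0) {c : ℝ} (hc0 : 0 ≤ c) (hc : c < 1) :
    {p : ℕ | p.Prime ∧ (p : ZMod q) = a ∧ c < Real.cos (α * Real.log p - β) ^ 2}.Infinite := by
  intro hfin
  obtain ⟨N, hN⟩ := exists_N hc0 hc
  set T := {p : ℕ | p.Prime ∧ (p : ZMod q) = a ∧ c < Real.cos (α * Real.log p - β) ^ 2}
  classical
  -- dominating summable function
  let g : ℕ → ℝ := fun n => (if n.Prime then 0 else residueClass a n) / n +
    (if n ∈ T then residueClass a n / n else 0)
  have hg : Summable g := by
    refine (summable_residueClass_non_primes_div a).add (summable_of_hasFiniteSupport ?_)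
    refine Set.Finite.subset hfin ?_
    intro n hn
    by_contra h
    simp [h] at hn
  obtain ⟨C, hC⟩ := twisted_lower ha N α β hα
  obtain ⟨C', hC'⟩ := LSeries_residueClass_lower_bound ha
  have hsum : ∀ x : ℝ, 1 < x → Summable fun n : ℕ => residueClass a n / (n : ℝ) ^ x := by
    intro x hx
    exact LSeries.summable_real_of_abscissaOfAbsConv_lt <|
        (abscissaOfAbsConv_residueClass_le_one a).trans_lt <| mod_cast hx
  have hpt : ∀ x : ℝ, 1 < x → ∀ n : ℕ,
      residueClass a n * Real.cos (α * Real.log n - β) ^ (2 * N) / (n : ℝ) ^ x ≤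
      g n + c ^ N * (residueClass a n / (n : ℝ) ^ x) := by
    intro x hx n
    have hr := residueClass_nonneg a n
    have hcos1 : Real.cos (α * Real.log n - β) ^ (2 * N) ≤ 1 := by
      rw [pow_mul]; exact pow_le_one₀ (sq_nonneg _) (Real.cos_sq_le_one _)
    have hle : residueClass a n / (n : ℝ) ^ x ≤ residueClass a n / n := by
      rcases n.eq_zero_or_pos with rfl | hn
      · simp
      · refine div_le_div_of_nonneg_left (residueClass_nonneg a _) (mod_cast hn) ?_
        conv_lhs => rw [← Real.rpow_one n]
        exact Real.rpow_le_rpow_of_exponent_le (by norm_cast) hx.le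
    have hdx : 0 ≤ residueClass a n / (n : ℝ) ^ x := by positivity
    have hd1 : 0 ≤ residueClass a n / (n : ℝ) := by positivity
    have hcN : 0 ≤ c ^ N := by positivity
    rw [mul_div_right_comm]
    by_cases hm : (n : ZMod q) = a
    · by_cases hcc : c < Real.cos (α * Real.log n - β) ^ 2
      · have hgn : residueClass a n / n ≤ g n := by
          by_cases hp : n.Prime
          · have : n ∈ T := ⟨hp, hm, hcc⟩
            simp [g, hp, this]
          · simp only [g, hp, if_false]
            split_ifs
            · linarith
            · linarith
        nlinarith [mul_nonneg hcN hdx, mul_le_mul_of_nonneg_left hcos1 hdx]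
      · have h1 : Real.cos (α * Real.log n - β) ^ (2 * N) ≤ c ^ N := by
          rw [pow_mul]; exact pow_le_pow_left₀ (sq_nonneg _) (not_lt.1 hcc) _
        have hgn : 0 ≤ g n := by
          apply add_nonneg
          · apply div_nonneg _ (Nat.cast_nonneg _)
            split_ifs <;> linarith
          · split_ifs <;> linarith
        nlinarith [mul_le_mul_of_nonneg_left h1 hdx]
    · have : residueClass a n = 0 := by simp [residueClass, hm]
      simp [g, this]
  have hfinal : ∀ x : ℝ, x ∈ Set.Ioc (1 : ℝ) 2 →
      ((N.centralBinom : ℝ) / 4 ^ N - c ^ N) * ((q.totient : ℝ)⁻¹ / (x - 1) - C') ≤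
        C + ∑' n, g n := by
    intro x hx
    have hs := hsum x hx.1
    have h1 : ∑' n : ℕ, residueClass a n * Real.cos (α * Real.log n - β) ^ (2 * N) / (n : ℝ) ^ x ≤
        ∑' n, g n + c ^ N * ∑' n, (residueClass a n / (n : ℝ) ^ x) := by
      rw [← tsum_mul_left, ← Summable.tsum_add hg (hs.mul_left _)]
      refine Summable.tsum_le_tsum (hpt x hx.1) ?_ (hg.add (hs.mul_left _))
      refine Summable.of_nonneg_of_le (fun n => ?_) (fun n => ?_) hs
      · have hr := residueClass_nonneg a n
        rw [pow_mul]
        positivity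
      · have hr := residueClass_nonneg a n
        have hcos1 : Real.cos (α * Real.log n - β) ^ (2 * N) ≤ 1 := by
          rw [pow_mul]; exact pow_le_one₀ (sq_nonneg _) (Real.cos_sq_le_one _)
        have : 0 ≤ (n : ℝ) ^ x := by positivity
        refine div_le_div_of_nonneg_right ?_ this
        nlinarith
    have h2 := hC x hx
    have h3 := mul_le_mul_of_nonneg_left (hC' hx) (sub_pos.2 hN).le
    linarith
  have hq : 0 < (q.totient : ℝ)⁻¹ := inv_pos.mpr (mod_cast q.totient.pos_of_neZero)
  set d := (N.centralBinom : ℝ) / 4 ^ N - c ^ N with hd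
  have hd0 : 0 < d := sub_pos.2 hN
  set M := (C + ∑' n, g n) / d + C' with hM
  set K := max 1 ((M + 1) / (q.totient : ℝ)⁻¹) with hK
  have hK1 : 1 ≤ K := le_max_left _ _
  have hK0 : 0 < K := by linarith
  have hx : 1 + 1 / K ∈ Set.Ioc (1 : ℝ) 2 := by
    constructor
    · have : 0 < 1 / K := by positivity
      linarith
    · have : 1 / K ≤ 1 := by rw [div_le_one hK0]; exact hK1
      linarith
  have h1 := hfinal _ hx
  rw [mul_comm, ← le_div_iff₀ hd0] at h1
  have h2 : (q.totient : ℝ)⁻¹ / (1 + 1 / K - 1) = (q.totient : ℝ)⁻¹ * K := by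
    rw [add_sub_cancel_left, one_div, div_inv_eq_mul]
  rw [h2] at h1
  have h3 : (M + 1) ≤ (q.totient : ℝ)⁻¹ * K := by
    rw [← div_le_iff₀' hq]; exact le_max_right _ _
  linarith

/-- From the cosine condition to an interval. -/
lemma cos_to_interval {t δ : ℝ} (hδ0 : 0 < δ) (hδ : δ ≤ 1 / 2)
    (h : Real.cos (Real.pi * δ) ^ 2 < Real.cos (Real.pi * t) ^ 2) :
    ∃ m : ℤ, |t - m| < δ := by
  refine ⟨round t, ?_⟩
  have hr := abs_sub_round t
  set m := round t
  by_contra hcon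
  have hcon := not_lt.1 hcon
  have e : Real.cos (Real.pi * t) ^ 2 = Real.cos (Real.pi * |t - m|) ^ 2 := by
    have h1 : Real.cos (Real.pi * |t - m|) = Real.cos (Real.pi * (t - m)) := by
      rw [← Real.cos_abs (Real.pi * (t - m)), abs_mul, abs_of_pos Real.pi_pos]
    rw [h1, Real.cos_sq, Real.cos_sq,
      show 2 * (Real.pi * (t - m)) = 2 * (Real.pi * t) - m * (2 * Real.pi) by ring,
      Real.cos_sub_int_mul_two_pi]
  rw [e] at h
  have hpi := Real.pi_pos
  have h2 : Real.cos (Real.pi * |t - m|) ≤ Real.cos (Real.pi * δ) :=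
    Real.cos_le_cos_of_nonneg_of_le_pi (by positivity) (by nlinarith) (by nlinarith)
  have h3 : 0 ≤ Real.cos (Real.pi * |t - m|) :=
    Real.cos_nonneg_of_mem_Icc ⟨by nlinarith [abs_nonneg (t - m)], by nlinarith⟩
  nlinarith

lemma infinite_primes_prefix {q : ℕ} [NeZero q] {a : ZMod q} (ha : IsUnit a) (b X : ℕ)
    (hb : 2 ≤ b) (hX : 1 ≤ X) :
    {p : ℕ | p.Prime ∧ (p : ZMod q) = a ∧ ∃ m : ℤ, (X : ℝ) * (b : ℝ) ^ m < p ∧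
      (p : ℝ) < (X + 1) * (b : ℝ) ^ m}.Infinite := by
  have hbR : (2 : ℝ) ≤ b := by exact_mod_cast hb
  have hXR : (1 : ℝ) ≤ X := by exact_mod_cast hX
  have hb0 : (0 : ℝ) < b := by linarith
  have hX0 : (0 : ℝ) < X := by linarith
  have hlb : 0 < Real.log b := Real.log_pos (by linarith)
  set l0 := Real.log X with hl0
  set l1 := Real.log (X + 1) with hl1
  have hl : l0 < l1 := Real.log_lt_log hX0 (by linarith)
  have hl' : l1 ≤ l0 + Real.log b := by
    rw [hl0, hl1, ← Real.log_mul hX0.ne' hb0.ne']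
    exact Real.log_le_log (by linarith) (by nlinarith)
  set δ := (l1 - l0) / (2 * Real.log b) with hδ
  have hδ0 : 0 < δ := by
    apply div_pos <;> linarith
  have hδ1 : δ ≤ 1 / 2 := by
    rw [hδ, div_le_iff₀ (by positivity)]; linarith
  have hpi := Real.pi_pos
  have hc : Real.cos (Real.pi * δ) ^ 2 < 1 := by
    have h1 : 0 < Real.sin (Real.pi * δ) := Real.sin_pos_of_pos_of_lt_pi (by positivity) (by nlinarith)
    nlinarith [Real.sin_sq_add_cos_sq (Real.pi * δ)]
  refine (infinite_primes_cos ha (Real.pi / Real.log b)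
    (Real.pi * ((l0 + l1) / (2 * Real.log b))) (by positivity) (sq_nonneg _) hc).mono ?_
  rintro p ⟨hp, hpa, hcos⟩
  refine ⟨hp, hpa, ?_⟩
  rw [show Real.pi / Real.log b * Real.log p - Real.pi * ((l0 + l1) / (2 * Real.log b)) =
    Real.pi * ((Real.log p - (l0 + l1) / 2) / Real.log b) by field_simp] at hcos
  obtain ⟨m, hm⟩ := cos_to_interval hδ0 hδ1 hcos
  refine ⟨m, ?_⟩
  have hp0 : (0 : ℝ) < p := by exact_mod_cast hp.pos
  have hbm : (0 : ℝ) < (b : ℝ) ^ m := by positivity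
  have e : (Real.log p - (l0 + l1) / 2) / Real.log b - m =
      (Real.log p - (l0 + l1) / 2 - m * Real.log b) / Real.log b := by field_simp
  have e2 : δ = ((l1 - l0) / 2) / Real.log b := by rw [hδ]; field_simp
  rw [e, e2, abs_div, abs_of_pos hlb, div_lt_div_iff_of_pos_right hlb, abs_lt] at hm
  constructor
  · rw [← Real.log_lt_log_iff (by positivity) hp0, Real.log_mul hX0.ne' hbm.ne', Real.log_zpow]
    linarith [hm.1]
  · rw [← Real.log_lt_log_iff hp0 (by positivity), Real.log_mul (by positivity) hbm.ne',
      Real.log_zpow]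
    linarith [hm.2]

lemma foldl_valB (b : ℕ) (l : List ℕ) (c : ℕ) :
    l.foldl (fun acc d => acc * b + d) c = c * b ^ l.length + valB b l := by
  induction l generalizing c with
  | nil => simp [valB]
  | cons d l ih =>
    have h := ih (0 * b + d)
    simp only [valB, List.foldl_cons, List.length_cons] at h ⊢
    rw [ih, h, pow_succ]
    simp only [valB]
    ring

lemma valB_append (b : ℕ) (l l' : List ℕ) :
    valB b (l ++ l') = valB b l * b ^ l'.length + valB b l' := by
  rw [← foldl_valB]; simp [valB]

lemma valB_lt (b : ℕ) (l : List ℕ) (h : ∀ d ∈ l, d < b) : valB b l < b ^ l.length := by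
  induction l using List.reverseRecOn with
  | nil => simp [valB]
  | append_singleton l d ih =>
    have h1 := ih fun e he => h e (by simp [he])
    have h2 := h d (by simp)
    rw [valB_append]
    simp only [List.length_append, List.length_singleton, pow_one, pow_succ]
    have : valB b [d] = d := by simp [valB]
    rw [this]
    nlinarith

lemma exists_digits (b n W : ℕ) (hb : 0 < b) (hW : W < b ^ n) :
    ∃ w : List ℕ, w.length = n ∧ (∀ d ∈ w, d < b) ∧ valB b w = W := by
  induction n generalizing W with
  | zero => exact ⟨[], by simp, by simp, by
      have : W = 0 := by simpa using hW
      simp [valB, this]⟩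
  | succ n ih =>
    obtain ⟨w, h1, h2, h3⟩ := ih (W / b) (by
      rw [Nat.div_lt_iff_lt_mul hb]; rwa [pow_succ] at hW)
    refine ⟨w ++ [W % b], by simp [h1], ?_, ?_⟩
    · intro d hd
      rcases List.mem_append.1 hd with hd | hd
      · exact h2 d hd
      · simp only [List.mem_singleton] at hd
        rw [hd]; exact Nat.mod_lt _ hb
    · rw [valB_append, h3]
      simp only [valB, List.length_singleton, pow_one, List.foldl_cons, List.foldl_nil, zero_mul,
        zero_add]
      exact Nat.div_add_mod' W b

end helpers

/-- For a base `b ≥ 2` and digit strings `x`, `y` over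
`{0, …, b−1}` with `[x]_b ≥ 1` and `gcd(b, [y]_b) = 1`, there are infinitely
many digit strings `w` such that `[xwy]_b` is prime. -/
theorem stmt_10 (b : ℕ) (hb : 2 ≤ b) (x y : List ℕ)
    (hx : ∀ d ∈ x, d < b) (hy : ∀ d ∈ y, d < b)
    (hx1 : 1 ≤ valB b x) (hgcd : Nat.gcd b (valB b y) = 1) :
    {w : List ℕ | (∀ d ∈ w, d < b) ∧ Nat.Prime (valB b (x ++ w ++ y))}.Infinite := by
  intro hfin
  have hb0 : 0 < b := by omega
  set k := y.length with hk
  haveI : NeZero (b ^ k) := ⟨by positivity⟩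
  have ha : IsUnit ((valB b y : ℕ) : ZMod (b ^ k)) := by
    rw [ZMod.isUnit_iff_coprime]
    exact Nat.Coprime.pow_right k (Nat.Coprime.symm hgcd)
  have hinf := infinite_primes_prefix ha b (valB b x) hb hx1
  apply hinf
  refine Set.Finite.subset ((hfin.image fun w => valB b (x ++ w ++ y)).union
    (Set.finite_Iio ((valB b x + 1) * b ^ k))) ?_
  rintro p ⟨hp, hpa, m, hm1, hm2⟩
  by_cases hpl : p < (valB b x + 1) * b ^ k
  · exact Or.inr hpl
  left
  have hbR : (1 : ℝ) < b := by exact_mod_cast (show 1 < b by omega)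
  have hkm : (k : ℤ) < m := by
    have h1 : (((valB b x + 1) * b ^ k : ℕ) : ℝ) ≤ p := by exact_mod_cast not_lt.1 hpl
    push_cast at h1
    have h2 := lt_of_le_of_lt h1 hm2
    have h3 : (b : ℝ) ^ (k : ℤ) < (b : ℝ) ^ m := by
      rw [zpow_natCast]
      exact lt_of_mul_lt_mul_left h2 (by positivity)
    exact (zpow_lt_zpow_iff_right₀ hbR).1 h3
  obtain ⟨j, rfl⟩ : ∃ j : ℕ, m = ((j + k : ℕ) : ℤ) := ⟨(m - k).toNat, by omega⟩
  rw [zpow_natCast] at hm1 hm2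
  have hm1 : valB b x * b ^ (j + k) < p := by exact_mod_cast hm1
  have hm2 : p < (valB b x + 1) * b ^ (j + k) := by exact_mod_cast hm2
  obtain ⟨r, rfl⟩ := Nat.exists_eq_add_of_le hm1.le
  have hr : r < b ^ j * b ^ k := by rw [← pow_add]; linarith
  have hmod : r % b ^ k = valB b y := by
    have h1 := (ZMod.natCast_eq_natCast_iff' _ _ _).1 hpa
    rw [pow_add, ← mul_assoc, Nat.mul_add_mod_self_right, Nat.mod_eq_of_lt (valB_lt b y hy)] at h1
    exact h1
  obtain ⟨w, hw1, hw2, hw3⟩ := exists_digits b j (r / b ^ k) hb0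
    (by rw [Nat.div_lt_iff_lt_mul (by positivity)]; exact hr)
  have hv : valB b (x ++ w ++ y) = valB b x * b ^ (j + k) + r := by
    rw [valB_append, valB_append, hw1, hw3, ← hk, ← hmod, add_mul, add_assoc, Nat.div_add_mod',
      pow_add, mul_assoc]
  exact ⟨w, ⟨hw2, by rw [hv]; exact hp⟩, hv⟩
end

section
/- Let p be a prime with p ≥ 3, let k ≥ 1 be an integer with p^k ≥ 5, let c be a nonzero integer and b an integer with gcd(p, b) = 1, and let qp(n) = c(p^k·n² + b·n). Then there exist an integer ℓ ≥ 0 and a positive integer r with r < p^{ℓ+1} such that r does not divide qp(j) − qp(i) for all integers i, j with 0 ≤ i < j ≤ p^ℓ. -/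
section Helpers

open ArithmeticFunction.vonMangoldt Filter Topology MeasureTheory

/-- The weighted average of `f (log n)` over the von Mangoldt weights in a residue class. -/
noncomputable def wsum {N : ℕ} (a : ZMod N) (T σ : ℝ) (f : C(AddCircle T, ℂ)) : ℂ :=
  ∑' n : ℕ, ((residueClass a n / (n : ℝ) ^ σ : ℝ) : ℂ) * f ((Real.log n : ℝ) : AddCircle T)

lemma summable_weight {N : ℕ} (a : ZMod N) {σ : ℝ} (hσ : 1 < σ) :
    Summable fun n : ℕ ↦ residueClass a n / (n : ℝ) ^ σ := by
  have h := LSeriesSummable_of_abscissaOfAbsConv_lt_re (s := (σ : ℂ)) <|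
    (abscissaOfAbsConv_residueClass_le_one a).trans_lt <| by norm_cast
  have h2 := h.norm
  refine h2.congr fun n ↦ ?_
  rw [LSeries.norm_term_eq]
  split_ifs with hn
  · simp [hn]
  · simp [abs_of_nonneg (residueClass_nonneg a n)]

lemma weight_nonneg {N : ℕ} (a : ZMod N) (σ : ℝ) (n : ℕ) :
    0 ≤ residueClass a n / (n : ℝ) ^ σ :=
  div_nonneg (residueClass_nonneg a n) (Real.rpow_nonneg n.cast_nonneg _)

variable {T : ℝ} [hT : Fact (0 < T)]

lemma norm_wterm_le {N : ℕ} (a : ZMod N) (σ : ℝ) (f : C(AddCircle T, ℂ)) (n : ℕ) :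
    ‖((residueClass a n / (n : ℝ) ^ σ : ℝ) : ℂ) * f ((Real.log n : ℝ) : AddCircle T)‖ ≤
      (residueClass a n / (n : ℝ) ^ σ) * ‖f‖ := by
  rw [norm_mul, Complex.norm_real, Real.norm_of_nonneg (weight_nonneg a σ n)]
  exact mul_le_mul_of_nonneg_left (f.norm_coe_le_norm _) (weight_nonneg a σ n)

lemma summable_wterm {N : ℕ} (a : ZMod N) {σ : ℝ} (hσ : 1 < σ) (f : C(AddCircle T, ℂ)) :
    Summable fun n : ℕ ↦
      ((residueClass a n / (n : ℝ) ^ σ : ℝ) : ℂ) * f ((Real.log n : ℝ) : AddCircle T) :=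
  Summable.of_norm_bounded ((summable_weight a hσ).mul_right ‖f‖) (norm_wterm_le a σ f)

lemma wsum_add {N : ℕ} (a : ZMod N) {σ : ℝ} (hσ : 1 < σ) (f g : C(AddCircle T, ℂ)) :
    wsum a T σ (f + g) = wsum a T σ f + wsum a T σ g := by
  unfold wsum
  rw [← (summable_wterm a hσ f).tsum_add (summable_wterm a hσ g)]
  simp [mul_add]

lemma wsum_smul {N : ℕ} (a : ZMod N) (σ : ℝ) (z : ℂ) (f : C(AddCircle T, ℂ)) :
    wsum a T σ (z • f) = z * wsum a T σ f := by
  unfold wsum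
  rw [← tsum_mul_left]
  congr 1; ext n
  simp; ring

lemma norm_wsum_le {N : ℕ} (a : ZMod N) {σ : ℝ} (hσ : 1 < σ) (f : C(AddCircle T, ℂ)) :
    ‖wsum a T σ f‖ ≤ (∑' n : ℕ, residueClass a n / (n : ℝ) ^ σ) * ‖f‖ := by
  rw [← tsum_mul_right]
  exact tsum_of_norm_bounded ((summable_weight a hσ).mul_right ‖f‖).hasSum (norm_wterm_le a σ f)

lemma wsum_fourier {N : ℕ} (a : ZMod N) (σ : ℝ) (m : ℤ) :
    wsum a T σ (fourier m) =
      LSeries (fun n ↦ (residueClass a n : ℂ)) (σ - (2 * Real.pi * m / T : ℝ) * Complex.I) := by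
  unfold wsum LSeries
  congr 1; ext n
  rw [LSeries.term]
  split_ifs with hn
  · simp [hn]
  · have hn' : (n : ℂ) ≠ 0 := by exact_mod_cast hn
    rw [fourier_coe_apply, Complex.cpow_sub _ _ hn', Complex.ofReal_div,
      Complex.ofReal_cpow n.cast_nonneg]
    rw [Complex.cpow_def_of_ne_zero hn' (_ * Complex.I), ← Complex.ofReal_natCast,
      ← Complex.ofReal_log n.cast_nonneg]
    rw [div_div_eq_mul_div, div_mul_eq_mul_div]
    congr 3
    push_cast; ring

lemma tendsto_wsum_fourier {N : ℕ} [NeZero N] {a : ZMod N} (ha : IsUnit a) (m : ℤ) :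
    Tendsto (fun σ : ℝ ↦ ((σ - 1 : ℝ) : ℂ) * wsum a T σ (fourier m)) (𝓝[>] 1)
      (𝓝 ((N.totient : ℂ)⁻¹ * if m = 0 then 1 else 0)) := by
  set t : ℝ := 2 * Real.pi * m / T with ht
  have hpath : Tendsto (fun σ : ℝ ↦ ((σ : ℂ) - t * Complex.I)) (𝓝[>] 1)
      (𝓝[{s | 1 ≤ s.re}] ((1 : ℂ) - t * Complex.I)) := by
    refine tendsto_nhdsWithin_iff.2 ⟨?_, ?_⟩
    · refine Tendsto.mono_left ?_ nhdsWithin_le_nhds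
      have : Continuous fun σ : ℝ ↦ ((σ : ℂ) - t * Complex.I) := by fun_prop
      simpa using this.tendsto 1
    · filter_upwards [self_mem_nhdsWithin] with σ hσ
      simpa using le_of_lt hσ
  have haux := ((continuousOn_LFunctionResidueClassAux a) ((1 : ℂ) - t * Complex.I)
    (by simp)).tendsto.comp hpath
  have hlin : Tendsto (fun σ : ℝ ↦ ((σ - 1 : ℝ) : ℂ)) (𝓝[>] 1) (𝓝 0) := by
    refine Tendsto.mono_left ?_ nhdsWithin_le_nhds
    have : Continuous fun σ : ℝ ↦ ((σ - 1 : ℝ) : ℂ) := by fun_prop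
    simpa using this.tendsto 1
  have hfrac : Tendsto (fun σ : ℝ ↦ ((σ - 1 : ℝ) : ℂ) / ((σ : ℂ) - t * Complex.I - 1)) (𝓝[>] 1)
      (𝓝 (if m = 0 then 1 else 0)) := by
    split_ifs with hm
    · refine tendsto_const_nhds.congr' ?_
      filter_upwards [self_mem_nhdsWithin] with σ hσ
      have hσ' : ((σ : ℂ) - 1) ≠ 0 := by
        exact_mod_cast sub_ne_zero.2 (ne_of_gt hσ)
      have : t = 0 := by simp [ht, hm]
      simp [this, div_self hσ']
    · have ht0 : t ≠ 0 := by
        have := hT.out.ne'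
        have := Real.pi_ne_zero
        have : (m : ℝ) ≠ 0 := by exact_mod_cast hm
        rw [ht]; positivity
      have hden : Tendsto (fun σ : ℝ ↦ ((σ : ℂ) - t * Complex.I - 1)) (𝓝[>] 1)
          (𝓝 (1 - t * Complex.I - 1)) := 
        (hpath.mono_right nhdsWithin_le_nhds).sub tendsto_const_nhds
      have h : Tendsto (fun σ : ℝ ↦ ((σ - 1 : ℝ) : ℂ) / ((σ : ℂ) - t * Complex.I - 1)) (𝓝[>] 1)
          (𝓝 (0 / (1 - t * Complex.I - 1))) := hlin.div hden (by simp [ht0])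
      rwa [zero_div] at h
  have hfin := (hlin.mul haux).add (hfrac.const_mul ((N.totient : ℂ)⁻¹))
  rw [zero_mul, zero_add] at hfin
  refine hfin.congr' ?_
  filter_upwards [self_mem_nhdsWithin] with σ hσ
  have hre : ((σ : ℂ) - t * Complex.I) ∈ {s : ℂ | 1 < s.re} := by
    simpa using hσ
  rw [wsum_fourier, Function.comp_apply, eqOn_LFunctionResidueClassAux ha hre]
  simp only [← ht]
  ring

lemma integral_fourier_eq (m : ℤ) :
    ∫ x : AddCircle T, fourier m x ∂AddCircle.haarAddCircle = if m = 0 then 1 else 0 := by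
  split_ifs with hm
  · subst hm; simp
  · exact integral_eq_zero_of_add_right_eq_neg (μ := AddCircle.haarAddCircle)
      (fourier_add_half_inv_index hm hT.out)

lemma integrable_cm (f : C(AddCircle T, ℂ)) : Integrable f AddCircle.haarAddCircle :=
  f.continuous.integrable_of_hasCompactSupport (HasCompactSupport.of_compactSpace _)

lemma tendsto_wsum_span {N : ℕ} [NeZero N] {a : ZMod N} (ha : IsUnit a) (h : C(AddCircle T, ℂ))
    (hh : h ∈ Submodule.span ℂ (Set.range (@fourier T))) :
    Tendsto (fun σ : ℝ ↦ ((σ - 1 : ℝ) : ℂ) * wsum a T σ h) (𝓝[>] 1)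
      (𝓝 ((N.totient : ℂ)⁻¹ * ∫ x, h x ∂AddCircle.haarAddCircle)) := by
  induction hh using Submodule.span_induction with
  | mem x hx =>
    obtain ⟨m, rfl⟩ := hx
    rw [integral_fourier_eq]
    exact tendsto_wsum_fourier ha m
  | zero => simp [wsum]
  | add x y hx hy ihx ihy =>
    have := ihx.add ihy
    simp only [ContinuousMap.add_apply]
    rw [integral_add (integrable_cm x) (integrable_cm y), mul_add]
    refine this.congr' ?_
    filter_upwards [self_mem_nhdsWithin] with σ hσ
    rw [wsum_add a hσ, mul_add]
  | smul z x hx ih =>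
    have := ih.const_mul z
    simp only [ContinuousMap.smul_apply, integral_smul]
    convert this using 2
    · rw [wsum_smul]; ring
    · rw [smul_eq_mul]; ring

/-- If `g ≥ 0` is a nonzero continuous function on the circle, then `g (log q) ≠ 0` for arbitrarily
large primes `q` in any invertible residue class. -/
lemma exists_prime_bump {N : ℕ} [NeZero N] {a : ZMod N} (ha : IsUnit a) (g : C(AddCircle T, ℝ))
    (hg : ∀ x, 0 ≤ g x) (x₀ : AddCircle T) (hx₀ : g x₀ ≠ 0) (M : ℕ) :
    ∃ q : ℕ, M < q ∧ q.Prime ∧ (q : ZMod N) = a ∧ g ((Real.log q : ℝ) : AddCircle T) ≠ 0 := by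
  by_contra! hcon
  set c : ℝ := ∫ x, g x ∂AddCircle.haarAddCircle with hc
  have hcpos : 0 < c := g.continuous.integral_pos_of_hasCompactSupport_nonneg_nonzero
    (HasCompactSupport.of_compactSpace _) hg hx₀
  let G : C(AddCircle T, ℂ) := ⟨fun x ↦ (g x : ℂ), by fun_prop⟩
  have hGint : ∫ x, G x ∂AddCircle.haarAddCircle = (c : ℂ) := integral_ofReal
  have hGmem : G ∈ (Submodule.span ℂ (Set.range (@fourier T))).topologicalClosure := by
    rw [span_fourier_closure_eq_top]; trivial
  obtain ⟨h, hh, hd⟩ := Metric.mem_closure_iff.1 hGmem (c / 4) (by positivity)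
  rw [dist_eq_norm] at hd
  have hφ : 0 < (N.totient : ℝ)⁻¹ := by
    have := Nat.totient_pos.2 (NeZero.pos N)
    positivity
  -- the total mass
  have hone : Tendsto (fun σ : ℝ ↦ (σ - 1) * ∑' n : ℕ, residueClass a n / (n : ℝ) ^ σ) (𝓝[>] 1)
      (𝓝 (N.totient : ℝ)⁻¹) := by
    have h1 := tendsto_wsum_fourier (T := T) ha 0
    have h2 := (Complex.continuous_re.tendsto _).comp h1
    convert h2 using 1
    · ext σ
      simp only [Function.comp_apply, wsum, fourier_zero, mul_one]
      rw [← Complex.ofReal_tsum, ← Complex.ofReal_mul, Complex.ofReal_re]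
    · simp only [if_true, mul_one]
      congr 1
      rw [← Complex.ofReal_natCast, ← Complex.ofReal_inv, Complex.ofReal_re]
  -- the `G`-sum is negligible
  let v : ℕ → ℝ := fun n ↦ (if n.Prime then 0 else residueClass a n) / n +
    (if n ≤ M then residueClass a n / n else 0)
  have hv : Summable v := by
    refine (summable_residueClass_non_primes_div a).add ?_
    refine summable_of_hasFiniteSupport ((Set.finite_Iic M).subset ?_)
    intro n hn
    by_contra h'
    simp only [Set.mem_Iic] at h'
    simp [h'] at hn
  have hGbd : ∀ σ : ℝ, 1 < σ → ‖wsum a T σ G‖ ≤ (∑' n, v n) * ‖G‖ := by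
    intro σ hσ
    rw [← tsum_mul_right]
    refine tsum_of_norm_bounded (hv.mul_right ‖G‖).hasSum fun n ↦ ?_
    have hr := residueClass_nonneg a n
    have hrn : 0 ≤ residueClass a n / (n : ℝ) := by positivity
    have hle : residueClass a n / (n : ℝ) ^ σ ≤ residueClass a n / n := by
      rcases Nat.eq_zero_or_pos n with rfl | hn
      · simp
      · have h1 : (1 : ℝ) ≤ n := by exact_mod_cast hn
        have := Real.self_le_rpow_of_one_le h1 hσ.le
        gcongr
    have hb := norm_wterm_le a σ G n
    by_cases hcase : n.Prime ∧ M < n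
    · have hz : residueClass a n = 0 ∨ G ((Real.log n : ℝ) : AddCircle T) = 0 := by
        by_cases hna : (n : ZMod N) = a
        · right
          simpa [G] using hcon n hcase.2 hcase.1 hna
        · left
          simp [residueClass, hna]
      have hv0 : 0 ≤ v n := by
        simp only [v]; split_ifs <;> simp_all
      have : ((residueClass a n / (n : ℝ) ^ σ : ℝ) : ℂ) *
          G ((Real.log n : ℝ) : AddCircle T) = 0 := by
        rcases hz with hz | hz <;> simp [hz]
      rw [this, norm_zero]
      positivity
    · refine hb.trans (mul_le_mul_of_nonneg_right (hle.trans ?_) (norm_nonneg _))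
      simp only [v]
      by_cases hp : n.Prime
      · have : n ≤ M := by
          by_contra h'; exact hcase ⟨hp, not_le.1 h'⟩
        simp [hp, this]
      · simp only [hp, if_false]
        split_ifs <;> linarith
  have hlin : Tendsto (fun σ : ℝ ↦ σ - 1) (𝓝[>] 1) (𝓝 0) := by
    refine Tendsto.mono_left ?_ nhdsWithin_le_nhds
    have : Continuous fun σ : ℝ ↦ σ - 1 := by fun_prop
    simpa using this.tendsto 1
  have hspan := (tendsto_wsum_span ha h hh).norm
  have hbound : ∀ᶠ σ : ℝ in 𝓝[>] 1, ‖((σ - 1 : ℝ) : ℂ) * wsum a T σ h‖ ≤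
      (σ - 1) * ((∑' n, v n) * ‖G‖) +
      ((σ - 1) * ∑' n : ℕ, residueClass a n / (n : ℝ) ^ σ) * (c / 4) := by
    filter_upwards [self_mem_nhdsWithin] with σ hσ
    have hσ' : (1 : ℝ) < σ := hσ
    have h0 : 0 ≤ σ - 1 := by linarith
    rw [norm_mul, Complex.norm_real, Real.norm_of_nonneg h0, mul_assoc, ← mul_add]
    refine mul_le_mul_of_nonneg_left ?_ h0
    have e : h = G + (h - G) := by abel
    rw [e, wsum_add a hσ']
    refine (norm_add_le _ _).trans (add_le_add (hGbd σ hσ') ?_)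
    refine (norm_wsum_le a hσ' _).trans ?_
    refine mul_le_mul_of_nonneg_left ?_ (tsum_nonneg (weight_nonneg a σ))
    rw [norm_sub_rev]; exact hd.le
  have hlim := le_of_tendsto_of_tendsto hspan
    ((hlin.mul_const ((∑' n, v n) * ‖G‖)).add (hone.mul_const (c / 4))) hbound
  rw [zero_mul, zero_add, norm_mul, norm_inv, Complex.norm_natCast] at hlim
  have hI := le_of_mul_le_mul_left hlim hφ
  have hdiff : ‖(c : ℂ) - ∫ x, h x ∂AddCircle.haarAddCircle‖ ≤ c / 4 := by
    rw [← hGint, ← integral_sub (integrable_cm G) (integrable_cm h)]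
    have := norm_integral_le_of_norm_le_const (μ := (AddCircle.haarAddCircle : Measure (AddCircle T)))
      (f := fun x ↦ G x - h x) (C := c / 4)
      (Eventually.of_forall fun x ↦ ((G - h).norm_coe_le_norm x).trans hd.le)
    simpa using this
  have := norm_sub_norm_le (c : ℂ) (∫ x, h x ∂AddCircle.haarAddCircle)
  rw [Complex.norm_real, Real.norm_of_nonneg hcpos.le] at this
  linarith

end Helpers

/-- Arbitrarily large primes `q` in a residue class lying slightly below a power of `P`. -/
lemma exists_prime_near_pow {N : ℕ} [NeZero N] {a : ZMod N} (ha : IsUnit a) (P : ℕ) (hP : 1 < P)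
    (M : ℕ) :
    ∃ q m : ℕ, M < q ∧ q.Prime ∧ (q : ZMod N) = a ∧ 4 * P ^ (m + 1) < 5 * q ∧ q < P ^ (m + 1) := by
  have hP1 : (1 : ℝ) < P := by exact_mod_cast hP
  have hP0 : (0 : ℝ) < P := by linarith
  have hT : Fact (0 < Real.log P) := ⟨Real.log_pos hP1⟩
  set T := Real.log P with hTdef
  have hneg : Real.log (4 / 5) < 0 := Real.log_neg (by norm_num) (by norm_num)
  let U : Set (AddCircle T) := (fun y : ℝ ↦ (y : AddCircle T)) '' Set.Ioo (Real.log (4 / 5)) 0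
  have hU : IsOpen U := QuotientAddGroup.isOpenMap_coe _ isOpen_Ioo
  let x₀ : AddCircle T := ((Real.log (4 / 5) / 2 : ℝ) : AddCircle T)
  have hx₀ : x₀ ∈ U := ⟨_, ⟨by linarith, by linarith⟩, rfl⟩
  obtain ⟨g, hg0, hg1, hg⟩ := exists_continuous_zero_one_of_isClosed hU.isClosed_compl
    (isClosed_singleton (x := x₀)) (by
      rw [Set.disjoint_singleton_right]; exact fun h ↦ h hx₀)
  obtain ⟨q, hM, hq, hqa, hgq⟩ := exists_prime_bump ha g (fun x ↦ (hg x).1) x₀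
    (by rw [hg1 (Set.mem_singleton _)]; simp) M
  have hqU : ((Real.log q : ℝ) : AddCircle T) ∈ U := by
    by_contra h
    exact hgq (hg0 h)
  obtain ⟨y, ⟨hy1, hy2⟩, hy⟩ := hqU
  have hy' : ((Real.log q - y : ℝ) : AddCircle T) = 0 := by
    rw [AddCircle.coe_sub, ← hy, sub_self]
  obtain ⟨z, hz⟩ := (AddCircle.coe_eq_zero_iff T).1 hy'
  rw [zsmul_eq_mul] at hz
  have hq1 : (1 : ℝ) < q := by exact_mod_cast hq.one_lt
  have hlogq : 0 < Real.log q := Real.log_pos hq1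
  have hzpos : 0 < z := by
    have h1 : 0 < (z : ℝ) * T := by linarith
    have h2 : (0 : ℝ) < z := pos_of_mul_pos_left h1 hT.out.le
    exact_mod_cast h2
  obtain ⟨m, rfl⟩ : ∃ m : ℕ, z = ((m + 1 : ℕ) : ℤ) := ⟨z.toNat - 1, by omega⟩
  have hzT : (((m + 1 : ℕ) : ℤ) : ℝ) * T = Real.log ((P : ℝ) ^ (m + 1)) := by
    rw [Real.log_pow, Int.cast_natCast]
  rw [hzT] at hz
  have hPp : (0 : ℝ) < (P : ℝ) ^ (m + 1) := by positivity
  refine ⟨q, m, hM, hq, hqa, ?_, ?_⟩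
  · have h1 : Real.log (4 / 5 * (P : ℝ) ^ (m + 1)) < Real.log q := by
      rw [Real.log_mul (by norm_num) hPp.ne']; linarith
    have h2 := (Real.log_lt_log_iff (by positivity) (by linarith)).1 h1
    have h3 : (4 : ℝ) * (P : ℝ) ^ (m + 1) < 5 * q := by linarith
    exact_mod_cast h3
  · have h1 : Real.log q < Real.log ((P : ℝ) ^ (m + 1)) := by linarith
    have h2 := (Real.log_lt_log_iff (by linarith) hPp).1 h1
    exact_mod_cast h2

/-- For `qp(n) = c(p^k n² + b n)` with `p ≥ 3` prime, `p^k ≥ 5`,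
`c ≠ 0`, `gcd(p, b) = 1`, there exist `ℓ ≥ 0` and a positive `r < p^(ℓ+1)` such
that `r ∤ qp(j) − qp(i)` for all `0 ≤ i < j ≤ p^ℓ`. -/
theorem stmt_11 (p k : ℕ) (hp : p.Prime) (hp3 : 3 ≤ p) (hk : 1 ≤ k)
    (hpk : 5 ≤ p ^ k) (c b : ℤ) (hc : c ≠ 0) (hb : IsCoprime (p : ℤ) b)
    (qp : ℕ → ℤ) (hqp : ∀ n : ℕ, qp n = c * ((p : ℤ) ^ k * (n : ℤ) ^ 2 + b * (n : ℤ))) :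
    ∃ (ℓ r : ℕ), 0 < r ∧ r < p ^ (ℓ + 1) ∧
      ∀ i j : ℕ, i < j → j ≤ p ^ ℓ → ¬ ((r : ℤ) ∣ qp j - qp i) := by
  have hKne : NeZero (p ^ k) := ⟨by positivity⟩
  have hcop : IsCoprime ((p : ℤ) ^ k) b := hb.pow_left
  have hunit : IsUnit ((-b : ℤ) : ZMod (p ^ k)) := by
    rw [ZMod.coe_int_isUnit_iff_isCoprime]
    push_cast
    exact hcop.neg_right
  obtain ⟨q, l, hM, hq, hqa, hlow, hup⟩ := exists_prime_near_pow hunit p (by omega)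
    (c.natAbs + b.natAbs * p)
  refine ⟨l, q, hq.pos, hup, ?_⟩
  intro i j hij hj hdvd
  have hqZ : Prime (q : ℤ) := Nat.prime_iff_prime_int.1 hq
  set K : ℤ := (p : ℤ) ^ k with hK
  set X : ℤ := (p : ℤ) ^ l with hX
  have hK5 : 5 ≤ K := by rw [hK]; exact_mod_cast hpk
  have hp3' : (3 : ℤ) ≤ p := by exact_mod_cast hp3
  have hX1 : 1 ≤ X := by
    rw [hX]; exact_mod_cast Nat.one_le_pow _ _ (by omega)
  have hjX : (j : ℤ) ≤ X := by rw [hX]; exact_mod_cast hj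
  have hijZ : (i : ℤ) < j := by exact_mod_cast hij
  have hi0 : (0 : ℤ) ≤ i := Int.natCast_nonneg i
  have hlow' : 4 * (X * p) < 5 * (q : ℤ) := by
    rw [hX, ← pow_succ]; exact_mod_cast hlow
  have hup' : (q : ℤ) < X * p := by
    rw [hX, ← pow_succ]; exact_mod_cast hup
  have hM' : |c| + |b| * p < q := by
    have : ((c.natAbs + b.natAbs * p : ℕ) : ℤ) < (q : ℤ) := by exact_mod_cast hM
    push_cast at this
    exact this
  have hbX : |b| < X := by
    have h1 : |b| * p < X * p := by linarith [abs_nonneg c]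
    exact lt_of_mul_lt_mul_right h1 (by linarith)
  have hXp : X * 3 ≤ X * p := mul_le_mul_of_nonneg_left hp3' (by linarith)
  have hfac : qp j - qp i = c * (((j : ℤ) - i) * (K * (i + j) + b)) := by
    rw [hqp, hqp]; ring
  rw [hfac] at hdvd
  rcases hqZ.dvd_or_dvd hdvd with h | h
  · have h1 := Int.le_of_dvd (abs_pos.2 hc) ((dvd_abs _ _).2 h)
    have h2 : 0 ≤ |b| * (p : ℤ) := by positivity
    linarith
  rcases hqZ.dvd_or_dvd h with h | h
  · have h1 := Int.le_of_dvd (by linarith) h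
    linarith
  obtain ⟨t, ht⟩ := h
  -- `t ≡ -1` modulo `p ^ k`
  have hqb : K ∣ (q : ℤ) + b := by
    have h1 : (((q : ℤ) + b : ℤ) : ZMod (p ^ k)) = 0 := by
      push_cast
      rw [hqa]; push_cast; ring
    have h2 := (ZMod.intCast_zmod_eq_zero_iff_dvd _ _).1 h1
    rw [hK]; exact_mod_cast h2
  have hKt : K ∣ t + 1 := by
    have h1 : K ∣ b * (t + 1) := by
      have e : b * (t + 1) = t * (q + b) - K * (i + j) := by linear_combination ht
      rw [e]
      exact dvd_sub (hqb.mul_left t) (dvd_mul_right _ _)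
    exact hcop.dvd_of_dvd_mul_left h1
  have hbabs1 := neg_abs_le b
  have hbabs2 := le_abs_self b
  have hq0 : (0 : ℤ) < q := by exact_mod_cast hq.pos
  have htpos : 0 < t + 1 := by
    have h1 : 0 < (q : ℤ) * (t + 1) := by
      have : 0 ≤ K * ((i : ℤ) + j) := by positivity
      nlinarith
    exact pos_of_mul_pos_right h1 hq0.le
  have htK := Int.le_of_dvd htpos hKt
  have hmain : (q : ℤ) * (K - 1) ≤ K * (2 * X) + b := by
    have h1 : (q : ℤ) * (K - 1) ≤ q * t := mul_le_mul_of_nonneg_left (by linarith) hq0.le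
    have h2 : K * ((i : ℤ) + j) ≤ K * (2 * X) :=
      mul_le_mul_of_nonneg_left (by linarith) (by linarith)
    linarith
  have hlow2 : 4 * (X * p) * (K - 1) ≤ 5 * (q : ℤ) * (K - 1) :=
    mul_le_mul_of_nonneg_right hlow'.le (by linarith)
  -- numerical contradiction: `4 p (K - 1) ≥ 10 K + 5`
  have hnum : 10 * K + 5 ≤ 4 * (p : ℤ) * (K - 1) := by
    rcases Nat.lt_or_ge p 5 with h5 | h5
    · have hp' : p = 3 := by
        interval_cases p
        · rfl
        · exact absurd hp (by norm_num)
      subst hp'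
      have hk2 : 2 ≤ k := by
        by_contra hlt
        have : k = 1 := by omega
        subst this
        norm_num at hpk
      have : (9 : ℕ) ≤ 3 ^ k := by
        calc 9 = 3 ^ 2 := by norm_num
          _ ≤ 3 ^ k := Nat.pow_le_pow_right (by norm_num) hk2
      have h9 : 9 ≤ K := by rw [hK]; exact_mod_cast this
      push_cast
      linarith
    · have h5' : (5 : ℤ) ≤ p := by exact_mod_cast h5
      nlinarith
  have := mul_le_mul_of_nonneg_left hnum (by linarith : 0 ≤ X)
  nlinarith
end

section
/- Let p be a prime with p ≥ 3, let k ≥ 1 be an integer with p^k ≥ 5, let c be a nonzero integer and b an integer with gcd(p, b) = 1, and let qp(n) = c(p^k·n² + b·n). Then there exists an integer n ≥ 1 such that the discriminator satisfies D_{qp}(n) ≠ p^{⌈log_p n⌉}. -/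
open Filter Topology Complex ArithmeticFunction.vonMangoldt in
lemma lemA {q : ℕ} [NeZero q] {a : ZMod q} (ha : IsUnit a) (t : ℝ) :
    Tendsto (fun x : ℝ => ((x : ℂ) - 1) * LSeries (fun n => (residueClass a n : ℂ)) (x + t * I))
      (𝓝[>] 1) (𝓝 (if t = 0 then (q.totient : ℂ)⁻¹ else 0)) := by
  have h1 : Tendsto (fun x : ℝ => (x : ℂ) - 1) (𝓝[>] 1) (𝓝 0) := by
    have : Continuous (fun x : ℝ => (x : ℂ) - 1) := by fun_prop
    have := this.tendsto 1
    simp only [ofReal_one, sub_self] at this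
    exact this.mono_left nhdsWithin_le_nhds
  have h2 : Tendsto (fun x : ℝ => LFunctionResidueClassAux a (x + t * I)) (𝓝[>] 1)
      (𝓝 (LFunctionResidueClassAux a ((1 : ℝ) + t * I))) := by
    have hc := continuousOn_LFunctionResidueClassAux a ((1 : ℝ) + t * I) (by simp)
    refine hc.tendsto.comp (tendsto_nhdsWithin_iff.mpr ⟨?_, ?_⟩)
    · have : Continuous (fun x : ℝ => (x : ℂ) + t * I) := by fun_prop
      exact (this.tendsto 1).mono_left nhdsWithin_le_nhds
    · filter_upwards [self_mem_nhdsWithin] with x hx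
      simp only [Set.mem_Ioi] at hx
      simp [hx.le]
  have h3 : Tendsto (fun x : ℝ => ((x : ℂ) - 1) / ((x : ℂ) + t * I - 1)) (𝓝[>] 1)
      (𝓝 (if t = 0 then 1 else 0)) := by
    split_ifs with ht
    · refine tendsto_const_nhds.congr' ?_
      filter_upwards [self_mem_nhdsWithin] with x hx
      simp only [Set.mem_Ioi] at hx
      have : (x : ℂ) - 1 ≠ 0 := by
        rw [sub_ne_zero]; exact_mod_cast hx.ne'
      simp [ht, div_self this]
    · have h4 : Tendsto (fun x : ℝ => (x : ℂ) + t * I - 1) (𝓝[>] 1) (𝓝 (t * I)) := by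
        have : Continuous (fun x : ℝ => (x : ℂ) + t * I - 1) := by fun_prop
        have := this.tendsto 1
        simp only [ofReal_one, add_sub_cancel_left] at this
        exact this.mono_left nhdsWithin_le_nhds
      have := h1.div h4 (by simp [ht])
      rw [zero_div] at this
      exact this
  have h5 := (h1.mul h2).add (h3.const_mul (q.totient : ℂ)⁻¹)
  have e : (0 * LFunctionResidueClassAux a ((1 : ℝ) + t * I) +
      (q.totient : ℂ)⁻¹ * (if t = 0 then 1 else 0)) = (if t = 0 then (q.totient : ℂ)⁻¹ else 0) := by
    split_ifs <;> simp
  rw [e] at h5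
  refine h5.congr' ?_
  filter_upwards [self_mem_nhdsWithin] with x hx
  simp only [Set.mem_Ioi] at hx
  rw [eqOn_LFunctionResidueClassAux ha (show (x + t * I : ℂ) ∈ {s : ℂ | 1 < s.re} by simpa using hx)]
  simp only
  ring

open Complex in
lemma lemTrig (N : ℕ) (θ : ℝ) : (((2 + 2 * Real.cos θ) ^ N : ℝ) : ℂ) =
    ∑ k ∈ Finset.range (2 * N + 1), ((2 * N).choose k : ℂ) * exp (((k : ℝ) - N : ℝ) * θ * I) := by
  have h : (2 + 2 * cos (θ : ℂ)) = exp (-(θ * I)) * (exp (θ * I) + 1) ^ 2 := by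
    rw [Complex.cos]
    have : exp (-(θ * I)) * exp (θ * I) = 1 := by rw [← exp_add]; simp
    have e : (-(θ:ℂ)) * I = -(θ * I) := by ring
    rw [e]
    linear_combination (-exp (θ * I) - 2) * this
  push_cast
  rw [h, mul_pow, ← pow_mul, add_pow, Finset.mul_sum]
  refine Finset.sum_congr rfl fun k hk => ?_
  rw [one_pow, mul_one, ← exp_nat_mul, ← exp_nat_mul, ← mul_assoc, ← exp_add, mul_comm]
  congr 2
  ring

lemma lemN (K : ℝ) (hK0 : 0 ≤ K) (hK : K < 4) : ∃ N : ℕ, K ^ N < ((2 * N).choose N : ℝ) := by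
  have h := tendsto_self_mul_const_pow_of_lt_one (r := K / 4) (by positivity) (by linarith)
  obtain ⟨N, hN4, hN⟩ := ((Filter.eventually_ge_atTop 4).and (h.eventually (gt_mem_nhds (show (0:ℝ) < 1 by norm_num)))).exists
  refine ⟨N, ?_⟩
  have h1 : (4 : ℝ) ^ N < N * ((2 * N).choose N : ℝ) := by
    exact_mod_cast Nat.four_pow_lt_mul_centralBinom N hN4
  rw [div_pow, ← mul_div_assoc, div_lt_one (by positivity)] at hN
  have hNp : (0 : ℝ) < N := by exact_mod_cast (by omega : 0 < N)
  exact lt_of_mul_lt_mul_left (hN.trans h1) hNp.le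

open Filter Topology ArithmeticFunction.vonMangoldt in
lemma lemLim {q : ℕ} [NeZero q] {a : ZMod q} (ha : IsUnit a) (τ φ₀ K : ℝ) (hτ : 0 < τ) (N : ℕ) :
    Tendsto (fun x : ℝ => (x - 1) * ∑' n : ℕ, residueClass a n / (n : ℝ) ^ x *
        ((2 + 2 * Real.cos (τ * Real.log n - φ₀)) ^ N - K ^ N)) (𝓝[>] 1)
      (𝓝 ((q.totient : ℝ)⁻¹ * (((2 * N).choose N : ℝ) - K ^ N))) := by
  set f : ℕ → ℂ := fun n => (residueClass a n : ℂ) with hf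
  have hs : ∀ x : ℝ, 1 < x → ∀ t : ℝ, LSeriesSummable f (x + t * Complex.I) := by
    intro x hx t
    refine LSeriesSummable_of_abscissaOfAbsConv_lt_re ?_
    refine (abscissaOfAbsConv_residueClass_le_one a).trans_lt ?_
    simp only [Complex.add_re, Complex.ofReal_re, Complex.mul_re, Complex.I_re, Complex.I_im,
      Complex.ofReal_im]
    norm_num
    exact_mod_cast hx
  have hL := tendsto_finsetSum (Finset.range (2 * N + 1)) (fun k _ =>
    (lemA ha (-(((k : ℝ) - N) * τ))).const_mul
      (((2 * N).choose k : ℂ) * Complex.exp (-(((k : ℝ) - N : ℝ) * φ₀ * Complex.I))))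
  have hL2 := hL.sub ((lemA ha 0).const_mul ((K : ℂ) ^ N))
  have hlim : (∑ k ∈ Finset.range (2 * N + 1),
      (((2 * N).choose k : ℂ) * Complex.exp (-(((k : ℝ) - N : ℝ) * φ₀ * Complex.I))) *
        (if -(((k : ℝ) - N) * τ) = 0 then (q.totient : ℂ)⁻¹ else 0)) -
      (K : ℂ) ^ N * (if (0 : ℝ) = 0 then (q.totient : ℂ)⁻¹ else 0) =
      (((q.totient : ℝ)⁻¹ * (((2 * N).choose N : ℝ) - K ^ N) : ℝ) : ℂ) := by
    rw [Finset.sum_eq_single N]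
    · simp; ring
    · intro k _ hk
      rw [if_neg, mul_zero]
      simp only [neg_eq_zero, mul_eq_zero, not_or, sub_ne_zero]
      exact ⟨by exact_mod_cast hk, hτ.ne'⟩
    · intro h; simp at h; omega
  rw [hlim] at hL2
  have hre := (Complex.continuous_re.tendsto _).comp hL2
  rw [Complex.ofReal_re] at hre
  refine hre.congr' ?_
  filter_upwards [self_mem_nhdsWithin] with x hx
  simp only [Set.mem_Ioi] at hx
  simp only [Function.comp]
  have key : HasSum (fun n : ℕ => ((residueClass a n / (n : ℝ) ^ x *
        ((2 + 2 * Real.cos (τ * Real.log n - φ₀)) ^ N - K ^ N) : ℝ) : ℂ))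
      ((∑ k ∈ Finset.range (2 * N + 1),
      (((2 * N).choose k : ℂ) * Complex.exp (-(((k : ℝ) - N : ℝ) * φ₀ * Complex.I))) *
        LSeries f (x + (-(((k : ℝ) - N) * τ) : ℝ) * Complex.I)) - (K : ℂ) ^ N * LSeries f (x + (0 : ℝ) * Complex.I)) := by
    have := (hasSum_sum (s := Finset.range (2 * N + 1)) (fun k _ =>
      ((hs x hx (-(((k : ℝ) - N) * τ))).hasSum.mul_left 
       (((2 * N).choose k : ℂ) * Complex.exp (-(((k : ℝ) - N : ℝ) * φ₀ * Complex.I)))))).sub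
       ((hs x hx 0).hasSum.mul_left ((K : ℂ) ^ N))
    refine this.congr_fun ?_
    intro n
    rcases eq_or_ne n 0 with rfl | hn
    · simp
    have hnC : (n : ℂ) ≠ 0 := by exact_mod_cast hn
    have hpow : ∀ t : ℝ, LSeries.term f (x + t * Complex.I) n =
        (residueClass a n : ℂ) / (n : ℂ) ^ (x : ℂ) * Complex.exp (-(t * Real.log n * Complex.I)) := by
      intro t
      rw [LSeries.term_of_ne_zero hn, Complex.cpow_add _ _ hnC,
        Complex.cpow_def_of_ne_zero hnC (t * Complex.I), Complex.exp_neg, ← Complex.natCast_log]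
      have e : (Real.log n : ℂ) * (t * Complex.I) = t * Real.log n * Complex.I := by ring
      rw [e, ← div_div, div_eq_mul_inv]
    simp only [hpow]
    rw [Complex.ofReal_mul, Complex.ofReal_sub, lemTrig, Complex.ofReal_div,
      Complex.ofReal_cpow (Nat.cast_nonneg _), mul_sub, Finset.mul_sum]
    congr 1
    · refine Finset.sum_congr rfl fun k _ => ?_
      have e : Complex.exp (((k : ℝ) - N : ℝ) * (τ * Real.log n - φ₀ : ℝ) * Complex.I) =
          Complex.exp (-(((k : ℝ) - N : ℝ) * φ₀ * Complex.I)) *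
          Complex.exp (-((-(((k : ℝ) - N) * τ) : ℝ) * Real.log n * Complex.I)) := by
        rw [← Complex.exp_add]
        congr 1
        push_cast
        ring
      rw [e]
      push_cast
      ring
    · simp
      ring
  have h2 := key.tsum_eq
  rw [← Complex.ofReal_tsum] at h2
  have h3 : (((x - 1) * ∑' n : ℕ, residueClass a n / (n : ℝ) ^ x *
        ((2 + 2 * Real.cos (τ * Real.log n - φ₀)) ^ N - K ^ N) : ℝ) : ℂ) = 
      (∑ k ∈ Finset.range (2 * N + 1),
      (((2 * N).choose k : ℂ) * Complex.exp (-(((k : ℝ) - N : ℝ) * φ₀ * Complex.I))) *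
        (((x : ℂ) - 1) * LSeries f (x + (-(((k : ℝ) - N) * τ) : ℝ) * Complex.I))) - (K : ℂ) ^ N * (((x : ℂ) - 1) * LSeries f (x + (0 : ℝ) * Complex.I)) := by
    rw [Complex.ofReal_mul, h2, mul_sub, Finset.mul_sum]
    push_cast
    congr 1
    · refine Finset.sum_congr rfl fun k _ => ?_
      ring
    · ring
  rw [← h3, Complex.ofReal_re]

open Filter Topology ArithmeticFunction.vonMangoldt in
lemma lemCos {q : ℕ} [NeZero q] {a : ZMod q} (ha : IsUnit a) (τ φ₀ K : ℝ) (hτ : 0 < τ)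
    (hK0 : 0 ≤ K) (hK : K < 4) (B : ℕ) :
    ∃ m : ℕ, m.Prime ∧ B < m ∧ (m : ZMod q) = a ∧
      K < 2 + 2 * Real.cos (τ * Real.log m - φ₀) := by
  by_contra! hcon
  obtain ⟨N, hN⟩ := lemN K hK0 hK
  have hlim := lemLim ha τ φ₀ K hτ N
  set g : ℕ → ℝ := fun n => (if n.Prime then 0 else residueClass a n) / n * 4 ^ N +
    (if n ∈ Finset.range (B + 1) then residueClass a n * 4 ^ N else 0) with hg
  have hw := residueClass_nonneg a
  have hg0 : ∀ n, 0 ≤ g n := by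
    intro n
    have := hw n
    simp only [hg]
    refine add_nonneg ?_ ?_ <;> split_ifs <;> positivity
  have hgs : Summable g := by
    refine ((summable_residueClass_non_primes_div a).mul_right _).add ?_
    refine summable_of_ne_finset_zero (s := Finset.range (B + 1)) ?_
    intro n hn
    rw [if_neg hn]
  have hbound : ∀ x : ℝ, 1 < x → ∑' n : ℕ, residueClass a n / (n : ℝ) ^ x *
        ((2 + 2 * Real.cos (τ * Real.log n - φ₀)) ^ N - K ^ N) ≤ ∑' n, g n := by
    intro x hx
    by_cases hsum : Summable (fun n : ℕ => residueClass a n / (n : ℝ) ^ x *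
        ((2 + 2 * Real.cos (τ * Real.log n - φ₀)) ^ N - K ^ N))
    swap
    · rw [tsum_eq_zero_of_not_summable hsum]
      exact tsum_nonneg hg0
    refine hsum.tsum_le_tsum ?_ hgs
    intro n
    rcases eq_or_ne n 0 with rfl | hn
    · simpa using hg0 0
    have hn1 : (1 : ℝ) ≤ n := by exact_mod_cast Nat.one_le_iff_ne_zero.mpr hn
    have hwn := hw n
    have hd1 : residueClass a n / (n : ℝ) ^ x ≤ residueClass a n / n := by
      refine div_le_div_of_nonneg_left hwn (by linarith) ?_
      conv_lhs => rw [← Real.rpow_one n]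
      exact Real.rpow_le_rpow_of_exponent_le hn1 hx.le
    have hd2 : residueClass a n / (n : ℝ) ≤ residueClass a n := div_le_self hwn hn1
    have hd0 : 0 ≤ residueClass a n / (n : ℝ) ^ x := by positivity
    have hc0 : 0 ≤ 2 + 2 * Real.cos (τ * Real.log n - φ₀) := by
      linarith [Real.neg_one_le_cos (τ * Real.log n - φ₀)]
    have hc4 : (2 + 2 * Real.cos (τ * Real.log n - φ₀)) ^ N ≤ 4 ^ N := by
      refine pow_le_pow_left₀ hc0 ?_ N
      linarith [Real.cos_le_one (τ * Real.log n - φ₀)]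
    have hKN : 0 ≤ K ^ N := by positivity
    have hup : residueClass a n / (n : ℝ) ^ x *
        ((2 + 2 * Real.cos (τ * Real.log n - φ₀)) ^ N - K ^ N) ≤ 
        residueClass a n / (n : ℝ) * 4 ^ N := by
      refine (mul_le_mul_of_nonneg_left (show _ ≤ (4 : ℝ) ^ N by linarith) hd0).trans ?_
      exact mul_le_mul_of_nonneg_right hd1 (by positivity)
    simp only [hg]
    by_cases hpr : n.Prime
    · rw [if_pos hpr, zero_div, zero_mul, zero_add]
      by_cases hB : n ∈ Finset.range (B + 1)
      · rw [if_pos hB]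
        exact hup.trans (mul_le_mul_of_nonneg_right hd2 (by positivity))
      · rw [if_neg hB]
        by_cases hna : (n : ZMod q) = a
        · have := hcon n hpr (by simpa using hB) hna
          refine mul_nonpos_of_nonneg_of_nonpos hd0 ?_
          have := pow_le_pow_left₀ hc0 this N
          linarith
        · have : residueClass a n = 0 := by
            simp [residueClass, hna]
          rw [this]; simp
    · rw [if_neg hpr]
      refine hup.trans (le_add_of_nonneg_right ?_)
      split_ifs <;> positivity
  have hz : Tendsto (fun x : ℝ => (x - 1) * ∑' n, g n) (𝓝[>] 1) (𝓝 0) := by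
    have : Continuous (fun x : ℝ => (x - 1) * ∑' n, g n) := by fun_prop
    have := this.tendsto 1
    simp only [sub_self, zero_mul] at this
    exact this.mono_left nhdsWithin_le_nhds
  have hle := le_of_tendsto_of_tendsto hlim hz (by
    filter_upwards [self_mem_nhdsWithin] with x hx
    simp only [Set.mem_Ioi] at hx
    exact mul_le_mul_of_nonneg_left (hbound x hx) (by linarith))
  have hq : 0 < (q.totient : ℝ)⁻¹ := inv_pos.mpr (mod_cast q.totient.pos_of_neZero)
  have : 0 < (q.totient : ℝ)⁻¹ * (((2 * N).choose N : ℝ) - K ^ N) := mul_pos hq (by linarith)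
  linarith

lemma lemPrime {q : ℕ} [NeZero q] {a : ZMod q} (ha : IsUnit a) (p : ℕ) (hp : 2 ≤ p) (ρ : ℝ)
    (hρ : 1 / 2 ≤ ρ) (hρ1 : ρ < 1) (B : ℕ) :
    ∃ m E : ℕ, m.Prime ∧ B < m ∧ (m : ZMod q) = a ∧ ρ * (p : ℝ) ^ (E + 1) < m ∧ m < p ^ (E + 1) := by
  have hpR : (2 : ℝ) ≤ p := by exact_mod_cast hp
  have hlp : 0 < Real.log p := Real.log_pos (by linarith)
  set l := Real.log ρ with hl
  have hl0 : l < 0 := Real.log_neg (by linarith) hρ1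
  have hll : -l ≤ Real.log p := by
    rw [hl, ← Real.log_inv]
    refine Real.log_le_log (by positivity) (le_trans ?_ hpR)
    rw [inv_le_comm₀ (by linarith) (by norm_num)]; linarith
  set τ := 2 * Real.pi / Real.log p with hτ
  have hpi := Real.pi_pos
  have hτ0 : 0 < τ := by positivity
  have hτl : τ * Real.log p = 2 * Real.pi := by rw [hτ]; field_simp
  set δ := -l / 2 with hδ
  have hδπ : τ * δ ≤ Real.pi := by
    have : τ * δ ≤ τ * (Real.log p / 2) := mul_le_mul_of_nonneg_left (by linarith) hτ0.le
    linarith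
  have hδ0 : 0 < τ * δ := mul_pos hτ0 (by linarith)
  have hK : 2 + 2 * Real.cos (τ * δ) < 4 := by
    have := Real.cos_lt_cos_of_nonneg_of_le_pi le_rfl hδπ hδ0
    rw [Real.cos_zero] at this
    linarith
  obtain ⟨m, hm, hBm, hma, hc⟩ := lemCos ha τ (τ * (l / 2)) (2 + 2 * Real.cos (τ * δ)) hτ0
    (by linarith [Real.neg_one_le_cos (τ * δ)]) hK B
  set e : ℤ := round ((Real.log m - l / 2) / Real.log p) with he
  set y : ℝ := Real.log m - l / 2 - e * Real.log p with hy
  have hyabs : |y| ≤ Real.log p / 2 := by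
    have h := abs_sub_round ((Real.log m - l / 2) / Real.log p)
    have : y = ((Real.log m - l / 2) / Real.log p - e) * Real.log p := by
      rw [hy]; field_simp
    rw [this, abs_mul, abs_of_pos hlp]
    have := mul_le_mul_of_nonneg_right h hlp.le
    linarith
  have hcos : Real.cos (τ * Real.log m - τ * (l / 2)) = Real.cos (τ * |y|) := by
    have e1 : τ * Real.log m - τ * (l / 2) = τ * y + e * (2 * Real.pi) := by
      rw [← hτl, hy]; ring
    rw [e1, Real.cos_add_int_mul_two_pi, ← Real.cos_abs, abs_mul, abs_of_pos hτ0]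
  rw [hcos] at hc
  have hylt : |y| < δ := by
    by_contra! h
    have h1 : τ * |y| ≤ Real.pi := by
      have := mul_le_mul_of_nonneg_left hyabs hτ0.le
      linarith
    have := Real.cos_le_cos_of_nonneg_of_le_pi hδ0.le h1 (mul_le_mul_of_nonneg_left h hτ0.le)
    linarith
  obtain ⟨hy1, hy2⟩ := abs_lt.mp hylt
  have hmpos : (0 : ℝ) < m := by exact_mod_cast hm.pos
  have hlogm : 0 < Real.log m := Real.log_pos (by exact_mod_cast hm.one_lt)
  have hb1 : l + e * Real.log p < Real.log m := by linarith
  have hb2 : Real.log m < e * Real.log p := by linarith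
  have he0 : 0 < e := by
    have : 0 < (e : ℝ) * Real.log p := by linarith
    exact_mod_cast (pos_iff_pos_of_mul_pos this).mpr hlp
  obtain ⟨E, hE⟩ : ∃ E : ℕ, e = (E + 1 : ℕ) := ⟨(e - 1).toNat, by omega⟩
  have hEl : (e : ℝ) * Real.log p = Real.log ((p : ℝ) ^ (E + 1)) := by
    rw [Real.log_pow, hE]; push_cast; ring
  have hppos : (0 : ℝ) < (p : ℝ) ^ (E + 1) := by positivity
  refine ⟨m, E, hm, hBm, hma, ?_, ?_⟩
  · rw [← Real.log_lt_log_iff (by positivity) hmpos, Real.log_mul (by positivity) hppos.ne', ← hEl]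
    exact hb1
  · have : (m : ℝ) < (p : ℝ) ^ (E + 1) := by
      rw [← Real.log_lt_log_iff hmpos hppos, ← hEl]; exact hb2
    exact_mod_cast this

/-- For `qp(n) = c(p^k n² + b n)` with `p ≥ 3` prime, `p^k ≥ 5`,
`c ≠ 0`, `gcd(p, b) = 1`, there is some `n ≥ 1` such that the discriminator of
`qp` at `n` is not `p ^ ⌈log_p n⌉` (i.e. `p ^ Nat.clog p n`). -/
theorem stmt_12 (p k : ℕ) (hp : p.Prime) (hp3 : 3 ≤ p) (hk : 1 ≤ k)
    (hpk : 5 ≤ p ^ k) (c b : ℤ) (hc : c ≠ 0) (hb : IsCoprime (p : ℤ) b)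
    (qp : ℕ → ℤ) (hqp : ∀ n : ℕ, qp n = c * ((p : ℤ) ^ k * (n : ℤ) ^ 2 + b * (n : ℤ))) :
    ∃ n : ℕ, 1 ≤ n ∧
      ¬ IsLeast {m : ℕ | 0 < m ∧ ∀ i j : ℕ, i < j → j < n → ¬ ((m : ℤ) ∣ qp j - qp i)}
        (p ^ Nat.clog p n) := by
  obtain ⟨k', rfl⟩ : ∃ k', k = k' + 1 := ⟨k - 1, by omega⟩
  set Q := p ^ k' with hQ
  have hQ1 : 1 ≤ Q := Nat.one_le_pow _ _ (by omega)
  have hPQ : p ^ (k' + 1) = p * Q := by rw [hQ, pow_succ, mul_comm]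
  have hP2 : 2 * Q + 2 ≤ p ^ (k' + 1) := by
    rw [hPQ] at hpk ⊢
    rcases Nat.lt_or_ge p 4 with h | h
    · have : p = 3 := by omega
      rw [this] at hpk ⊢; omega
    · nlinarith
  have : NeZero (p ^ (k' + 1)) := ⟨by positivity⟩
  have hunit : IsUnit ((-b : ℤ) : ZMod (p ^ (k' + 1))) := by
    rw [ZMod.coe_int_isUnit_iff_isCoprime]
    push_cast
    exact (hb.pow_left).neg_right
  set ρ : ℝ := (2 * Q + 1 / 2) / (2 * Q + 1) with hρ
  have hQR : (1 : ℝ) ≤ Q := by exact_mod_cast hQ1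
  have hρ1 : ρ < 1 := by rw [hρ, div_lt_one (by positivity)]; linarith
  have hρ2 : 1 / 2 ≤ ρ := by rw [hρ, le_div_iff₀ (by positivity)]; linarith
  obtain ⟨m, E, hm, hBm, hma, hm1, hm2⟩ := lemPrime hunit p (by omega) ρ hρ2 hρ1
    (c.natAbs + 2 * b.natAbs + p)
  have hpE : 1 ≤ p ^ E := Nat.one_le_pow _ _ (by omega)
  refine ⟨p ^ E + 1, by omega, fun hleast => ?_⟩
  have hclog : Nat.clog p (p ^ E + 1) = E + 1 := by
    apply le_antisymm
    · refine Nat.clog_le_of_le_pow ?_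
      rw [pow_succ]; nlinarith
    · rw [Nat.succ_le_iff, Nat.lt_clog_iff_pow_lt (by omega)]
      omega
  rw [hclog] at hleast
  refine absurd hm2 (not_lt.mpr (hleast.2 (show m ∈ _ from ?_)))
  refine ⟨hm.pos, ?_⟩
  intro i j hij hj hdvd
  have hpEm : p ^ E < m := by
    have : (p : ℝ) ^ E < m := by
      refine lt_of_le_of_lt ?_ hm1
      rw [pow_succ]
      have h1 : (3 : ℝ) ≤ p := by exact_mod_cast hp3
      have h2 : (0 : ℝ) < (p : ℝ) ^ E := by positivity
      nlinarith [mul_le_mul hρ2 h1 (by norm_num) (by linarith)]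
    exact_mod_cast this
  have hmZ : Prime (m : ℤ) := Nat.prime_iff_prime_int.mp hm
  have e1 : qp j - qp i = c * (((j : ℤ) - i) * ((p : ℤ) ^ (k' + 1) * (i + j) + b)) := by
    rw [hqp, hqp]; ring
  rw [e1] at hdvd
  rcases hmZ.dvd_or_dvd hdvd with h | h
  · have := Int.natAbs_le_of_dvd_ne_zero h hc
    simp at this; omega
  rcases hmZ.dvd_or_dvd h with h | h
  · have := Int.le_of_dvd (by omega) h
    omega
  obtain ⟨s, hs⟩ := h
  have hmb : ((p : ℤ) ^ (k' + 1)) ∣ m + b := by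
    have : ((m + b : ℤ) : ZMod (p ^ (k' + 1))) = 0 := by
      push_cast; rw [hma]; push_cast; ring
    have := (ZMod.intCast_zmod_eq_zero_iff_dvd _ _).mp this
    exact_mod_cast this
  have hcop : IsCoprime ((p : ℤ) ^ (k' + 1)) (m : ℤ) := by
    refine IsCoprime.pow_left ?_
    rw [Nat.isCoprime_iff_coprime, Nat.coprime_primes hp hm]
    omega
  have hs1 : ((p : ℤ) ^ (k' + 1)) ∣ s + 1 := by
    refine hcop.dvd_of_dvd_mul_left ?_
    have : (m : ℤ) * (s + 1) = (p : ℤ) ^ (k' + 1) * (i + j) + (m + b) := by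
      rw [mul_add, ← hs]; ring
    rw [this]
    exact dvd_add (dvd_mul_right _ _) hmb
  have hPpos : (0 : ℤ) < (p : ℤ) ^ (k' + 1) := by positivity
  have hs0 : 0 ≤ s := by
    by_contra! hneg
    have h1 : (m : ℤ) * s ≤ -m := by nlinarith [hm.pos]
    have h2 : 0 ≤ (p : ℤ) ^ (k' + 1) * (i + j) := by positivity
    omega
  have hsP : (p : ℤ) ^ (k' + 1) ≤ s + 1 := Int.le_of_dvd (by omega) hs1
  have hPZ : (p : ℤ) ^ (k' + 1) = p * Q := by exact_mod_cast hPQ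
  have hsQ : 2 * (Q : ℤ) + 1 ≤ s := by
    have : ((2 * Q + 2 : ℕ) : ℤ) ≤ (p : ℤ) ^ (k' + 1) := by exact_mod_cast hP2
    push_cast at this; linarith
  have hsQR : 2 * (Q : ℝ) + 1 ≤ s := by exact_mod_cast hsQ
  have hsR : (p : ℝ) * Q * (i + j) + b = m * s := by
    rw [hPZ] at hs
    exact_mod_cast hs
  have hijR : (i : ℝ) + j ≤ 2 * (p : ℝ) ^ E := by
    have : i + j ≤ 2 * p ^ E := by omega
    exact_mod_cast this
  have hbR : 2 * (b : ℝ) ≤ m := by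
    have : 2 * b ≤ m := by omega
    exact_mod_cast this
  have hm2R : (m : ℝ) < (p : ℝ) ^ (E + 1) := by exact_mod_cast hm2
  have hm0 : (0 : ℝ) < m := by exact_mod_cast hm.pos
  have h1 : (2 * (Q : ℝ) + 1 / 2) * (p : ℝ) ^ (E + 1) < m * (2 * Q + 1) := by
    have := mul_lt_mul_of_pos_right hm1 (show (0 : ℝ) < 2 * Q + 1 by positivity)
    refine lt_of_eq_of_lt ?_ this
    rw [hρ]; field_simp
  have h2 : (m : ℝ) * (2 * Q + 1) ≤ m * s := mul_le_mul_of_nonneg_left hsQR hm0.le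
  have h3 : (p : ℝ) * Q * (i + j) ≤ p * Q * (2 * (p : ℝ) ^ E) :=
    mul_le_mul_of_nonneg_left hijR (by positivity)
  have h4 : (p : ℝ) * Q * (2 * (p : ℝ) ^ E) = 2 * Q * (p : ℝ) ^ (E + 1) := by
    rw [pow_succ]; ring
  linarith
end

section
/- Let p ≥ 5 be a prime number. Then for every quadratic sequence with integer coefficients, q(n) = αn² + βn + γ with α ≠ 0, there exists an integer n ≥ 1 such that p^{⌈log_p n⌉} is not the least positive integer m for which q(0), q(1), …, q(n−1) are pairwise incongruent modulo m. -/
open ArithmeticFunction.vonMangoldt in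
lemma osc_bound {N : ℕ} [NeZero N] {a : ZMod N} (ha : IsUnit a) (τ ψ : ℝ) (hτ : τ ≠ 0) :
    ∃ C : ℝ, ∀ x ∈ Set.Ioc (1:ℝ) 2, ∃ S : ℝ, S ≤ C ∧
      HasSum (fun n : ℕ => residueClass a n / (n:ℝ)^x * Real.cos (τ * Real.log n + ψ)) S := by
  let c : ℝ → ℂ := fun x => (x:ℂ) - τ * Complex.I
  have hre : ∀ x, (c x).re = x := fun x => by simp [c]
  have him : ∀ x, (c x).im = -τ := fun x => by simp [c]
  have hc : Continuous c := by fun_prop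
  have hne : ∀ x, c x - 1 ≠ 0 := fun x h => by
    have := congrArg Complex.im h
    simp [him] at this
    exact hτ this
  have hcont : ContinuousOn (fun x : ℝ => ‖LFunctionResidueClassAux a (c x) + (N.totient : ℂ)⁻¹ / (c x - 1)‖)
      (Set.Icc 1 2) := by
    refine ContinuousOn.norm (ContinuousOn.add ?_ ?_)
    · exact (continuousOn_LFunctionResidueClassAux a).comp hc.continuousOn fun x hx => by
        simpa [hre] using hx.1
    · exact ContinuousOn.div continuousOn_const (by fun_prop) fun x _ => hne x
  obtain ⟨C, hC⟩ := isCompact_Icc.bddAbove_image hcont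
  refine ⟨C, fun x hx => ?_⟩
  have hx1 : 1 < (c x).re := by rw [hre]; exact hx.1
  have hsum : LSeriesSummable (fun n => ((residueClass a n : ℝ) : ℂ)) (c x) :=
    LSeriesSummable_of_abscissaOfAbsConv_lt_re <|
      (abscissaOfAbsConv_residueClass_le_one a).trans_lt <| by exact_mod_cast hx1
  have h1 := hsum.hasSum
  have h2 := Complex.reCLM.hasSum (h1.mul_left (Complex.exp (ψ * Complex.I)))
  refine ⟨_, ?_, h2.congr_fun ?_⟩
  · have he := eqOn_LFunctionResidueClassAux ha (show c x ∈ {s : ℂ | 1 < s.re} from hx1)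
    have he' : (∑' n, LSeries.term (fun n => ((residueClass a n : ℝ) : ℂ)) (c x) n) =
      LFunctionResidueClassAux a (c x) + (N.totient : ℂ)⁻¹ / (c x - 1) := by
      rw [he]; simp only [sub_add_cancel]; rfl
    rw [he']
    refine (Complex.re_le_norm _).trans ?_
    rw [norm_mul, Complex.norm_exp_ofReal_mul_I, one_mul]
    exact hC ⟨x, ⟨hx.1.le, hx.2⟩, rfl⟩
  · intro n
    rcases eq_or_ne n 0 with rfl | hn
    · simp
    · have hn' : (n:ℂ) ≠ 0 := by exact_mod_cast hn
      have hnp : (0:ℝ) < n := by positivity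
      have hpw : Complex.exp (ψ * Complex.I) * (((residueClass a n : ℝ) : ℂ) / (n:ℂ)^(c x)) =
        ((residueClass a n / (n:ℝ)^x : ℝ) : ℂ) * Complex.exp ((τ * Real.log n + ψ : ℝ) * Complex.I) := by
        have : (n:ℂ)^(c x) = (n:ℂ)^(x:ℂ) * Complex.exp (-(τ * Real.log n * Complex.I)) := by
          change (n:ℂ)^((x:ℂ) - τ * Complex.I) = _
          rw [sub_eq_add_neg, Complex.cpow_add _ _ hn']
          congr 1
          rw [Complex.cpow_def_of_ne_zero hn', Complex.ofReal_log hnp.le]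
          congr 1; push_cast; ring
        rw [this, Complex.exp_neg]
        push_cast
        rw [Complex.ofReal_cpow hnp.le, add_mul, Complex.exp_add]
        push_cast
        field_simp
      rw [LSeries.term_of_ne_zero hn, Complex.reCLM_apply, hpw, Complex.re_ofReal_mul,
        Complex.exp_ofReal_mul_I_re]

open ArithmeticFunction.vonMangoldt in
lemma main_lower {N : ℕ} [NeZero N] {a : ZMod N} (ha : IsUnit a) :
    ∃ C : ℝ, ∀ x ∈ Set.Ioc (1:ℝ) 2, ∃ S : ℝ, (N.totient : ℝ)⁻¹ / (x - 1) - C ≤ S ∧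
      HasSum (fun n : ℕ => residueClass a n / (n:ℝ)^x) S := by
  obtain ⟨C, hC⟩ := LSeries_residueClass_lower_bound ha
  refine ⟨C, fun x hx => ⟨_, hC hx, Summable.hasSum ?_⟩⟩
  exact LSeries.summable_real_of_abscissaOfAbsConv_lt <|
        (abscissaOfAbsConv_residueClass_le_one a).trans_lt <| mod_cast hx.1

open ArithmeticFunction.vonMangoldt in
lemma exists_prime_cos {N : ℕ} [NeZero N] {a : ZMod N} (ha : IsUnit a) (τ ψ : ℝ) (hτ : τ ≠ 0)
    (R : ℕ) : ∃ r : ℕ, R < r ∧ r.Prime ∧ (r : ZMod N) = a ∧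
      0.35 < Real.cos (τ * Real.log r + ψ) := by
  by_contra! H
  obtain ⟨C0, h0⟩ := main_lower ha
  obtain ⟨C1, h1⟩ := osc_bound ha τ (ψ + Real.pi) hτ
  obtain ⟨C2, h2⟩ := osc_bound ha (2 * τ) (2 * ψ + Real.pi) (by simpa)
  obtain ⟨C3, h3⟩ := osc_bound ha (3 * τ) (3 * ψ + Real.pi) (by simpa)
  have hs1 := (summable_residueClass_non_primes_div a)
  have hs2 : Summable (fun n : ℕ => (if n ≤ R then residueClass a n else 0) / (n:ℝ)) := by
    refine summable_of_ne_finset_zero (s := Finset.range (R+1)) fun n hn => ?_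
    have : ¬ n ≤ R := by simpa using hn
    simp [this]
  obtain ⟨K, hK⟩ := hs1.add hs2
  have key : ∀ x ∈ Set.Ioc (1:ℝ) 2, 0.03 * ((N.totient : ℝ)⁻¹ / (x - 1) - C0) ≤
      15/4*C1 + 3/2*C2+1/4*C3 + 6*K := by
    intro x hx
    obtain ⟨S0, hS0, s0⟩ := h0 x hx
    obtain ⟨S1, hS1, s1⟩ := h1 x hx
    obtain ⟨S2, hS2, s2⟩ := h2 x hx
    obtain ⟨S3, hS3, s3⟩ := h3 x hx
    have := hasSum_le (fun n => ?_) (s0.mul_left 0.03)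
      ((((s1.mul_left (15/4)).add (s2.mul_left (3/2))).add (s3.mul_left (1/4))).add (hK.mul_left 6))
    · linarith
    · rcases eq_or_ne n 0 with rfl | hn
      · simp
      set t := τ * Real.log n + ψ with ht
      have e1 : Real.cos (τ * Real.log n + (ψ + Real.pi)) = - Real.cos t := by
        rw [← Real.cos_add_pi]; congr 1; ring
      have e2 : Real.cos (2 * τ * Real.log n + (2 * ψ + Real.pi)) = - (2 * Real.cos t^2 - 1) := by
        rw [← Real.cos_two_mul, ← Real.cos_add_pi]; congr 1; ring
      have e3 : Real.cos (3 * τ * Real.log n + (3 * ψ + Real.pi)) = - (4 * Real.cos t^3 - 3 * Real.cos t) := by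
        rw [← Real.cos_three_mul, ← Real.cos_add_pi]; congr 1; ring
      rw [e1, e2, e3]
      have hu1 := Real.cos_le_one t
      have hu2 := Real.neg_one_le_cos t
      have hf := residueClass_nonneg a n
      have hn1 : (1:ℝ) ≤ n := by exact_mod_cast Nat.one_le_iff_ne_zero.2 hn
      have hw : residueClass a n / (n:ℝ)^x ≤ residueClass a n / n := by
        refine div_le_div_of_nonneg_left hf (by positivity) ?_
        conv_lhs => rw [← Real.rpow_one n]
        exact Real.rpow_le_rpow_of_exponent_le hn1 hx.1.le
      have hw0 : 0 ≤ residueClass a n / (n:ℝ)^x := by positivity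
      set w := residueClass a n / (n:ℝ)^x
      set u := Real.cos t
      have hcalc : 15/4 * (w * -u) + 3/2*(w * -(2*u^2-1)) + 1/4*(w* -(4*u^3-3*u)) =
        w * (5/2 - (1+u)^3) := by ring
      rw [hcalc]
      by_cases hgood : n.Prime ∧ ¬ n ≤ R
      · simp only [hgood.1, hgood.2, if_true, if_false]
        by_cases hna : (n : ZMod N) = a
        · have := H n (not_le.1 hgood.2) hgood.1 hna
          have h3 : (1+u)^3 ≤ 1.35^3 :=
            pow_le_pow_left₀ (by linarith) (by linarith) 3
          have : 0.03 ≤ 5/2 - (1+u)^3 := by norm_num at h3 ⊢; linarith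
          have := mul_le_mul_of_nonneg_left this hw0
          simp only [zero_div]
          linarith
        · have : w = 0 := by simp [w, residueClass, hna]
          simp [this]
      · have h3 : (1+u)^3 ≤ 2^3 := pow_le_pow_left₀ (by linarith) (by linarith) 3
        have hb : residueClass a n / n ≤ (if n.Prime then 0 else residueClass a n) / (n:ℝ) +
          (if n ≤ R then residueClass a n else 0) / (n:ℝ) := by
          rw [← add_div]
          gcongr
          split_ifs <;> simp_all <;> linarith
        nlinarith
  have hq : 0 < (N.totient : ℝ)⁻¹ := inv_pos.mpr (mod_cast N.totient.pos_of_neZero)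
  set D := 15/4*C1 + 3/2*C2+1/4*C3 + 6*K
  set E := max 1 ((D / 0.03 + C0 + 1) / (N.totient : ℝ)⁻¹)
  have hE : 1 ≤ E := le_max_left _ _
  have := key (1 + 1/E) ⟨by simp; linarith, by
    have : 1 / E ≤ 1 := by rw [div_le_one (by linarith)]; exact hE
    linarith⟩
  have hE2 : (D / 0.03 + C0 + 1) / (N.totient : ℝ)⁻¹ ≤ E := le_max_right _ _
  rw [div_le_iff₀ hq] at hE2
  have e : (N.totient : ℝ)⁻¹ / (1 + 1/E - 1) = E * (N.totient : ℝ)⁻¹ := by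
    rw [add_sub_cancel_left]; simp; ring
  rw [e] at this
  have e2 : D = 0.03 * (D/0.03) := by ring
  nlinarith

lemma exists_prime_interval {N : ℕ} [NeZero N] {a : ZMod N} (ha : IsUnit a) (p : ℕ) (hp : 2 ≤ p)
    (R : ℕ) : ∃ r k : ℕ, R < r ∧ r.Prime ∧ (r : ZMod N) = a ∧ p^(5*k+3) < r^5 ∧ r < p^(k+1) := by
  have hp1 : (1:ℝ) < p := by exact_mod_cast hp
  have hL : 0 < Real.log p := Real.log_pos hp1
  have hpi := Real.pi_pos
  obtain ⟨r, hR, hr, hra, hcos⟩ := exists_prime_cos ha (2 * Real.pi / Real.log p)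
    (-(2 * Real.pi * (4/5))) (by positivity) R
  have hr0 : (0:ℝ) < r := by exact_mod_cast hr.pos
  have hr1 : (1:ℝ) < r := by exact_mod_cast hr.one_lt
  set y := Real.log r / Real.log p with hy
  have hy0 : 0 < y := div_pos (Real.log_pos hr1) hL
  have hyL : Real.log r = y * Real.log p := by rw [hy]; field_simp
  have harg : 2 * Real.pi / Real.log p * Real.log r + -(2 * Real.pi * (4/5)) = 2 * Real.pi * (y - 4/5) := by
    rw [hyL]; field_simp; ring
  rw [harg] at hcos
  let j : ℤ := round (y - 4/5)
  have hj := abs_sub_round (y - 4/5)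
  have habs : |y - 4/5 - j| < 1/5 := by
    by_contra! hcon
    have hc1 : Real.cos (2 * Real.pi * (y - 4/5)) = Real.cos |2 * Real.pi * (y - 4/5 - j)| := by
      rw [Real.cos_abs, ← Real.cos_sub_int_mul_two_pi _ j]; congr 1; ring
    have hc2 : Real.cos |2 * Real.pi * (y - 4/5 - j)| ≤ Real.cos (2 * (Real.pi / 5)) := by
      rw [abs_mul, abs_of_pos (by positivity : 0 < 2 * Real.pi)]
      apply Real.cos_le_cos_of_nonneg_of_le_pi
      · positivity
      · nlinarith
      · nlinarith
    rw [Real.cos_two_mul, Real.cos_pi_div_five] at hc2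
    have h5 : Real.sqrt 5 < 2.24 := by rw [Real.sqrt_lt' (by norm_num)]; norm_num
    have h5' := Real.sq_sqrt (show (0:ℝ) ≤ 5 by norm_num)
    rw [hc1] at hcos
    nlinarith
  rw [abs_lt] at habs
  have hjn : 0 ≤ j := by
    have : (-1:ℝ) < j := by linarith [habs.2]
    have : (-1:ℤ) < j := by exact_mod_cast this
    linarith
  obtain ⟨k, hk⟩ := Int.eq_ofNat_of_zero_le hjn
  have hjk : (j:ℝ) = k := by rw [hk]; simp
  rw [hjk] at habs
  refine ⟨r, k, hR, hr, hra, ?_, ?_⟩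
  · have : (p:ℝ)^(5*k+3) < (r:ℝ)^5 := by
      rw [← Real.log_lt_log_iff (by positivity) (by positivity), Real.log_pow, Real.log_pow, hyL]
      push_cast
      nlinarith
    exact_mod_cast this
  · have : (r:ℝ) < (p:ℝ)^(k+1) := by
      rw [← Real.log_lt_log_iff (by positivity) (by positivity), Real.log_pow, hyL]
      push_cast
      nlinarith
    exact_mod_cast this

lemma core_s13 (p : ℕ) (hp5 : 5 ≤ p) (g A B : ℤ) (hg : g ≠ 0) (hA : 5 ≤ A) (hAB : IsCoprime A B) :
    ∃ n m : ℕ, 1 ≤ n ∧ 0 < m ∧ m < p ^ Nat.clog p n ∧ ∀ i j : ℕ, i < j → j < n →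
      ¬ ((m:ℤ) ∣ g * (((j:ℤ) - i) * (A * (i + j) + B))) := by
  obtain ⟨N, rfl⟩ := Int.eq_ofNat_of_zero_le (show 0 ≤ A by linarith)
  have hN : N ≠ 0 := by rintro rfl; simp at hA
  haveI : NeZero N := ⟨hN⟩
  have ha : IsUnit ((-B : ℤ) : ZMod N) := by
    rw [ZMod.coe_int_isUnit_iff_isCoprime]; exact hAB.neg_right
  obtain ⟨r, k, hR, hr, hra, hlo, hhi⟩ := exists_prime_interval ha p (by omega)
    (p * (13 * B.natAbs + g.natAbs + 13))
  have hP : 0 < p ^ k := by positivity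
  have hPk : 13 * B.natAbs + g.natAbs + 13 < p ^ k := by
    rw [pow_succ, mul_comm] at hhi
    exact lt_of_mul_lt_mul_left (hR.trans hhi) (Nat.zero_le p)
  have hlo' : 13 * p^k < 5 * r := by
    by_contra! hcon
    have h1 : (5 * r)^5 ≤ (13 * p^k)^5 := Nat.pow_le_pow_left hcon 5
    have h2 : 5^3 ≤ p^3 := Nat.pow_le_pow_left hp5 3
    have h3 : p^(5*k+3) = (p^k)^5 * p^3 := by ring
    rw [h3] at hlo
    have h4 : 0 < (p^k)^5 := by positivity
    nlinarith
  refine ⟨p^k+1, r, by omega, hr.pos, ?_, ?_⟩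
  · have hc : k + 1 ≤ Nat.clog p (p^k+1) := by
      have : k < Nat.clog p (p^k+1) := by
        rw [Nat.lt_clog_iff_pow_lt (by omega)]; omega
      omega
    exact hhi.trans_le (Nat.pow_le_pow_right (by omega) hc)
  · intro i j hij hj hdvd
    have hrp : Prime (r:ℤ) := Nat.prime_iff_prime_int.1 hr
    have hpk : p * (13 * B.natAbs + g.natAbs + 13) ≥ 13 * B.natAbs + g.natAbs + 13 :=
      Nat.le_mul_of_pos_left _ (by omega)
    have hB := abs_le.1 (le_refl |B|)
    rw [Int.abs_eq_natAbs] at hB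
    rcases hrp.dvd_or_dvd hdvd with h | h
    · have := Int.natAbs_dvd_natAbs.2 h
      have := Nat.le_of_dvd (Int.natAbs_pos.2 hg) this
      simp at this; omega
    rcases hrp.dvd_or_dvd h with h | h
    · have := Int.le_of_dvd (by omega) h
      omega
    · obtain ⟨v, hv⟩ := h
      have h1 : (N:ℤ) ∣ r + B := by
        rw [← ZMod.intCast_zmod_eq_zero_iff_dvd]
        push_cast
        rw [hra]; simp
      obtain ⟨z, hz⟩ := h1
      have hcop : IsCoprime (N:ℤ) (r:ℤ) := by
        have : (r:ℤ) = -B + N * z := by linarith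
        rw [this]
        exact (IsCoprime.add_mul_left_right hAB.neg_right z)
      have h2 : (N:ℤ) ∣ v + 1 := by
        refine hcop.dvd_of_dvd_mul_left (z := v + 1) ?_
        exact ⟨i + j + z, by linear_combination -hv + hz⟩
      obtain ⟨w, hw⟩ := h2
      have hv2 : v = N * w - 1 := by linarith
      rw [hv2] at hv
      have hs0 : (0:ℤ) ≤ i + j := by omega
      have hs1 : (i:ℤ) + j ≤ 2 * (p^k : ℕ) := by omega
      have hPz : (13 * B.natAbs + g.natAbs + 13 : ℤ) < (p^k : ℕ) := by exact_mod_cast hPk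
      have hloz : (13 * (p^k : ℕ) : ℤ) < 5 * r := by exact_mod_cast hlo'
      generalize ((p^k : ℕ) : ℤ) = P at *
      generalize (i:ℤ) + j = s at *
      have hNs : (N:ℤ) * s ≤ N * (2 * P) := mul_le_mul_of_nonneg_left hs1 (by omega)
      have hNs0 : (0:ℤ) ≤ N * s := mul_nonneg (by omega) hs0
      rcases le_or_gt w 0 with hw0 | hw0
      · have : (r:ℤ) * (N * w - 1) ≤ - r := by
          have : (N:ℤ) * w ≤ 0 := mul_nonpos_of_nonneg_of_nonpos (by omega) hw0
          nlinarith
        omega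
      · have h5 : (r:ℤ) * (N - 1) ≤ r * (N * w - 1) := by
          apply mul_le_mul_of_nonneg_left _ (by omega)
          nlinarith
        have h6 : (r:ℤ) * (N - 1) * 5 ≥ 4 * N * r := by nlinarith
        have h7 : (N:ℤ) * (13 * P) ≤ N * (5 * r) := mul_le_mul_of_nonneg_left hloz.le (by omega)
        have h8 : 5 * P ≤ N * P := mul_le_mul_of_nonneg_right hA (by omega)
        nlinarith

lemma p_dvd (p : ℕ) (hp5 : 5 ≤ p) (hp : p.Prime) (α β : ℤ)
    (H : ∀ i j : ℕ, i < j → j < p → ¬ ((p : ℤ) ∣ ((j:ℤ) - i) * (α * (i + j) + β))) :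
    (p:ℤ) ∣ α ∧ ¬ (p:ℤ) ∣ β := by
  haveI : Fact p.Prime := ⟨hp⟩
  have h1 : (p:ℤ) ∣ α := by
    by_contra hα
    have hα' : (α : ZMod p) ≠ 0 := by
      rwa [Ne, ZMod.intCast_zmod_eq_zero_iff_dvd]
    have h2 : (2 : ZMod p) ≠ 0 := by
      intro h
      have : ((2:ℕ) : ZMod p) = 0 := by exact_mod_cast h
      rw [ZMod.natCast_eq_zero_iff] at this
      have := Nat.le_of_dvd (by norm_num) this
      omega
    let c : ZMod p := -β / α / 2
    have key : ∀ x y : ZMod p, x + y = 2 * c → x.val < y.val → False := by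
      intro x y hxy hlt
      apply H x.val y.val hlt (ZMod.val_lt y)
      rw [← ZMod.intCast_zmod_eq_zero_iff_dvd]
      push_cast
      simp only [ZMod.natCast_val, ZMod.cast_id', id]
      rw [hxy]
      simp only [c]
      field_simp
      ring
    rcases lt_trichotomy (c-1).val (c+1).val with h | h | h
    · exact key _ _ (by ring) h
    · have := ZMod.val_injective p h
      apply h2; linear_combination -this
    · exact key _ _ (by ring) h
  refine ⟨h1, fun hβ => H 0 1 (by norm_num) (by omega) ?_⟩
  simpa using dvd_add h1 hβ

/-- For a prime `p ≥ 5` and any quadratic sequence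
`q(n) = αn² + βn + γ` with integer coefficients and `α ≠ 0`, there is some
`n ≥ 1` for which `p ^ ⌈log_p n⌉` (i.e. `p ^ Nat.clog p n`) is not the least
positive integer modulo which `q(0), …, q(n−1)` are pairwise incongruent. -/
theorem stmt_13 (p : ℕ) (hp5 : 5 ≤ p) (hp : p.Prime) (α β γ : ℤ) (hα : α ≠ 0)
    (q : ℕ → ℤ) (hq : ∀ n : ℕ, q n = α * (n : ℤ) ^ 2 + β * (n : ℤ) + γ) :
    ∃ n : ℕ, 1 ≤ n ∧
      ¬ IsLeast {m : ℕ | 0 < m ∧ ∀ i j : ℕ, i < j → j < n → ¬ ((m : ℤ) ∣ q j - q i)}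
        (p ^ Nat.clog p n) := by
  by_contra! H
  have hdiff : ∀ i j : ℕ, q j - q i = ((j:ℤ) - i) * (α * (i + j) + β) := by
    intro i j; rw [hq, hq]; ring
  have h1 := (H p (by omega)).1.2
  have hclog : Nat.clog p p = 1 := by
    simpa using Nat.clog_pow p 1 (by omega)
  rw [hclog, pow_one] at h1
  obtain ⟨hpα, hpβ⟩ := p_dvd p hp5 hp α β fun i j hij hj => by
    rw [← hdiff]; exact h1 i j hij hj
  obtain ⟨g, A, B, hg, hA, hAB, rfl, rfl⟩ : ∃ g A B : ℤ, g ≠ 0 ∧ 0 < A ∧ IsCoprime A B ∧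
      α = g * A ∧ β = g * B := by
    have hg0 : (Int.gcd α β : ℤ) ≠ 0 := by
      exact_mod_cast (Int.gcd_pos_of_ne_zero_left β hα).ne'
    obtain ⟨A, hA⟩ := Int.gcd_dvd_left α β
    obtain ⟨B, hB⟩ := Int.gcd_dvd_right α β
    have hcop : IsCoprime A B := by
      obtain ⟨u, v, huv⟩ : ∃ u v : ℤ, (Int.gcd α β : ℤ) = α * u + β * v :=
        ⟨_, _, Int.gcd_eq_gcd_ab α β⟩
      refine ⟨u, v, mul_left_cancel₀ hg0 ?_⟩
      linear_combination -huv - u * hA - v * hB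
    have hA0 : A ≠ 0 := by rintro rfl; simp at hA; exact hα hA
    rcases lt_or_gt_of_ne hA0 with h | h
    · exact ⟨-(Int.gcd α β : ℤ), -A, -B, by simpa using hg0, by linarith, hcop.neg_neg,
        by linarith, by linarith⟩
    · exact ⟨_, A, B, hg0, h, hcop, hA, hB⟩
  have hpA : (p:ℤ) ∣ A := by
    rcases (Nat.prime_iff_prime_int.1 hp).dvd_or_dvd hpα with h | h
    · exact absurd (h.mul_right B) hpβ
    · exact h
  have hpA' := Int.le_of_dvd hA hpA
  obtain ⟨n, m, hn, hm, hlt, hm2⟩ := core_s13 p hp5 g A B hg (by omega) hAB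
  have := (H n hn).2 (show m ∈ _ from ⟨hm, fun i j hij hj => by
    rw [hdiff]
    convert hm2 i j hij hj using 2
    ring⟩)
  omega
end

section
/- Let p ≥ 3 be a prime number, let α′ and β′ be odd integers and γ an integer, and let qr(n) = (α′/2)n² + (β′/2)n + γ (an integer-valued quadratic). Suppose at least one of the following holds: (1) α′ = β′; (2) p does not divide α′; (3) p divides β′; (4) α′ = p^k·c for some integers k ≥ 1 and c with p not dividing c and c not dividing β′; (5) α′ = p^k·c for some integers k ≥ 1 and c with p not dividing c, c dividing β′, and p^k ≥ 5. Then there exists an integer n ≥ 1 such that p^{⌈log_p n⌉} is not the least positive integer m for which qr(0), qr(1), …, qr(n−1) are pairwise incongruent modulo m. -/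
/-- Density of powers of `2` along an arithmetic progression, relative to powers of `p`. -/
lemma aux_density (p : ℕ) (hp3 : 3 ≤ p) (hp : p.Prime) (L : ℕ) (hL : 1 ≤ L) (t₀ : ℕ) :
    ∃ u z : ℕ, 2 * p ^ z < 2 ^ (t₀ + L * u) ∧ 2 ^ (t₀ + L * u) < p ^ (z + 1) := by
  have hpR : (3 : ℝ) ≤ p := by exact_mod_cast hp3
  have hlp : 0 < Real.log p := Real.log_pos (by linarith)
  have hl2 : 0 < Real.log 2 := Real.log_pos (by norm_num)
  have hl2p : Real.log 2 < Real.log p := Real.log_lt_log (by norm_num) (by linarith)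
  haveI : Fact (0 < Real.log p) := ⟨hlp⟩
  have hirr : Irrational ((L * Real.log 2) / Real.log p) := by
    rintro ⟨q, hq⟩
    have hqpos : 0 < q := by
      have : (0 : ℝ) < q := by rw [hq]; positivity
      exact_mod_cast this
    have hd : (0 : ℝ) < q.den := by exact_mod_cast q.den_pos
    have hn : (q.num.toNat : ℤ) = q.num := Int.toNat_of_nonneg (Rat.num_pos.2 hqpos).le
    have hq' : (q : ℝ) = (q.num.toNat : ℝ) / q.den := by
      rw [Rat.cast_def]
      congr 1
      exact_mod_cast hn.symm
    rw [hq', div_eq_div_iff hd.ne' hlp.ne'] at hq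
    have h2 : Real.log ((p : ℝ) ^ q.num.toNat) = Real.log ((2 : ℝ) ^ (L * q.den)) := by
      rw [Real.log_pow, Real.log_pow]; push_cast; linarith
    have h3 : ((p : ℝ) ^ q.num.toNat) = ((2 : ℝ) ^ (L * q.den)) :=
      Real.log_injOn_pos (Set.mem_Ioi.2 (by positivity)) (Set.mem_Ioi.2 (by positivity)) h2
    have h4 : p ^ q.num.toNat = 2 ^ (L * q.den) := by exact_mod_cast h3
    have h5 : p ∣ 2 ^ (L * q.den) := by
      rw [← h4]
      apply dvd_pow_self
      have := Rat.num_pos.2 hqpos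
      omega
    have h6 := (Nat.prime_dvd_prime_iff_eq hp Nat.prime_two).1 (hp.dvd_of_dvd_pow h5)
    omega
  have hdz := AddCircle.denseRange_zsmul_coe_iff.2 hirr
  have hdn : DenseRange (fun n : ℕ => n • ((L * Real.log 2 : ℝ) : AddCircle (Real.log p))) :=
    denseRange_zsmul_iff_nsmul.1 hdz
  obtain ⟨u, hu⟩ := hdn.exists_mem_open
    (s := (QuotientAddGroup.mk : ℝ → AddCircle (Real.log p)) ''
      Set.Ioo (Real.log 2 - t₀ * Real.log 2) (Real.log p - t₀ * Real.log 2))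
    (QuotientAddGroup.isOpenMap_coe _ isOpen_Ioo)
    ((Set.nonempty_Ioo.2 (by linarith)).image _)
  obtain ⟨y, ⟨hy1, hy2⟩, hy⟩ := hu
  have hy3 : ((u * (L * Real.log 2) : ℝ) : AddCircle (Real.log p)) = (y : AddCircle (Real.log p)) := by
    rw [← nsmul_eq_mul]
    exact hy.symm
  rw [← sub_eq_zero, ← AddCircle.coe_sub, AddCircle.coe_eq_zero_iff] at hy3
  obtain ⟨z, hz⟩ := hy3
  rw [zsmul_eq_mul] at hz
  have hzpos : -1 < z := by
    have h1 : (0 : ℝ) < (z + 1) * Real.log p := by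
      have : (0 : ℝ) ≤ u * (L * Real.log 2) := by positivity
      have : (0 : ℝ) ≤ t₀ * Real.log 2 := by positivity
      linarith
    have h2 : (0 : ℝ) < z + 1 := pos_of_mul_pos_left h1 hlp.le
    have h3 : (0 : ℤ) < z + 1 := by exact_mod_cast h2
    omega
  lift z to ℕ using (by omega)
  refine ⟨u, z, ?_, ?_⟩
  · have : (2 : ℝ) * (p : ℝ) ^ z < 2 ^ (t₀ + L * u) := by
      rw [← Real.log_lt_log_iff (by positivity) (by positivity),
        Real.log_mul (by norm_num) (by positivity), Real.log_pow, Real.log_pow]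
      push_cast at hz ⊢
      linarith
    exact_mod_cast this
  · have : (2 : ℝ) ^ (t₀ + L * u) < (p : ℝ) ^ (z + 1) := by
      rw [← Real.log_lt_log_iff (by positivity) (by positivity), Real.log_pow, Real.log_pow]
      push_cast at hz ⊢
      linarith
    exact_mod_cast this

/-- Exponents `t` for which the `t`-th binary digit of the `2`-adic integer `-b/a` is `1`. -/
lemma aux_bits (a b : ℤ) (ha : Odd a) (hpos : 0 < a) (hab : ¬ a ∣ b) :
    ∃ L t₀ : ℕ, 1 ≤ L ∧ 1 ≤ t₀ ∧ ∀ u : ℕ, ∀ x : ℤ, 0 ≤ x → x < 2 ^ (t₀ + L * u) →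
      ¬ (2 : ℤ) ^ (t₀ + L * u + 1) ∣ a * x + b := by
  have hb0 : 0 ≤ b % a := Int.emod_nonneg _ hpos.ne'
  have hba : b % a < a := Int.emod_lt_of_pos _ hpos
  have hbne : b % a ≠ 0 := fun h => hab (Int.dvd_of_emod_eq_zero h)
  set r := b % a with hr
  have hex : ∃ j : ℕ, a ≤ 2 ^ (j + 1) * r := by
    refine ⟨a.toNat, ?_⟩
    have h1 : a.toNat < 2 ^ a.toNat := Nat.lt_two_pow_self
    have h2 : (a.toNat : ℤ) < 2 ^ a.toNat := by exact_mod_cast h1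
    rw [Int.toNat_of_nonneg hpos.le] at h2
    rw [pow_succ]
    have h3 : 1 ≤ r := by omega
    nlinarith
  classical
  obtain ⟨j, hj1, hj2⟩ : ∃ j : ℕ, a ≤ 2 ^ (j + 1) * r ∧ 2 ^ j * r < a := by
    refine ⟨Nat.find hex, Nat.find_spec hex, ?_⟩
    rcases Nat.eq_zero_or_pos (Nat.find hex) with h | h
    · rw [h]; simpa using hba
    · have := Nat.find_min hex (Nat.sub_lt h one_pos)
      rw [show Nat.find hex - 1 + 1 = Nat.find hex by omega] at this
      exact not_le.1 this
  have hcop : IsCoprime a 2 := by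
    obtain ⟨k, hk⟩ := ha
    exact ⟨1, -k, by rw [hk]; ring⟩
  obtain ⟨L, hL, hL1⟩ : ∃ L : ℕ, 1 ≤ L ∧ a ∣ 2 ^ L - 1 := by
    refine ⟨Nat.totient a.natAbs, Nat.totient_pos.2 (Int.natAbs_pos.2 hpos.ne'), ?_⟩
    have hc : Nat.Coprime 2 a.natAbs := by
      rw [Int.isCoprime_iff_gcd_eq_one] at hcop
      rw [Nat.coprime_comm]
      exact hcop
    have h1 := Nat.ModEq.pow_totient hc
    have h2 := (Int.natCast_modEq_iff.2 h1).symm.dvd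
    push_cast at h2
    simpa using h2
  have hLle : ∀ M : ℕ, M ≤ L * M := fun M => Nat.le_mul_of_pos_left M hL
  have hLM := hLle (j + 2 + b.natAbs)
  refine ⟨L, L * (j + 2 + b.natAbs) - j - 1, hL, by omega, ?_⟩
  intro u x hx0 hx hdvd
  set t := L * (j + 2 + b.natAbs) - j - 1 + L * u with ht
  have htL : t + 1 + j = L * (j + 2 + b.natAbs + u) := by
    rw [ht, mul_add L _ u]; omega
  have hbt : b.natAbs < t := by omega
  have hbt2 : |b| < 2 ^ t := by
    rw [Int.abs_eq_natAbs]
    exact_mod_cast hbt.trans Nat.lt_two_pow_self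
  obtain ⟨hb1, hb2⟩ := abs_lt.1 hbt2
  obtain ⟨s, hs⟩ := hdvd
  have hP : (0 : ℤ) < 2 ^ t := by positivity
  rw [pow_succ] at hs
  have hs0 : 0 ≤ s := by
    by_contra hneg
    have h1 : s ≤ -1 := by omega
    have := mul_nonneg hpos.le hx0
    nlinarith
  have hs1 : 2 * s ≤ a := by
    by_contra hneg
    have h1 : a + 1 ≤ 2 * s := by omega
    have h2 : a * x ≤ a * 2 ^ t := mul_le_mul_of_nonneg_left hx.le hpos.le
    nlinarith
  -- compare residues
  have hM : a ∣ 2 ^ (t + 1 + j) - 1 := by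
    rw [htL, pow_mul]
    exact hL1.trans (sub_one_dvd_pow_sub_one _ _)
  have hbr : a ∣ b - r := Int.dvd_self_sub_emod
  have hkey : a ∣ 2 ^ (t + 1) * (s - 2 ^ j * r) := by
    have e : (2 : ℤ) ^ (t + 1) * (s - 2 ^ j * r) =
        a * x + (b - r) - r * (2 ^ (t + 1 + j) - 1) := by
      have : (2 : ℤ) ^ (t + 1 + j) = 2 ^ t * 2 * 2 ^ j := by rw [pow_add, pow_succ]
      rw [this, pow_succ]
      linear_combination -hs
    rw [e]
    exact dvd_sub (dvd_add (dvd_mul_right _ _) hbr) (Dvd.dvd.mul_left hM r)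
  have hk2 : a ∣ s - 2 ^ j * r := (hcop.pow_right).dvd_of_dvd_mul_left hkey
  have hr1 : 0 < 2 ^ j * r := by
    have : 0 < r := by omega
    positivity
  have h0 : s - 2 ^ j * r = 0 := by
    apply Int.eq_zero_of_abs_lt_dvd hk2
    rw [abs_lt]
    constructor <;> omega
  rw [pow_succ] at hj1
  obtain ⟨k, hk⟩ := ha
  have : 2 ^ j * 2 * r = 2 * (2 ^ j * r) := by ring
  omega

lemma aux_bits' (a b : ℤ) (ha : Odd a) (hab : ¬ a ∣ b) :
    ∃ L t₀ : ℕ, 1 ≤ L ∧ 1 ≤ t₀ ∧ ∀ u : ℕ, ∀ x : ℤ, 0 ≤ x → x < 2 ^ (t₀ + L * u) →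
      ¬ (2 : ℤ) ^ (t₀ + L * u + 1) ∣ a * x + b := by
  rcases lt_trichotomy a 0 with h | h | h
  · obtain ⟨L, t₀, h1, h2, h3⟩ := aux_bits (-a) (-b) ha.neg (by omega) (by simpa using hab)
    refine ⟨L, t₀, h1, h2, fun u x hx hx' hd => h3 u x hx hx' ?_⟩
    have : -a * x + -b = -(a * x + b) := by ring
    rw [this]
    exact (dvd_neg).2 hd
  · subst h; simp at ha
  · exact aux_bits a b ha h hab

/-- If `p ∣ a` and `p ∤ b`, a power of two eventually beats the power of `p`. -/
lemma aux_main (p : ℕ) (hp3 : 3 ≤ p) (hp : p.Prime) (a b c : ℤ)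
    (ha : Odd a) (hb : Odd b)
    (qr : ℕ → ℤ) (hqr : ∀ n : ℕ, 2 * qr n = a * (n : ℤ) ^ 2 + b * (n : ℤ) + 2 * c)
    (hpa : (p : ℤ) ∣ a) (hpb : ¬ (p : ℤ) ∣ b) :
    ∃ n : ℕ, 1 ≤ n ∧
      ¬ IsLeast {m : ℕ | 0 < m ∧ ∀ i j : ℕ, i < j → j < n → ¬ ((m : ℤ) ∣ qr j - qr i)}
        (p ^ Nat.clog p n) := by
  obtain ⟨L, t₀, hL, ht₀, H⟩ := aux_bits' a b ha (fun h => hpb (hpa.trans h))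
  obtain ⟨u, z, hz1, hz2⟩ := aux_density p hp3 hp L hL t₀
  specialize H u
  have ht : 1 ≤ t₀ + L * u := by omega
  generalize t₀ + L * u = t at *
  obtain ⟨w, rfl⟩ : ∃ w, t = w + 1 := ⟨t - 1, by omega⟩
  have hw : p ^ z < 2 ^ w := by rw [pow_succ] at hz1; omega
  refine ⟨2 ^ w + 1, by omega, ?_⟩
  have hw1 : 1 ≤ 2 ^ w := Nat.one_le_two_pow
  have hclog : p ^ (z + 1) ≤ p ^ Nat.clog p (2 ^ w + 1) := by
    apply Nat.pow_le_pow_right (by omega)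
    exact (Nat.lt_clog_iff_pow_lt (by omega)).2 (by omega)
  rintro ⟨-, hle⟩
  have hmem : 2 ^ (w + 1) ∈
      {m : ℕ | 0 < m ∧ ∀ i j : ℕ, i < j → j < 2 ^ w + 1 → ¬ ((m : ℤ) ∣ qr j - qr i)} := by
    refine ⟨by positivity, ?_⟩
    intro i j hij hj hd
    have h2 : (2 : ℤ) ^ (w + 1 + 1) ∣ ((j : ℤ) - i) * (a * ((i + j : ℕ) : ℤ) + b) := by
      obtain ⟨k, hk⟩ := hd
      refine ⟨k, ?_⟩
      push_cast at hk ⊢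
      rw [pow_succ]
      linear_combination 2 * hk - hqr j + hqr i
    rcases Int.even_or_odd ((j : ℤ) - i) with he | ho
    · have hodd : Odd (a * ((i + j : ℕ) : ℤ) + b) := by
        have : Even ((i + j : ℕ) : ℤ) := by
          obtain ⟨k, hk⟩ := he
          exact ⟨k + i, by push_cast; linarith⟩
        exact (this.mul_left a).add_odd hb
      have hc : IsCoprime ((2 : ℤ) ^ (w + 1 + 1)) (a * ((i + j : ℕ) : ℤ) + b) :=
        IsCoprime.pow_left ((Int.isCoprime_two_left).2 hodd)
      have hd3 := hc.dvd_of_dvd_mul_right h2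
      have := Int.le_of_dvd (by omega) hd3
      have h5 : (2 : ℤ) ^ (w + 1 + 1) = 4 * ((2 ^ w : ℕ) : ℤ) := by push_cast; ring
      omega
    · have hc : IsCoprime ((2 : ℤ) ^ (w + 1 + 1)) ((j : ℤ) - i) :=
        IsCoprime.pow_left ((Int.isCoprime_two_left).2 ho)
      have hd3 := hc.dvd_of_dvd_mul_left h2
      refine H ((i + j : ℕ) : ℤ) (by positivity) ?_ hd3
      have h5 : (2 : ℤ) ^ (w + 1) = 2 * ((2 ^ w : ℕ) : ℤ) := by push_cast; ring
      omega
  have := hle hmem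
  omega

/-- If `p ∣ a` and `p ∣ b`, then `p` fails for `n = 2`. -/
lemma aux_dvd (p : ℕ) (hp3 : 3 ≤ p) (hp : p.Prime) (a b c : ℤ)
    (qr : ℕ → ℤ) (hqr : ∀ n : ℕ, 2 * qr n = a * (n : ℤ) ^ 2 + b * (n : ℤ) + 2 * c)
    (hpa : (p : ℤ) ∣ a) (hpb : (p : ℤ) ∣ b) :
    ∃ n : ℕ, 1 ≤ n ∧
      ¬ IsLeast {m : ℕ | 0 < m ∧ ∀ i j : ℕ, i < j → j < n → ¬ ((m : ℤ) ∣ qr j - qr i)}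
        (p ^ Nat.clog p n) := by
  refine ⟨2, by norm_num, ?_⟩
  rw [Nat.clog_eq_one le_rfl (by omega), pow_one]
  rintro ⟨⟨-, h⟩, -⟩
  apply h 0 1 (by norm_num) (by norm_num)
  have hp2 : IsCoprime (p : ℤ) 2 := by
    rw [Int.isCoprime_two_right]
    exact_mod_cast hp.odd_of_ne_two (by omega)
  apply hp2.dvd_of_dvd_mul_left
  have : 2 * (qr 1 - qr 0) = a + b := by
    have h1 := hqr 1
    have h0 := hqr 0
    push_cast at h1 h0
    linarith
  rw [this]
  exact dvd_add hpa hpb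

/-- If `p ∤ a`, then `p` fails for `n = p`. -/
lemma aux_not_dvd (p : ℕ) (hp3 : 3 ≤ p) (hp : p.Prime) (a b c : ℤ)
    (qr : ℕ → ℤ) (hqr : ∀ n : ℕ, 2 * qr n = a * (n : ℤ) ^ 2 + b * (n : ℤ) + 2 * c)
    (hpa : ¬ (p : ℤ) ∣ a) :
    ∃ n : ℕ, 1 ≤ n ∧
      ¬ IsLeast {m : ℕ | 0 < m ∧ ∀ i j : ℕ, i < j → j < n → ¬ ((m : ℤ) ∣ qr j - qr i)}
        (p ^ Nat.clog p n) := by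
  refine ⟨p, by omega, ?_⟩
  rw [Nat.clog_eq_one (by omega) le_rfl, pow_one]
  rintro ⟨⟨-, h⟩, -⟩
  have hp2 : IsCoprime (p : ℤ) 2 := by
    rw [Int.isCoprime_two_right]
    exact_mod_cast hp.odd_of_ne_two (by omega)
  have key : ∀ i j : ℕ, i < j → j < p → ¬ (p : ℤ) ∣ a * ((i : ℤ) + j) + b := by
    intro i j hij hj hd
    apply h i j hij hj
    apply hp2.dvd_of_dvd_mul_left
    have : 2 * (qr j - qr i) = ((j : ℤ) - i) * (a * ((i : ℤ) + j) + b) := by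
      linear_combination hqr j - hqr i
    rw [this]
    exact hd.mul_left _
  have hcop : IsCoprime a (p : ℤ) :=
    ((Nat.prime_iff_prime_int.1 hp).coprime_iff_not_dvd.2 hpa).symm
  obtain ⟨v, w, hvw⟩ := hcop
  have hpp : (0 : ℤ) < p := by omega
  -- `r` is the root of `a * r + b` modulo `p`
  obtain ⟨r, hr, hrd⟩ : ∃ r : ℕ, r < p ∧ (p : ℤ) ∣ a * r + b := by
    have h0 := Int.emod_nonneg (-(v * b)) hpp.ne'
    have h1 := Int.emod_lt_of_pos (-(v * b)) hpp
    refine ⟨((-(v * b)) % (p : ℤ)).toNat, by omega, ?_⟩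
    rw [Int.toNat_of_nonneg h0, Int.emod_def]
    exact ⟨w * b - a * (-(v * b) / p), by linear_combination (-b) * hvw⟩
  rcases Nat.eq_zero_or_pos r with h0 | h0
  · subst h0
    apply key 1 (p - 1) (by omega) (by omega)
    have : ((1 : ℕ) : ℤ) + ((p - 1 : ℕ) : ℤ) = p := by omega
    rw [this]
    have := dvd_add (Dvd.intro_left a rfl : (p : ℤ) ∣ a * p) hrd
    simpa using this
  · apply key 0 r h0 hr
    simpa using hrd


/-- For a prime `p ≥ 3` and the integer-valued quadratic
`qr(n) = (α′/2)n² + (β′/2)n + γ` with `α′, β′` odd (encoded by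
`2 * qr n = α′ n² + β′ n + 2γ`), if one of the five conditions holds, then there
is some `n ≥ 1` for which `p ^ ⌈log_p n⌉` (i.e. `p ^ Nat.clog p n`) is not the
least positive integer modulo which `qr(0), …, qr(n−1)` are pairwise incongruent. -/
theorem stmt_14 (p : ℕ) (hp3 : 3 ≤ p) (hp : p.Prime) (α' β' γ : ℤ)
    (hα' : Odd α') (hβ' : Odd β')
    (qr : ℕ → ℤ) (hqr : ∀ n : ℕ, 2 * qr n = α' * (n : ℤ) ^ 2 + β' * (n : ℤ) + 2 * γ)
    (h : (α' = β') ∨ (¬ (p : ℤ) ∣ α') ∨ ((p : ℤ) ∣ β') ∨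
      (∃ (k : ℕ) (c : ℤ), 1 ≤ k ∧ α' = (p : ℤ) ^ k * c ∧ ¬ (p : ℤ) ∣ c ∧ ¬ c ∣ β') ∨
      (∃ (k : ℕ) (c : ℤ), 1 ≤ k ∧ α' = (p : ℤ) ^ k * c ∧ ¬ (p : ℤ) ∣ c ∧ c ∣ β' ∧
        5 ≤ p ^ k)) :
    ∃ n : ℕ, 1 ≤ n ∧
      ¬ IsLeast {m : ℕ | 0 < m ∧ ∀ i j : ℕ, i < j → j < n → ¬ ((m : ℤ) ∣ qr j - qr i)}
        (p ^ Nat.clog p n) := by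
  by_cases hpa : (p : ℤ) ∣ α'
  · by_cases hpb : (p : ℤ) ∣ β'
    · exact aux_dvd p hp3 hp α' β' γ qr hqr hpa hpb
    · exact aux_main p hp3 hp α' β' γ hα' hβ' qr hqr hpa hpb
  · exact aux_not_dvd p hp3 hp α' β' γ qr hqr hpa
end

section
/- Let p ≥ 5 be a prime number, let α′ and β′ be odd integers and γ an integer, and let qr(n) = (α′/2)n² + (β′/2)n + γ (an integer-valued quadratic). Then there exists an integer n ≥ 1 such that p^{⌈log_p n⌉} is not the least positive integer m for which qr(0), qr(1), …, qr(n−1) are pairwise incongruent modulo m. -/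
/-- For a prime `p ≥ 5` and the integer-valued quadratic
`qr(n) = (α′/2)n² + (β′/2)n + γ` with `α′, β′` odd (encoded by
`2 * qr n = α′ n² + β′ n + 2γ`), there is some `n ≥ 1` for which
`p ^ ⌈log_p n⌉` (i.e. `p ^ Nat.clog p n`) is not the least positive integer
modulo which `qr(0), …, qr(n−1)` are pairwise incongruent. -/
theorem stmt_15 (p : ℕ) (hp5 : 5 ≤ p) (hp : p.Prime) (α' β' γ : ℤ)
    (hα' : Odd α') (hβ' : Odd β')
    (qr : ℕ → ℤ) (hqr : ∀ n : ℕ, 2 * qr n = α' * (n : ℤ) ^ 2 + β' * (n : ℤ) + 2 * γ) :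
    ∃ n : ℕ, 1 ≤ n ∧
      ¬ IsLeast {m : ℕ | 0 < m ∧ ∀ i j : ℕ, i < j → j < n → ¬ ((m : ℤ) ∣ qr j - qr i)}
        (p ^ Nat.clog p n) := by
  have hpI : Prime (p : ℤ) := Nat.prime_iff_prime_int.mp hp
  have hdiff : ∀ i j : ℕ, 2 * (qr j - qr i) = ((j : ℤ) - i) * (α' * (i + j) + β') := by
    intro i j
    have h1 := hqr i
    have h2 := hqr j
    linear_combination h2 - h1
  have hp2 : ¬ (p : ℤ) ∣ 2 := by
    intro h
    have := Int.le_of_dvd (by norm_num) h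
    omega
  have hclog : ∀ n, 1 < n → n ≤ p → Nat.clog p n = 1 := by
    intro n h1 h2
    apply le_antisymm
    · exact (Nat.clog_le_iff_le_pow (by omega)).2 (by simpa using h2)
    · exact Nat.clog_pos (by omega) (by omega)
  obtain ⟨a, ha1, ha2⟩ : ∃ a : ℕ, 2 ^ a < p ∧ p < 2 ^ (a + 1) := by
    refine ⟨Nat.log 2 p, lt_of_le_of_ne (Nat.pow_log_le_self 2 (by omega)) ?_,
      Nat.lt_pow_succ_log_self (by norm_num) p⟩
    intro h
    have h2 : p ∣ 2 := by
      apply hp.dvd_of_dvd_pow (n := Nat.log 2 p)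
      rw [h]
    have := Nat.le_of_dvd (by norm_num) h2
    omega
  by_cases hpa : (p : ℤ) ∣ α'
  · by_cases h1 : (2 : ℤ) ^ (a + 1) ∣ α' + β'
    · by_cases hpb : (p : ℤ) ∣ β'
      · -- the modulus `p` fails for two terms
        refine ⟨2, by norm_num, ?_⟩
        rintro ⟨⟨-, h⟩, -⟩
        rw [hclog 2 (by norm_num) (by omega), pow_one] at h
        apply h 0 1 (by norm_num) (by norm_num)
        have h3 : (p : ℤ) ∣ 2 * (qr 1 - qr 0) := by
          rw [hdiff]
          simpa using dvd_add hpa hpb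
        exact (hpI.dvd_or_dvd h3).resolve_left hp2
      · refine ⟨p + 1, by omega, ?_⟩
        rintro ⟨-, h⟩
        have hc : 2 ≤ Nat.clog p (p + 1) := by
          by_contra hlt
          have h4 : Nat.clog p (p + 1) ≤ 1 := by omega
          rw [Nat.clog_le_iff_le_pow (by omega)] at h4
          simp at h4
        have hm := h (a := 2 ^ a * p) (by
          refine ⟨by positivity, ?_⟩
          intro i j hij hj hd
          push_cast at hd
          have hdp : (p : ℤ) ∣ 2 * (qr j - qr i) :=
            Dvd.dvd.mul_left ((Dvd.intro_left _ rfl).trans hd) 2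
          rw [hdiff] at hdp
          have hji : (p : ℤ) ∣ (j : ℤ) - i := by
            refine (hpI.dvd_or_dvd hdp).resolve_right ?_
            intro h5
            exact hpb ((dvd_add_right (Dvd.dvd.mul_right hpa _)).1 h5)
          have hle := Int.le_of_dvd (by omega) hji
          have hi0 : i = 0 := by omega
          have hjp : j = p := by omega
          subst hi0
          subst hjp
          have h6 : (2 : ℤ) ^ (a + 1) ∣ 2 * (qr j - qr 0) := by
            rw [pow_succ']
            exact mul_dvd_mul_left 2 ((Dvd.intro _ rfl).trans hd)
          rw [hdiff] at h6
          have hodd : Odd (j : ℤ) := by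
            exact_mod_cast hp.odd_of_ne_two (by omega)
          have hcop : ∀ x : ℤ, Odd x → IsCoprime ((2 : ℤ) ^ (a + 1)) x := fun x hx =>
            IsCoprime.pow_left (Int.isCoprime_two_left.2 hx)
          have h7 : (2 : ℤ) ^ (a + 1) ∣ α' * j + β' := by
            apply (hcop _ hodd).dvd_of_dvd_mul_left
            simpa using h6
          have h8 : (2 : ℤ) ^ (a + 1) ∣ (j : ℤ) - 1 := by
            apply (hcop _ hα').dvd_of_dvd_mul_left
            have := dvd_sub h7 h1
            convert this using 1
            ring
          have h9 := Int.le_of_dvd (by omega) h8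
          have h10 : (j : ℤ) < 2 ^ (a + 1) := by exact_mod_cast ha2
          omega)
        have h11 : p ^ 2 ≤ p ^ Nat.clog p (p + 1) := Nat.pow_le_pow_right (by omega) hc
        have h12 : 2 ^ a * p < p * p := Nat.mul_lt_mul_of_pos_right ha1 (by omega)
        nlinarith
    · -- `2 ^ a` discriminates two terms
      refine ⟨2, by norm_num, ?_⟩
      rintro ⟨-, h⟩
      rw [hclog 2 (by norm_num) (by omega), pow_one] at h
      have hm := h (a := 2 ^ a) (by
        refine ⟨by positivity, ?_⟩
        intro i j hij hj hd
        have hi0 : i = 0 := by omega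
        have hj1 : j = 1 := by omega
        subst hi0
        subst hj1
        push_cast at hd
        apply h1
        have h6 : (2 : ℤ) ^ (a + 1) ∣ 2 * (qr 1 - qr 0) := by
          rw [pow_succ']
          exact mul_dvd_mul_left 2 hd
        rw [hdiff] at h6
        simpa using h6)
      omega
  · -- `p` fails for `p` terms
    refine ⟨p, by omega, ?_⟩
    rintro ⟨⟨-, h⟩, -⟩
    rw [hclog p (by omega) le_rfl, pow_one] at h
    have key : ∀ i j : ℕ, i < j → j < p → ¬ (p : ℤ) ∣ α' * (i + j) + β' := by
      intro i j hij hj hd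
      apply h i j hij hj
      have h3 : (p : ℤ) ∣ 2 * (qr j - qr i) := by
        rw [hdiff]
        exact Dvd.dvd.mul_left hd _
      exact (hpI.dvd_or_dvd h3).resolve_left hp2
    obtain ⟨u, v, huv⟩ : IsCoprime α' (p : ℤ) := ((hpI.coprime_iff_not_dvd).2 hpa).symm
    have hp0 : (0 : ℤ) < p := by omega
    have hc0 := Int.emod_nonneg (-β' * u) hp0.ne'
    have hc1 := Int.emod_lt_of_pos (-β' * u) hp0
    have hcd : (p : ℤ) ∣ α' * ((-β' * u) % p) + β' := by
      have h4 := Int.emod_add_mul_ediv (-β' * u) p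
      refine ⟨-α' * ((-β' * u) / p) + β' * v, ?_⟩
      linear_combination α' * h4 - β' * huv
    obtain ⟨c, hc⟩ := Int.eq_ofNat_of_zero_le hc0
    rw [hc] at hcd hc1
    rcases Nat.eq_zero_or_pos c with h0 | hpos
    · subst h0
      apply key 1 (p - 1) (by omega) (by omega)
      have h5 : (p : ℤ) ∣ β' := by simpa using hcd
      have h6 : ((1 : ℕ) : ℤ) + ((p - 1 : ℕ) : ℤ) = p := by omega
      rw [h6]
      exact dvd_add (Dvd.intro_left _ rfl) h5
    · apply key 0 c hpos (by omega)
      simpa using hcd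
end

section
/- Let q(n) = αn² + βn + γ be a quadratic sequence with integer coefficients whose discriminator satisfies D_q(n) = 3^{⌈log_3 n⌉} for all n ≥ 1. Then there exist integers b and c such that α = 3c, β = bc, and 3 does not divide bc; furthermore, if b is even, then c is also even. -/
open ArithmeticFunction vonMangoldt Filter Topology

lemma hasSumTwist {q : ℕ} [NeZero q] {a : ZMod q} (t σ : ℝ) (hσ : 1 < σ) :
    HasSum (fun n : ℕ => ((residueClass a n / (n:ℝ) ^ σ : ℝ) : ℂ) *
      Complex.exp (Complex.I * (t * Real.log n : ℝ)))
      (LSeries (fun n => ((residueClass a n : ℝ) : ℂ)) ((σ : ℂ) - Complex.I * t)) := by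
  have hre : 1 < ((σ : ℂ) - Complex.I * t).re := by simpa using hσ
  have h := (LSeriesSummable_of_abscissaOfAbsConv_lt_re
    (lt_of_le_of_lt (abscissaOfAbsConv_residueClass_le_one a) (by exact_mod_cast hre))).LSeriesHasSum
  unfold LSeriesHasSum at h
  convert h using 2 with n
  rcases eq_or_ne n 0 with rfl | hn
  · simp [residueClass_apply_zero]
  · rw [LSeries.term_of_ne_zero hn, Complex.cpow_sub _ _ (by exact_mod_cast hn)]
    have h1 : ((n:ℂ)) ^ (Complex.I * t) = Complex.exp (Complex.I * (t * Real.log n : ℝ)) := by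
      rw [Complex.cpow_def_of_ne_zero (by exact_mod_cast hn), Complex.natCast_log.symm]
      push_cast
      congr 1; ring
    rw [h1]
    push_cast
    rw [Complex.ofReal_cpow (by positivity)]
    push_cast
    have := Complex.exp_ne_zero (Complex.I * (t * Real.log n : ℝ))
    push_cast at this
    field_simp

lemma tendstoTwist {q : ℕ} [NeZero q] {a : ZMod q} (ha : IsUnit a) (t : ℝ) :
    Tendsto (fun σ : ℝ => ((σ : ℂ) - 1) *
      LSeries (fun n => ((residueClass a n : ℝ) : ℂ)) ((σ : ℂ) - Complex.I * t)) (𝓝[>] 1)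
      (𝓝 (if t = 0 then (q.totient : ℂ)⁻¹ else 0)) := by
  have hlin : Tendsto (fun σ : ℝ => ((σ : ℂ) - 1)) (𝓝[>] 1) (𝓝 0) := by
    have : Continuous (fun σ : ℝ => ((σ : ℂ) - 1)) := by fun_prop
    simpa using (this.tendsto 1).mono_left nhdsWithin_le_nhds
  have hmap : Tendsto (fun σ : ℝ => ((σ : ℂ) - Complex.I * t)) (𝓝[>] 1)
      (𝓝[{s : ℂ | 1 ≤ s.re}] ((1 : ℂ) - Complex.I * t)) := by
    refine tendsto_nhdsWithin_of_tendsto_nhds_of_eventually_within _ ?_ ?_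
    · have : Continuous (fun σ : ℝ => ((σ : ℂ) - Complex.I * t)) := by fun_prop
      simpa using (this.tendsto 1).mono_left nhdsWithin_le_nhds
    · filter_upwards [self_mem_nhdsWithin] with σ hσ
      simpa using le_of_lt hσ
  have haux := ((continuousOn_LFunctionResidueClassAux a) ((1 : ℂ) - Complex.I * t)
    (by simp)).tendsto.comp hmap
  have h1 := hlin.mul haux
  rw [zero_mul] at h1
  have h2 : Tendsto (fun σ : ℝ => ((σ : ℂ) - 1) *
      ((q.totient : ℂ)⁻¹ / ((σ : ℂ) - Complex.I * t - 1))) (𝓝[>] 1)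
      (𝓝 (if t = 0 then (q.totient : ℂ)⁻¹ else 0)) := by
    split_ifs with ht
    · subst ht
      refine tendsto_const_nhds.congr' ?_
      filter_upwards [self_mem_nhdsWithin] with σ hσ
      have : (σ : ℂ) - 1 ≠ 0 := by
        have : (1:ℝ) < σ := hσ
        exact_mod_cast (sub_pos.2 this).ne'
      simp
      field_simp
    · have h3 : Tendsto (fun σ : ℝ => ((q.totient : ℂ)⁻¹ / ((σ : ℂ) - Complex.I * t - 1)))
          (𝓝[>] 1) (𝓝 ((q.totient : ℂ)⁻¹ / (((1:ℝ) : ℂ) - Complex.I * t - 1))) := by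
        refine Tendsto.mono_left (ContinuousAt.tendsto ?_) nhdsWithin_le_nhds
        refine ContinuousAt.div (by fun_prop) (by fun_prop) ?_
        simpa using ht
      simpa using hlin.mul h3
  have h4 := h1.add h2
  rw [zero_add] at h4
  refine h4.congr' ?_
  filter_upwards [self_mem_nhdsWithin] with σ hσ
  have := eqOn_LFunctionResidueClassAux ha (x := (σ : ℂ) - Complex.I * t) (by simpa using hσ)
  simp only [Function.comp, this]
  ring

lemma cosPow (θ : ℝ) (K : ℕ) :
    ((((1 + Real.cos θ) / 2) ^ K : ℝ) : ℂ) = ∑ m ∈ Finset.range (2 * K + 1),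
      ((2 * K).choose m / 4 ^ K : ℂ) * Complex.exp (Complex.I * (((m:ℝ) - K) * θ : ℝ)) := by
  have hu := Complex.exp_ne_zero (Complex.I * θ)
  have h1 : ((1 + Real.cos θ : ℝ) / 2 : ℂ) =
      (1 + Complex.exp (Complex.I * θ)) ^ 2 / (4 * Complex.exp (Complex.I * θ)) := by
    push_cast
    rw [Complex.cos, show -(θ:ℂ) * Complex.I = -(Complex.I * θ) by ring, Complex.exp_neg,
      mul_comm (θ : ℂ)]
    field_simp
    ring
  have h2 : ((((1 + Real.cos θ) / 2) ^ K : ℝ) : ℂ) = ((1 + Real.cos θ : ℝ) / 2 : ℂ) ^ K := by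
    push_cast; rfl
  rw [h2, h1, div_pow, ← pow_mul, add_comm, add_pow, Finset.sum_div]
  refine Finset.sum_congr rfl fun m _ => ?_
  have h3 : Complex.exp (Complex.I * (((m:ℝ) - K) * θ : ℝ)) =
      Complex.exp (Complex.I * θ) ^ m / Complex.exp (Complex.I * θ) ^ K := by
    rw [← Complex.exp_nat_mul, ← Complex.exp_nat_mul, ← Complex.exp_sub]
    push_cast
    congr 1; ring
  rw [h3, mul_pow]
  simp
  field_simp

lemma hasMean {q : ℕ} [NeZero q] {a : ZMod q} (ha : IsUnit a) (ω x0 d : ℝ) (hω : ω ≠ 0) (K : ℕ) :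
    ∃ V : ℝ → ℝ, (∀ σ, 1 < σ → HasSum (fun n : ℕ => (residueClass a n / (n:ℝ) ^ σ) *
        (((1 + Real.cos (ω * (Real.log n - x0))) / 2) ^ K - d)) (V σ)) ∧
      Tendsto (fun σ => (σ - 1) * V σ) (𝓝[>] 1)
        (𝓝 ((q.totient : ℝ)⁻¹ * ((2 * K).choose K / 4 ^ K - d))) := by
  set Lf : ℂ → ℂ := LSeries (fun n => ((residueClass a n : ℝ) : ℂ)) with hLf
  let co : ℕ → ℂ := fun m => ((2 * K).choose m / 4 ^ K : ℂ) *
    Complex.exp (Complex.I * (-(((m:ℝ) - K) * ω * x0) : ℝ))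
  let U : ℝ → ℂ := fun σ => ∑ m ∈ Finset.range (2 * K + 1),
    co m * Lf ((σ : ℂ) - Complex.I * (((m:ℝ) - K) * ω : ℝ)) - d * Lf ((σ : ℂ) - Complex.I * (0:ℝ))
  have hU : ∀ σ, 1 < σ → HasSum (fun n : ℕ => (((residueClass a n / (n:ℝ) ^ σ) *
        (((1 + Real.cos (ω * (Real.log n - x0))) / 2) ^ K - d) : ℝ) : ℂ)) (U σ) := by
    intro σ hσ
    have h1 := hasSum_sum (s := Finset.range (2 * K + 1)) (fun m _ =>
      (hasSumTwist (a := a) (((m:ℝ) - K) * ω) σ hσ).mul_left (co m))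
    have h2 := (hasSumTwist (a := a) 0 σ hσ).mul_left (d : ℂ)
    refine (h1.sub h2).congr_fun ?_ |> fun h => h
    intro n
    rw [Complex.ofReal_mul, Complex.ofReal_sub, cosPow, mul_sub, Finset.mul_sum]
    congr 1
    · refine Finset.sum_congr rfl fun m _ => ?_
      have : Complex.exp (Complex.I * (((m:ℝ) - K) * (ω * (Real.log n - x0)) : ℝ)) =
          Complex.exp (Complex.I * (-(((m:ℝ) - K) * ω * x0) : ℝ)) *
          Complex.exp (Complex.I * (((m:ℝ) - K) * ω * Real.log n : ℝ)) := by
        rw [← Complex.exp_add]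
        push_cast
        congr 1; ring
      rw [this]
      simp only [co]
      ring
    · simp; ring
  have hT : Tendsto (fun σ : ℝ => ((σ:ℂ) - 1) * U σ) (𝓝[>] 1)
      (𝓝 ((((q.totient : ℝ)⁻¹ * ((2 * K).choose K / 4 ^ K - d) : ℝ) : ℂ))) := by
    have h1 := tendsto_finsetSum (Finset.range (2 * K + 1)) (fun m _ =>
      (tendstoTwist ha (((m:ℝ) - K) * ω)).const_mul (co m))
    have h2 := (tendstoTwist ha 0).const_mul (d : ℂ)
    have h3 := h1.sub h2
    have e : ∑ m ∈ Finset.range (2 * K + 1), co m *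
        (if ((m:ℝ) - K) * ω = 0 then (q.totient : ℂ)⁻¹ else 0) =
        ((2 * K).choose K / 4 ^ K : ℂ) * (q.totient : ℂ)⁻¹ := by
      rw [Finset.sum_eq_single K]
      · simp [co]
      · intro m _ hm
        rw [if_neg, mul_zero]
        exact mul_ne_zero (sub_ne_zero.2 (by exact_mod_cast hm)) hω
      · intro h; exact absurd (Finset.mem_range.2 (by omega)) h
    rw [e] at h3
    have e2 : ((2 * K).choose K / 4 ^ K : ℂ) * (q.totient : ℂ)⁻¹ -
        (d : ℂ) * (if (0:ℝ) = 0 then (q.totient : ℂ)⁻¹ else 0) =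
        (((q.totient : ℝ)⁻¹ * ((2 * K).choose K / 4 ^ K - d) : ℝ) : ℂ) := by
      simp; ring
    rw [e2] at h3
    refine Tendsto.congr ?_ h3
    · intro σ
      simp only [U, mul_sub, Finset.mul_sum]
      congr 1
      · refine Finset.sum_congr rfl fun m _ => ?_
        ring
      · ring
  refine ⟨fun σ => (U σ).re, fun σ hσ => ?_, ?_⟩
  · simpa only [Complex.ofReal_re] using Complex.hasSum_re (hU σ hσ)
  · have := (Complex.continuous_re.tendsto _).comp hT
    rw [Complex.ofReal_re] at this
    refine this.congr fun σ => ?_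
    have : ((σ:ℂ) - 1) = ((σ - 1 : ℝ) : ℂ) := by push_cast; rfl
    simp only [Function.comp, this, Complex.re_ofReal_mul]

lemma cosBound (ω ε y : ℝ) (hω : 0 < ω) (hε : 0 < ε)
    (h : ∀ k : ℤ, ε ≤ |y - k * (2 * Real.pi / ω)|) :
    Real.cos (ω * y) ≤ Real.cos (ω * ε) := by
  have hpi := Real.pi_pos
  set P := 2 * Real.pi / ω with hP
  have hPpos : 0 < P := by positivity
  have hωP : ω * P = 2 * Real.pi := by rw [hP]; field_simp
  set k := round (y / P)
  have hk := abs_sub_round (y / P)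
  have hz : |y - k * P| ≤ P / 2 := by
    have : y - k * P = (y / P - k) * P := by field_simp
    rw [this, abs_mul, abs_of_pos hPpos]
    nlinarith
  have h1 : Real.cos (ω * y) = Real.cos (ω * |y - k * P|) := by
    rw [← abs_of_pos hω, ← abs_mul, Real.cos_abs, abs_of_pos hω, mul_sub,
      show ω * (k * P) = k * (ω * P) by ring, hωP, Real.cos_sub_int_mul_two_pi]
  rw [h1]
  apply Real.cos_le_cos_of_nonneg_of_le_pi
  · positivity
  · nlinarith
  · exact mul_le_mul_of_nonneg_left (h k) hω.le

lemma primeArc {q : ℕ} [NeZero q] {a : ZMod q} (ha : IsUnit a) (B : ℕ) :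
    ∃ r k : ℕ, r.Prime ∧ (r : ZMod q) = a ∧ B < k ∧ 5 * 3 ^ k < 2 * r ∧ r < 3 ^ (k + 1) := by
  by_contra! hno
  have hpi := Real.pi_pos
  have hl3 : 0 < Real.log 3 := Real.log_pos (by norm_num)
  set ω := 2 * Real.pi / Real.log 3 with hω
  have hωpos : 0 < ω := by positivity
  have hper : 2 * Real.pi / ω = Real.log 3 := by rw [hω]; field_simp
  set ε := Real.log (12 / 11) with hε
  have hεpos : 0 < ε := Real.log_pos (by norm_num)
  set x0 := Real.log (11 / 4) with hx0
  set δ := (1 + Real.cos (ω * ε)) / 2 with hδ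
  have hδ0 : 0 ≤ δ := by have := Real.neg_one_le_cos (ω * ε); rw [hδ]; linarith
  have hε3 : ε < Real.log 3 := Real.log_lt_log (by norm_num) (by norm_num)
  have hδ1 : δ < 1 := by
    have : Real.cos (ω * ε) < Real.cos 0 := by
      rcases le_or_gt (ω * ε) Real.pi with h | h
      · exact Real.cos_lt_cos_of_nonneg_of_le_pi le_rfl h (by positivity)
      · rw [Real.cos_zero]
        refine lt_of_le_of_ne (Real.cos_le_one _) fun h1 => ?_
        have h2 : ω * ε < 2 * Real.pi := by
          calc ω * ε < ω * Real.log 3 := by gcongr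
            _ = 2 * Real.pi := by rw [hω]; field_simp
        have := (Real.cos_eq_one_iff_of_lt_of_lt (by linarith) h2).1 h1
        linarith
    rw [Real.cos_zero] at this
    rw [hδ]; linarith
  -- choose K
  obtain ⟨K, hK⟩ : ∃ K : ℕ, δ ^ K < ((2 * K).choose K : ℝ) / 4 ^ K := by
    have := (tendsto_self_mul_const_pow_of_lt_one hδ0 hδ1).eventually_lt_const
      (show (0:ℝ) < 1 / 2 by norm_num)
    obtain ⟨K, hK1, hK2⟩ := (this.and (eventually_ge_atTop 1)).exists
    refine ⟨K, ?_⟩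
    have h4 := Nat.four_pow_le_two_mul_self_mul_centralBinom K hK2
    rw [Nat.centralBinom_eq_two_mul_choose] at h4
    have h4' : (4:ℝ) ^ K ≤ 2 * K * ((2 * K).choose K : ℝ) := by exact_mod_cast h4
    rw [lt_div_iff₀ (by positivity)]
    have hc : (0:ℝ) < ((2 * K).choose K : ℝ) := by
      exact_mod_cast Nat.choose_pos (by omega)
    have hd : 0 ≤ δ ^ K := by positivity
    calc δ ^ K * 4 ^ K ≤ δ ^ K * (2 * K * ((2 * K).choose K : ℝ)) := by gcongr
      _ = 2 * (K * δ ^ K) * ((2 * K).choose K : ℝ) := by ring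
      _ < 2 * (1 / 2) * ((2 * K).choose K : ℝ) := by gcongr
      _ = _ := by ring
  obtain ⟨V, hV, hVt⟩ := hasMean ha ω x0 (δ ^ K) hωpos.ne' K
  have hφ : 0 < (q.totient : ℝ)⁻¹ := inv_pos.mpr (mod_cast q.totient.pos_of_neZero)
  -- pointwise bound
  have hcos0 (x : ℝ) : 0 ≤ (1 + Real.cos x) / 2 := by
    have := Real.neg_one_le_cos x; linarith
  have hcos1 (x : ℝ) : (1 + Real.cos x) / 2 ≤ 1 := by
    have := Real.cos_le_one x; linarith
  have hf1 (x : ℝ) : ((1 + Real.cos x) / 2) ^ K - δ ^ K ≤ 1 := by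
    have := pow_le_one₀ (n := K) (hcos0 x) (hcos1 x)
    have : 0 ≤ δ ^ K := by positivity
    linarith
  have hfneg (r : ℕ) (hr : r.Prime) (hra : (r : ZMod q) = a) (hrB : 3 ^ (B + 2) ≤ r) :
      ((1 + Real.cos (ω * (Real.log r - x0))) / 2) ^ K - δ ^ K ≤ 0 := by
    rw [sub_nonpos]
    refine pow_le_pow_left₀ (hcos0 _) ?_ K
    have : Real.cos (ω * (Real.log r - x0)) ≤ Real.cos (ω * ε) := by
      refine cosBound ω ε _ hωpos hεpos ?_
      rw [hper]
      by_contra! hk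
      obtain ⟨k, hk⟩ := hk
      rw [abs_lt] at hk
      have hr0 : (0:ℝ) < r := by exact_mod_cast hr.pos
      have hz : (k:ℝ) * Real.log 3 = Real.log ((3:ℝ) ^ k) := by rw [Real.log_zpow]
      have h3k : (0:ℝ) < (3:ℝ) ^ k := by positivity
      have hup : (r:ℝ) < 3 * (3:ℝ) ^ k := by
        rw [← Real.log_lt_log_iff hr0 (by positivity)]
        have : Real.log (3 * (3:ℝ)^k) = ε + x0 + Real.log ((3:ℝ)^k) := by
          rw [hε, hx0, ← Real.log_mul (by norm_num) (by norm_num),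
            ← Real.log_mul (by norm_num) (by positivity)]
          norm_num
        rw [this, ← hz]; linarith [hk.2]
      have hlo : 5 * (3:ℝ) ^ k < 2 * r := by
        have h1 : (121 / 48 : ℝ) * (3:ℝ) ^ k < r := by
          rw [← Real.log_lt_log_iff (by positivity) hr0]
          have : Real.log ((121/48) * (3:ℝ)^k) = -ε + x0 + Real.log ((3:ℝ)^k) := by
            rw [hε, hx0, ← Real.log_inv, ← Real.log_mul (by norm_num) (by norm_num),
              ← Real.log_mul (by norm_num) (by positivity)]
            norm_num
          rw [this, ← hz]; linarith [hk.1]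
        linarith
      have hkB : ((B + 2 : ℕ) : ℤ) < k + 1 := by
        have : (3:ℝ) ^ ((B + 2 : ℕ) : ℤ) < (3:ℝ) ^ (k + 1) := by
          rw [zpow_add_one₀ (by norm_num), zpow_natCast]
          have : ((3:ℝ) ^ (B + 2)) ≤ r := by exact_mod_cast hrB
          linarith
        exact (zpow_lt_zpow_iff_right₀ (by norm_num)).1 this
      lift k to ℕ using by omega
      rw [zpow_natCast] at hup hlo
      have hup' : r < 3 ^ (k + 1) := by
        rw [pow_succ, mul_comm]; exact_mod_cast hup
      have hlo' : 5 * 3 ^ k < 2 * r := by exact_mod_cast hlo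
      have := hno r k hr hra (by omega) hlo'
      omega
    rw [hδ]; linarith
  -- dominating summable function
  let G : ℕ → ℝ := fun n => (if n.Prime then 0 else residueClass a n) / n +
    (if n < 3 ^ (B + 2) then residueClass a n / n else 0)
  have hG : Summable G := by
    refine (summable_residueClass_non_primes_div a).add ?_
    refine summable_of_ne_finset_zero (s := Finset.range (3 ^ (B + 2))) ?_
    intro n hn
    rw [if_neg (by simpa using hn)]
  have hVle : ∀ σ, 1 < σ → V σ ≤ ∑' n, G n := by
    intro σ hσ
    refine hasSum_le ?_ (hV σ hσ) hG.hasSum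
    intro n
    have hR := residueClass_nonneg a n
    have hR0 : 0 ≤ residueClass a n / (n:ℝ) := by positivity
    have hle : residueClass a n / (n:ℝ) ^ σ ≤ residueClass a n / (n:ℝ) := by
      rcases n.eq_zero_or_pos with rfl | hn
      · simp
      · refine div_le_div_of_nonneg_left hR (mod_cast hn) ?_
        conv_lhs => rw [← Real.rpow_one n]
        exact Real.rpow_le_rpow_of_exponent_le (by norm_cast) hσ.le
    have hRs : 0 ≤ residueClass a n / (n:ℝ) ^ σ := by positivity
    have hb : (residueClass a n / (n:ℝ) ^ σ) *
        (((1 + Real.cos (ω * (Real.log n - x0))) / 2) ^ K - δ ^ K) ≤ residueClass a n / (n:ℝ) := by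
      calc _ ≤ (residueClass a n / (n:ℝ) ^ σ) * 1 := by gcongr; exact hf1 _
        _ ≤ _ := by rw [mul_one]; exact hle
    simp only [G]
    by_cases hn : n.Prime
    · rw [if_pos hn, zero_div, zero_add]
      split_ifs with hnB
      · exact hb
      · by_cases hna : (n : ZMod q) = a
        · exact mul_nonpos_of_nonneg_of_nonpos hRs (hfneg n hn hna (by omega))
        · have : residueClass a n = 0 := by
            simp [residueClass, hna]
          simp [this]
    · rw [if_neg hn]
      refine hb.trans (le_add_of_nonneg_right ?_)
      split_ifs <;> simp [hR0]
  have hlim : Tendsto (fun σ : ℝ => (σ - 1) * ∑' n, G n) (𝓝[>] 1) (𝓝 0) := by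
    have : Continuous (fun σ : ℝ => (σ - 1) * ∑' n, G n) := by fun_prop
    simpa using (this.tendsto 1).mono_left nhdsWithin_le_nhds
  have := le_of_tendsto_of_tendsto hVt hlim (by
    filter_upwards [self_mem_nhdsWithin] with σ hσ
    have : (1:ℝ) < σ := hσ
    exact mul_le_mul_of_nonneg_left (hVle σ this) (by linarith))
  have h2 : 0 < (q.totient : ℝ)⁻¹ * (((2 * K).choose K : ℝ) / 4 ^ K - δ ^ K) :=
    mul_pos hφ (by linarith)
  linarith

lemma notDvdSmall (r : ℕ) (g : ℤ) (hg : g ≠ 0) (h : g.natAbs < r) : ¬ (r : ℤ) ∣ g := fun hd => by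
  have := Int.le_of_dvd (abs_pos.2 hg) ((dvd_abs _ _).2 hd)
  rw [Int.abs_eq_natAbs] at this
  omega

lemma noBig (g b : ℤ) (A : ℕ) (hg : g ≠ 0) (hA : 2 ≤ A) (hcop : IsCoprime (A : ℤ) b)
    (h3 : ¬ (3 : ℤ) ∣ b)
    (H : ∀ k m : ℕ, 3 ^ k < m → m < 3 ^ (k + 1) → ∃ i j : ℕ, i < j ∧ j ≤ 3 ^ k ∧
      (m : ℤ) ∣ ((j : ℤ) - i) * ((3 * (g * A)) * ((i : ℤ) + j) + g * b)) : False := by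
  have : NeZero (3 * A) := ⟨by omega⟩
  have hc3 : IsCoprime (3 : ℤ) b := (Int.prime_three.coprime_iff_not_dvd).2 h3
  have hcN : IsCoprime ((3 * A : ℕ) : ℤ) b := by
    push_cast; exact IsCoprime.mul_left hc3 hcop
  have hu : IsUnit (((-b : ℤ)) : ZMod (3 * A)) :=
    (ZMod.coe_int_isUnit_iff_isCoprime _ _).2 hcN.neg_right
  obtain ⟨r, k, hr, hra, hk, hlo, hup⟩ := primeArc hu (2 * b.natAbs + g.natAbs)
  have hT : k < 3 ^ k := Nat.lt_pow_self (by norm_num)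
  obtain ⟨i, j, hij, hj, hd⟩ := H k r (by omega) hup
  set T : ℕ := 3 ^ k with hTdef
  have hp : Prime (r : ℤ) := Nat.prime_iff_prime_int.1 hr
  have hd' : (r : ℤ) ∣ 3 * A * ((i : ℤ) + j) + b := by
    rw [show ((j : ℤ) - i) * ((3 * (g * A)) * ((i : ℤ) + j) + g * b) =
      ((j : ℤ) - i) * (g * (3 * A * ((i : ℤ) + j) + b)) by ring] at hd
    rcases hp.dvd_or_dvd hd with h | h
    · exact absurd h (notDvdSmall r _ (by omega) (by omega))
    · rcases hp.dvd_or_dvd h with h | h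
      · exact absurd h (notDvdSmall r _ hg (by omega))
      · exact h
  obtain ⟨y, hy⟩ := hd'
  have hrb : ((3 * A : ℕ) : ℤ) ∣ r + b := by
    rw [← ZMod.intCast_zmod_eq_zero_iff_dvd]
    push_cast at hra ⊢
    rw [hra]; ring
  have hy1 : ((3 * A : ℕ) : ℤ) ∣ y + 1 := by
    refine hcN.dvd_of_dvd_mul_left ?_
    have : b * (y + 1) = y * (r + b) - ((3 * A : ℕ) : ℤ) * ((i : ℤ) + j) := by
      push_cast; linear_combination hy
    rw [this]
    exact dvd_sub (hrb.mul_left _) (dvd_mul_right _ _)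
  have hx : 0 ≤ (3 * A * ((i : ℤ) + j)) := by positivity
  have hypos : 0 < y + 1 := by
    by_contra hneg
    have : (r:ℤ) * y ≤ r * (-1) := mul_le_mul_of_nonneg_left (by omega) (by omega)
    omega
  have hyge := Int.le_of_dvd hypos hy1
  push_cast at hyge
  have h1 : (r:ℤ) * (3 * A - 1) ≤ 3 * A * ((i : ℤ) + j) + b := by
    rw [hy]; exact mul_le_mul_of_nonneg_left (by omega) (by omega)
  have h2 : (A:ℤ) * ((i : ℤ) + j) ≤ A * (2 * T) :=
    mul_le_mul_of_nonneg_left (by omega) (by omega)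
  have h3' : (5 * T : ℤ) * (3 * A - 1) ≤ 2 * r * (3 * A - 1) :=
    mul_le_mul_of_nonneg_right (by omega) (by omega)
  have h4 : 2 * (T:ℤ) ≤ A * T := mul_le_mul_of_nonneg_right (by omega) (by omega)
  have h5 : (T : ℤ) ≤ 2 * b := by nlinarith
  omega

/-- If a quadratic sequence `q(n) = αn² + βn + γ` with integer
coefficients has discriminator `3 ^ ⌈log₃ n⌉` (i.e. `3 ^ Nat.clog 3 n`) for all
`n ≥ 1`, then `α = 3c`, `β = bc` with `3 ∤ bc`, and if `b` is even then so is `c`. -/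
theorem stmt_16 (α β γ : ℤ)
    (q : ℕ → ℤ) (hq : ∀ n : ℕ, q n = α * (n : ℤ) ^ 2 + β * (n : ℤ) + γ)
    (hdisc : ∀ n : ℕ, 1 ≤ n →
      IsLeast {m : ℕ | 0 < m ∧ ∀ i j : ℕ, i < j → j < n → ¬ ((m : ℤ) ∣ q j - q i)}
        (3 ^ Nat.clog 3 n)) :
    ∃ b c : ℤ, α = 3 * c ∧ β = b * c ∧ ¬ ((3 : ℤ) ∣ b * c) ∧ (Even b → Even c) := by
  have hdiff (i j : ℕ) : q j - q i = ((j : ℤ) - i) * (α * ((i : ℤ) + j) + β) := by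
    rw [hq, hq]; ring
  have hcl (k n : ℕ) (h1 : 3 ^ k < n) (h2 : n ≤ 3 ^ (k + 1)) : Nat.clog 3 n = k + 1 := by
    apply le_antisymm
    · exact Nat.clog_le_of_le_pow h2
    · exact (Nat.lt_clog_iff_pow_lt (by norm_num)).2 h1
  have c2 : Nat.clog 3 2 = 1 := hcl 0 2 (by norm_num) (by norm_num)
  have c3 : Nat.clog 3 3 = 1 := hcl 0 3 (by norm_num) (by norm_num)
  -- n = 3
  have d3 := (hdisc 3 (by norm_num)).1
  rw [c3] at d3
  have d31 := d3.2 0 1 (by norm_num) (by norm_num)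
  have d32 := d3.2 0 2 (by norm_num) (by norm_num)
  have d33 := d3.2 1 2 (by norm_num) (by norm_num)
  simp only [hq] at d31 d32 d33
  norm_num at d31 d32 d33
  have hα : (3:ℤ) ∣ α := by
    have h1 : α % 3 = 0 ∨ α % 3 = 1 ∨ α % 3 = 2 := by omega
    have h2 : β % 3 = 0 ∨ β % 3 = 1 ∨ β % 3 = 2 := by omega
    rcases h1 with h1 | h1 | h1 <;> rcases h2 with h2 | h2 | h2 <;> omega
  have hβ : ¬ (3:ℤ) ∣ β := by omega
  -- n = 2
  have d2 : (2:ℤ) ∣ α + β := by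
    by_contra hcon
    have := (hdisc 2 (by norm_num)).2 (show (2:ℕ) ∈ _ from ⟨by norm_num, by
      intro i j hij hj
      obtain rfl : i = 0 := by omega
      obtain rfl : j = 1 := by omega
      simp only [hq]
      norm_num
      omega⟩)
    rw [c2] at this
    norm_num at this
  have H : ∀ k m : ℕ, 3 ^ k < m → m < 3 ^ (k + 1) → ∃ i j : ℕ, i < j ∧ j ≤ 3 ^ k ∧
      (m : ℤ) ∣ ((j : ℤ) - i) * (α * ((i : ℤ) + j) + β) := by
    intro k m h1 h2
    by_contra! hcon
    have := (hdisc (3 ^ k + 1) (by omega)).2 (show m ∈ _ from ⟨by omega, by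
      intro i j hij hj
      rw [hdiff]
      exact hcon i j hij (by omega)⟩)
    rw [hcl k _ (by omega) (by rw [pow_succ]; have : 0 < 3 ^ k := by positivity
                               omega)] at this
    omega
  obtain ⟨c, rfl⟩ := hα
  have hc0 : c ≠ 0 := by
    rintro rfl
    have hβ0 : β ≠ 0 := by rintro rfl; simp at hβ
    obtain ⟨r, k, hr, -, hk, hlo, hup⟩ := primeArc (q := 1) (a := 1) isUnit_one β.natAbs
    have hT : k < 3 ^ k := Nat.lt_pow_self (by norm_num)
    obtain ⟨i, j, hij, hj, hd⟩ := H k r (by omega) hup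
    have hp : Prime (r : ℤ) := Nat.prime_iff_prime_int.1 hr
    rcases hp.dvd_or_dvd hd with h | h
    · exact absurd h (notDvdSmall r _ (by omega) (by omega))
    · simp only [mul_zero, zero_mul, zero_add] at h
      exact absurd h (notDvdSmall r _ hβ0 (by omega))
  have hdvd : c ∣ β := by
    obtain ⟨g, c', b', hg, hcop, hc, hb⟩ : ∃ g c' b' : ℤ, g ≠ 0 ∧ IsCoprime c' b' ∧
        c = g * c' ∧ β = g * b' := by
      have hgpos : 0 < Int.gcd c β := Int.gcd_pos_of_ne_zero_left _ hc0
      obtain ⟨c', b', hcop, hc, hb⟩ := Int.exists_gcd_one hgpos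
      exact ⟨(Int.gcd c β : ℤ), c', b', by exact_mod_cast hgpos.ne',
        Int.isCoprime_iff_gcd_eq_one.2 hcop, by rw [mul_comm]; exact hc, by rw [mul_comm]; exact hb⟩
    have hb3 : ¬ (3:ℤ) ∣ b' := fun h => hβ (hb ▸ h.mul_left g)
    have hc'0 : c' ≠ 0 := by rintro rfl; simp at hc; exact hc0 hc
    rcases Nat.lt_or_ge c'.natAbs 2 with h1 | h2
    · have hu : IsUnit c' := Int.isUnit_iff_natAbs_eq.2 (by omega)
      rw [hc, hb]
      exact mul_dvd_mul_left g hu.dvd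
    · exfalso
      rcases le_or_gt 0 c' with hs | hs
      · lift c' to ℕ using hs
        refine noBig g b' c' hg (by simpa using h2) hcop hb3 ?_
        rw [hc, hb] at H
        exact H
      · have hcast : ((c'.natAbs : ℕ) : ℤ) = -c' := by omega
        refine noBig (-g) (-b') c'.natAbs (neg_ne_zero.2 hg) h2 ?_ (by simpa using hb3) ?_
        · rw [hcast]; exact hcop.neg_neg
        · rw [hc, hb] at H
          rw [hcast]
          simpa only [neg_mul_neg] using H
  obtain ⟨b, rfl⟩ := hdvd
  refine ⟨b, c, rfl, mul_comm _ _, by rwa [mul_comm], fun hb => ?_⟩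
  have h1 : Even (c * (3 + b)) := by
    rw [show c * (3 + b) = 3 * c + c * b by ring]
    exact even_iff_two_dvd.2 d2
  rcases Int.even_mul.1 h1 with h | h
  · exact h
  · exfalso
    rw [Int.even_add] at h
    exact absurd (h.2 hb) (by decide)
end
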